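/- arXiv:2312.05997 — 2 statements merged into one kernel-verified Lean document; each statement's English description precedes it below -/
import Mathlib

section
/- Let (E₁,…,Eₙ) be a complete exceptional sequence over a hereditary algebra Λ. The following are equivalent: (1) Eₖ is both relatively projective and relatively injective; (2) there is a vertex i of the quiver of Λ that lies in the support of Eₖ but not in the support of any E_j with j ≠ k; (3) there is an indecomposable projective module P_i such that (E₁,…,Ê_k,…,Eₙ,P_i) is a complete exceptional sequence (where Ê_k means Eₖ is omitted). -/
open CategoryTheory

universe u

variable {A : Type u} [Ring A]

namespace ExcSeq

/-- `Hom(X, Y) = 0`. -/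
def homZero (X Y : ModuleCat.{u} A) : Prop := ∀ f : X ⟶ Y, f = 0

/-- `Ext¹(X, Y) = 0`: every short exact sequence `0 → Y → E → X → 0` splits. -/
def extZero (X Y : ModuleCat.{u} A) : Prop :=
  ∀ (E : ModuleCat.{u} A) (i : Y ⟶ E) (p : E ⟶ X) (w : i ≫ p = 0),
    (ShortComplex.mk i p w).ShortExact → ∃ s : X ⟶ E, s ≫ p = 𝟙 X

/-- `Y` belongs to the right perpendicular category `X^⊥`. -/
def rperp (X Y : ModuleCat.{u} A) : Prop := homZero X Y ∧ extZero X Y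

/-- `Y` belongs to the left perpendicular category `^⊥X`. -/
def lperp (X Y : ModuleCat.{u} A) : Prop := homZero Y X ∧ extZero Y X

/-- An exceptional module: finitely generated, rigid, with division algebra endomorphism
ring (in particular nonzero and indecomposable). -/
def ExceptionalMod (X : ModuleCat.{u} A) : Prop :=
  Module.Finite A X ∧ extZero X X ∧ Nontrivial X ∧ ∀ f : X ⟶ X, f ≠ 0 → IsIso f

/-- An exceptional sequence `(E 0, …, E (n-1))`. -/
def IsExcSeq {n : ℕ} (E : Fin n → ModuleCat.{u} A) : Prop :=
  (∀ i, ExceptionalMod (E i)) ∧ ∀ i j : Fin n, i < j → rperp (E j) (E i)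

/-- A complete exceptional sequence: an exceptional sequence of maximal length. -/
def CompleteES {n : ℕ} (E : Fin n → ModuleCat.{u} A) : Prop :=
  IsExcSeq E ∧ ∀ (m : ℕ) (F : Fin m → ModuleCat.{u} A), IsExcSeq F → m ≤ n

/-- The wide subcategory `𝒜ₖ = (E_{k+1} ⊕ ⋯ ⊕ Eₙ)^⊥`. -/
def Aperp {n : ℕ} (E : Fin n → ModuleCat.{u} A) (k : Fin n) (X : ModuleCat.{u} A) : Prop :=
  ∀ j : Fin n, k < j → rperp (E j) X

/-- The wide subcategory `ℬₖ = ^⊥(E₁ ⊕ ⋯ ⊕ E_{k-1})`. -/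
def Bperp {n : ℕ} (E : Fin n → ModuleCat.{u} A) (k : Fin n) (X : ModuleCat.{u} A) : Prop :=
  ∀ j : Fin n, j < k → lperp (E j) X

/-- `X` is a projective object of the subcategory (given by the predicate) `C`. -/
def ProjIn (C : ModuleCat.{u} A → Prop) (X : ModuleCat.{u} A) : Prop :=
  C X ∧ ∀ (Y Z : ModuleCat.{u} A), C Y → C Z → ∀ p : Y ⟶ Z, Epi p →
    ∀ f : X ⟶ Z, ∃ g : X ⟶ Y, g ≫ p = f

/-- `X` is an injective object of the subcategory (given by the predicate) `C`. -/
def InjIn (C : ModuleCat.{u} A → Prop) (X : ModuleCat.{u} A) : Prop :=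
  C X ∧ ∀ (Y Z : ModuleCat.{u} A), C Y → C Z → ∀ i : Y ⟶ Z, Mono i →
    ∀ f : Y ⟶ X, ∃ g : Z ⟶ X, i ≫ g = f

/-- `E k` is relatively projective in the exceptional sequence `E`. -/
def RelProj {n : ℕ} (E : Fin n → ModuleCat.{u} A) (k : Fin n) : Prop :=
  ProjIn (Aperp E k) (E k)

/-- `E k` is relatively injective in the exceptional sequence `E`. -/
def RelInj {n : ℕ} (E : Fin n → ModuleCat.{u} A) (k : Fin n) : Prop :=
  InjIn (Bperp E k) (E k)

/-- `Λ` is hereditary: every submodule of a projective module is projective. -/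
def Hereditary (A : Type u) [Ring A] : Prop :=
  ∀ (P : ModuleCat.{u} A), Projective P →
    ∀ S : Submodule A P, Projective (ModuleCat.of A S)

/-- The simple module `S` is in the support of `M`, i.e. `S` is (isomorphic to) a
composition factor (subquotient) of `M`. -/
def InSupport (S M : ModuleCat.{u} A) : Prop :=
  ∃ (N₁ N₂ : Submodule A M), N₁ ≤ N₂ ∧
    Nonempty ((ModuleCat.of A (N₂ ⧸ (Submodule.comap N₂.subtype N₁))) ≅ S)


/-- A module is indecomposable: it is nonzero and admits no nontrivial direct sum
decomposition. -/
def IndecMod (M : ModuleCat.{u} A) : Prop :=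
  Nontrivial M ∧ ∀ N₁ N₂ : Submodule A M, IsCompl N₁ N₂ → N₁ = ⊥ ∨ N₂ = ⊥



open CategoryTheory.Abelian

section Helpers

section basics
variable {A : Type u} [Ring A]

variable (A) in
def H0 (X Y : Type u) [AddCommGroup X] [Module A X] [AddCommGroup Y] [Module A Y] : Prop :=
  ∀ f : X →ₗ[A] Y, f = 0

variable (A) in
def H1 (X Y : Type u) [AddCommGroup X] [Module A X] [AddCommGroup Y] [Module A Y] : Prop :=
  ∀ e : Ext (ModuleCat.of A X) (ModuleCat.of A Y) 1, e = 0

variable (A) in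
def RP (X Y : Type u) [AddCommGroup X] [Module A X] [AddCommGroup Y] [Module A Y] : Prop :=
  H0 A X Y ∧ H1 A X Y

variable {X Y Z N : Type u} [AddCommGroup X] [Module A X] [AddCommGroup Y] [Module A Y]
  [AddCommGroup Z] [Module A Z] [AddCommGroup N] [Module A N]

structure SES (f : X →ₗ[A] Y) (g : Y →ₗ[A] Z) : Prop where
  inj : Function.Injective f
  ex : Function.Exact f g
  surj : Function.Surjective g

abbrev scx (f : X →ₗ[A] Y) (g : Y →ₗ[A] Z) (h : Function.Exact f g) :
    ShortComplex (ModuleCat.{u} A) :=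
  ShortComplex.mk (ModuleCat.ofHom f) (ModuleCat.ofHom g) (by
    rw [← ModuleCat.ofHom_comp, h.linearMap_comp_eq_zero]; rfl)

theorem SES.se {f : X →ₗ[A] Y} {g : Y →ₗ[A] Z} (h : SES f g) : (scx f g h.ex).ShortExact where
  exact := by
    rw [ShortComplex.ShortExact.moduleCat_exact_iff_function_exact]
    exact h.ex
  mono_f := (ModuleCat.mono_iff_injective _).2 h.inj
  epi_g := (ModuleCat.epi_iff_surjective _).2 h.surj

variable {f : X →ₗ[A] Y} {g : Y →ₗ[A] Z}

theorem SES.lift (h : SES f g) (hN : H1 A N X) (φ : N →ₗ[A] Z) : ∃ ψ : N →ₗ[A] Y, g ∘ₗ ψ = φ := by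
  obtain ⟨x, hx⟩ := Ext.covariant_sequence_exact₃ (ModuleCat.of A N) h.se
    (Ext.mk₀ (ModuleCat.ofHom φ)) (n₁ := 1) (by simp) (hN _)
  obtain ⟨y, rfl⟩ := Ext.mk₀_bijective _ _ |>.2 x
  rw [Ext.mk₀_comp_mk₀] at hx
  have := (Ext.mk₀_bijective _ _).1 hx
  refine ⟨y.hom, ?_⟩
  have h2 := congrArg ModuleCat.Hom.hom this
  exact h2

theorem SES.ext (h : SES f g) (hN : H1 A Z N) (φ : X →ₗ[A] N) : ∃ ψ : Y →ₗ[A] N, ψ ∘ₗ f = φ := by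
  obtain ⟨x, hx⟩ := Ext.contravariant_sequence_exact₁ h.se (ModuleCat.of A N)
    (Ext.mk₀ (ModuleCat.ofHom φ)) (n₁ := 1) (by simp) (hN _)
  obtain ⟨y, rfl⟩ := Ext.mk₀_bijective _ _ |>.2 x
  rw [Ext.mk₀_comp_mk₀] at hx
  have := (Ext.mk₀_bijective _ _).1 hx
  refine ⟨y.hom, ?_⟩
  have h2 := congrArg ModuleCat.Hom.hom this
  exact h2

theorem H0_of_inj (hf : Function.Injective f) (h : H0 A N Y) : H0 A N X := fun φ => by
  ext x; apply hf; simpa using LinearMap.congr_fun (h (f ∘ₗ φ)) x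

theorem H0_of_surj (hf : Function.Surjective g) (h : H0 A Y N) : H0 A Z N := fun φ => by
  ext x; obtain ⟨y, rfl⟩ := hf x; simpa using LinearMap.congr_fun (h (φ ∘ₗ g)) y

/-- factor through the kernel -/
theorem SES.factor (h : SES f g) (φ : N →ₗ[A] Y) (hφ : g ∘ₗ φ = 0) : ∃ ψ : N →ₗ[A] X, f ∘ₗ ψ = φ := by
  have hr : ∀ x, φ x ∈ LinearMap.range f := fun x => by
    have := (h.ex (φ x)).1 (LinearMap.congr_fun hφ x)
    exact this
  refine ⟨(LinearEquiv.ofInjective f h.inj).symm.toLinearMap ∘ₗ φ.codRestrict _ hr, ?_⟩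
  ext x
  have := (LinearEquiv.ofInjective f h.inj).apply_symm_apply (φ.codRestrict _ hr x)
  have := congrArg Subtype.val this
  simpa using this

theorem SES.cofactor (h : SES f g) (φ : Y →ₗ[A] N) (hφ : φ ∘ₗ f = 0) : ∃ ψ : Z →ₗ[A] N, ψ ∘ₗ g = φ := by
  have hk : LinearMap.ker g ≤ LinearMap.ker φ := fun x hx => by
    obtain ⟨y, rfl⟩ := (h.ex x).1 hx
    exact LinearMap.congr_fun hφ y
  let e := g.quotKerEquivOfSurjective h.surj
  refine ⟨(LinearMap.ker g).liftQ φ hk ∘ₗ e.symm.toLinearMap, ?_⟩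
  ext x
  have : e.symm (g x) = Submodule.Quotient.mk x := by
    rw [LinearEquiv.symm_apply_eq]; rfl
  simp [this]

theorem SES.H0_mid (h : SES f g) (h1 : H0 A N X) (h3 : H0 A N Z) : H0 A N Y := fun φ => by
  obtain ⟨ψ, rfl⟩ := h.factor φ (h3 _)
  rw [h1 ψ]; simp

theorem SES.H0_mid' (h : SES f g) (h1 : H0 A X N) (h3 : H0 A Z N) : H0 A Y N := fun φ => by
  obtain ⟨ψ, rfl⟩ := h.cofactor φ (h1 _)
  rw [h3 ψ]; simp

theorem SES.H0_quot (h : SES f g) (h2 : H0 A N Y) (h1 : H1 A N X) : H0 A N Z := fun φ => by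
  obtain ⟨ψ, rfl⟩ := h.lift h1 φ
  rw [h2 ψ]; simp

theorem SES.H0_sub' (h : SES f g) (h2 : H0 A Y N) (h1 : H1 A Z N) : H0 A X N := fun φ => by
  obtain ⟨ψ, rfl⟩ := h.ext h1 φ
  rw [h2 ψ]; simp

theorem H0.ext0 (h : H0 A X Y) (e : Ext (ModuleCat.of A X) (ModuleCat.of A Y) 0) : e = 0 := by
  obtain ⟨y, rfl⟩ := Ext.mk₀_bijective _ _ |>.2 e
  have : y = 0 := by
    apply ModuleCat.hom_ext
    exact h y.hom
  rw [this, Ext.mk₀_zero]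

theorem SES.H1_sub (h : SES f g) (h0 : H0 A N Z) (h1 : H1 A N Y) : H1 A N X := fun e => by
  obtain ⟨x, hx⟩ := Ext.covariant_sequence_exact₁ (ModuleCat.of A N) h.se e (h1 _) (n₀ := 0) rfl
  have h0x : x = 0 := H0.ext0 h0 x
  rw [h0x, Ext.zero_comp] at hx
  exact hx.symm

theorem SES.H1_quot' (h : SES f g) (h0 : H0 A X N) (h1 : H1 A Y N) : H1 A Z N := fun e => by
  obtain ⟨x, hx⟩ := Ext.contravariant_sequence_exact₃ h.se (ModuleCat.of A N) e (h1 _) (n₀ := 0) rfl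
  have h0x : x = 0 := H0.ext0 h0 x
  rw [h0x, Ext.comp_zero] at hx
  exact hx.symm

theorem SES.H1_mid (h : SES f g) (h0 : H1 A N X) (h1 : H1 A N Z) : H1 A N Y := fun e => by
  obtain ⟨x, hx⟩ := Ext.covariant_sequence_exact₂ (ModuleCat.of A N) h.se e (h1 _)
  have h0x : x = 0 := h0 x
  rw [h0x, Ext.zero_comp] at hx
  exact hx.symm

theorem SES.H1_mid' (h : SES f g) (h0 : H1 A X N) (h1 : H1 A Z N) : H1 A Y N := fun e => by
  obtain ⟨x, hx⟩ := Ext.contravariant_sequence_exact₂ h.se (ModuleCat.of A N) e (h0 _)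
  have h0x : x = 0 := h1 x
  rw [h0x, Ext.comp_zero] at hx
  exact hx.symm

theorem ses_ker (hg : Function.Surjective g) : SES (LinearMap.ker g).subtype g where
  inj := Subtype.val_injective
  ex := LinearMap.exact_subtype_ker_map g
  surj := hg

theorem ses_sub (U : Submodule A Y) : SES U.subtype U.mkQ where
  inj := Subtype.val_injective
  ex := LinearMap.exact_subtype_mkQ U
  surj := U.mkQ_surjective

theorem ses_range (φ : X →ₗ[A] Y) : SES (LinearMap.ker φ).subtype φ.rangeRestrict where
  inj := Subtype.val_injective
  ex := by
    intro x
    simp [Subtype.ext_iff]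
  surj := φ.surjective_rangeRestrict

theorem proj_H1 (X : Type u) [AddCommGroup X] [Module A X] [Module.Projective A X]
    (Y : Type u) [AddCommGroup Y] [Module A Y] : H1 A X Y := fun e =>
  Ext.eq_zero_of_projective (P := ModuleCat.of A X) (n := 0) e

theorem her_proj (hA : Hereditary A) (P : Type u) [AddCommGroup P] [Module A P] [Module.Projective A P]
    (S : Submodule A P) : Module.Projective A S := by
  have := hA (ModuleCat.of A P) inferInstance S
  exact (IsProjective.iff_projective S).2 this

theorem ext2 (hA : Hereditary A) (X Y : Type u) [AddCommGroup X] [Module A X] [AddCommGroup Y] [Module A Y]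
    (e : Ext (ModuleCat.of A X) (ModuleCat.of A Y) 2) : e = 0 := by
  let π : (X →₀ A) →ₗ[A] X := Finsupp.linearCombination A id
  have hπ : Function.Surjective π := Finsupp.linearCombination_id_surjective A X
  have h := ses_ker hπ
  have := her_proj hA (X →₀ A) (LinearMap.ker π)
  obtain ⟨x, hx⟩ := Ext.contravariant_sequence_exact₃ h.se (ModuleCat.of A Y) e
    (Ext.eq_zero_of_projective (P := ModuleCat.of A (X →₀ A)) (n := 1) _) (n₀ := 1) rfl
  have h0x : x = 0 := proj_H1 (LinearMap.ker π) Y x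
  rw [h0x, Ext.comp_zero] at hx
  exact hx.symm

theorem SES.H1_quot (h : SES f g) (hA : Hereditary A) (h1 : H1 A N Y) : H1 A N Z := fun e => by
  obtain ⟨x, hx⟩ := Ext.covariant_sequence_exact₃ (ModuleCat.of A N) h.se e (n₁ := 2) rfl
    (ext2 hA _ _ _)
  have h0x : x = 0 := h1 x
  rw [h0x, Ext.zero_comp] at hx
  exact hx.symm

theorem SES.H1_sub' (h : SES f g) (hA : Hereditary A) (h1 : H1 A Y N) : H1 A X N := fun e => by
  obtain ⟨x, hx⟩ := Ext.contravariant_sequence_exact₁ h.se (ModuleCat.of A N) e (n₁ := 2) rfl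
    (ext2 hA _ _ _)
  have h0x : x = 0 := h1 x
  rw [h0x, Ext.comp_zero] at hx
  exact hx.symm

end basics

section part2
variable {A : Type u} [Ring A]
variable {X Y Z N F O : Type u} [AddCommGroup X] [Module A X] [AddCommGroup Y] [Module A Y]
  [AddCommGroup Z] [Module A Z] [AddCommGroup N] [Module A N]
  [AddCommGroup F] [Module A F] [AddCommGroup O] [Module A O]

theorem SES.H1_crit {f : X →ₗ[A] Y} {g : Y →ₗ[A] Z} (h : SES f g) (h1 : H1 A Y N)
    (hx : ∀ φ : X →ₗ[A] N, ∃ ψ : Y →ₗ[A] N, ψ ∘ₗ f = φ) : H1 A Z N := fun e => by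
  obtain ⟨x, hx'⟩ := Ext.contravariant_sequence_exact₃ h.se (ModuleCat.of A N) e (h1 _) (n₀ := 0) rfl
  obtain ⟨y, rfl⟩ := Ext.mk₀_bijective _ _ |>.2 x
  obtain ⟨ψ, hψ⟩ := hx y.hom
  have hy : y = (scx f g h.ex).f ≫ ModuleCat.ofHom ψ := by
    apply ModuleCat.hom_ext
    exact hψ.symm
  rw [hy, ← Ext.mk₀_comp_mk₀, h.se.extClass_comp_assoc] at hx'
  exact hx'.symm

theorem push {j : O →ₗ[A] F} {p : F →ₗ[A] X} (h : SES j p) (φ : O →ₗ[A] Y) :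
    ∃ (W : Type u) (_ : AddCommGroup W) (_ : Module A W) (i : Y →ₗ[A] W) (q : W →ₗ[A] X)
      (v : F →ₗ[A] W) (π : (Y × F) →ₗ[A] W), SES i q ∧ v ∘ₗ j = i ∘ₗ φ ∧ q ∘ₗ v = p ∧
        SES (φ.prod (-j)) π := by
  let R := LinearMap.range (φ.prod (-j))
  have hR : R ≤ LinearMap.ker (p ∘ₗ LinearMap.snd A Y F) := by
    rintro _ ⟨w, rfl⟩
    simp [h.ex.apply_apply_eq_zero]
  refine ⟨(Y × F) ⧸ R, inferInstance, inferInstance, R.mkQ ∘ₗ LinearMap.inl A Y F,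
    R.liftQ (p ∘ₗ LinearMap.snd A Y F) hR, R.mkQ ∘ₗ LinearMap.inr A Y F, R.mkQ, ⟨?_, ?_, ?_⟩, ?_, ?_, ⟨?_, ?_, ?_⟩⟩
  · rw [injective_iff_map_eq_zero]
    intro y hy
    simp only [LinearMap.comp_apply, Submodule.mkQ_apply, Submodule.Quotient.mk_eq_zero] at hy
    obtain ⟨w, hw⟩ := hy
    simp only [LinearMap.prod_apply, LinearMap.inl_apply, Function.prod_apply, LinearMap.neg_apply, Prod.mk.injEq, neg_eq_zero] at hw
    have : w = 0 := h.inj (by simp [hw.2])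
    rw [← hw.1, this, map_zero]
  · intro w
    obtain ⟨⟨y, z⟩, rfl⟩ := R.mkQ_surjective w
    constructor
    · intro hw
      have hw : p z = 0 := hw
      obtain ⟨o, rfl⟩ := (h.ex z).1 hw
      refine ⟨y + φ o, ?_⟩
      change R.mkQ _ = R.mkQ _
      rw [← sub_eq_zero, ← map_sub]
      simp only [LinearMap.inl_apply, Submodule.mkQ_apply, Submodule.Quotient.mk_eq_zero]
      exact ⟨o, by simp⟩
    · rintro ⟨y', hy'⟩
      rw [← hy']
      simp
  · intro x
    obtain ⟨z, rfl⟩ := h.surj x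
    exact ⟨R.mkQ (0, z), by simp⟩
  · ext o
    change R.mkQ _ = R.mkQ _
    rw [← sub_eq_zero, ← map_sub]
    simp only [Submodule.mkQ_apply, Submodule.Quotient.mk_eq_zero]
    exact ⟨-o, by simp⟩
  · ext z
    simp
  · intro a b hab
    simp only [LinearMap.prod_apply, Function.prod_apply, LinearMap.neg_apply, Prod.mk.injEq, neg_inj] at hab
    exact h.inj hab.2
  · intro w
    simp [R]
  · exact R.mkQ_surjective

variable (A) in
/-- free presentation -/
theorem pres (X : Type u) [AddCommGroup X] [Module A X] :
    ∃ (O F : Type u) (_ : AddCommGroup O) (_ : Module A O) (_ : AddCommGroup F) (_ : Module A F)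
      (j : O →ₗ[A] F) (p : F →ₗ[A] X), SES j p ∧ Module.Projective A F := by
  let π : (X →₀ A) →ₗ[A] X := Finsupp.linearCombination A id
  have hπ : Function.Surjective π := Finsupp.linearCombination_id_surjective A X
  exact ⟨_, _, _, _, _, _, _, π, ses_ker hπ, inferInstance⟩

theorem presfg [IsNoetherianRing A] (X : Type u) [AddCommGroup X] [Module A X] [Module.Finite A X] :
    ∃ (O F : Type u) (_ : AddCommGroup O) (_ : Module A O) (_ : AddCommGroup F) (_ : Module A F)
      (j : O →ₗ[A] F) (p : F →ₗ[A] X), SES j p ∧ Module.Projective A F ∧ Module.Finite A O ∧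
      Module.Finite A F := by
  obtain ⟨n, π, hπ⟩ := Module.Finite.exists_fin' A X
  exact ⟨_, _, _, _, _, _, _, π, ses_ker hπ, inferInstance, inferInstance, inferInstance⟩

theorem H1_iff : H1 A X Y ↔ ∀ (W : Type u) [AddCommGroup W] [Module A W] (i : Y →ₗ[A] W) (p : W →ₗ[A] X),
    SES i p → ∃ s : X →ₗ[A] W, p ∘ₗ s = LinearMap.id := by
  constructor
  · intro h W _ _ i p hs
    exact hs.lift h _
  · intro H
    obtain ⟨O, F, _, _, _, _, j, p, h, hF⟩ := pres A X
    refine h.H1_crit (proj_H1 _ _) fun φ => ?_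
    obtain ⟨W, _, _, i, q, v, π, hs, h1, h2, -⟩ := push h φ
    obtain ⟨s, hs'⟩ := H W i q hs
    obtain ⟨ψ, hψ⟩ := hs.factor (v - s ∘ₗ p) (by
      rw [LinearMap.comp_sub, ← LinearMap.comp_assoc, hs', h2]; simp)
    refine ⟨ψ, ?_⟩
    ext o
    apply hs.inj
    have e1 := LinearMap.congr_fun hψ (j o)
    have e2 := LinearMap.congr_fun h1 o
    simp only [LinearMap.comp_apply, LinearMap.sub_apply, h.ex.apply_apply_eq_zero, map_zero, sub_zero] at e1 e2 ⊢
    rw [e1, e2]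

theorem homZero_iff (X Y : ModuleCat.{u} A) : homZero X Y ↔ H0 A X Y := by
  constructor
  · intro h f
    have := h (ModuleCat.ofHom f)
    exact congrArg ModuleCat.Hom.hom this
  · intro h f
    apply ModuleCat.hom_ext
    exact h f.hom

theorem extZero_iff (X Y : ModuleCat.{u} A) : extZero X Y ↔ H1 A X Y := by
  rw [H1_iff]
  constructor
  · intro h W _ _ i p hs
    obtain ⟨s, hs'⟩ := h (ModuleCat.of A W) (ModuleCat.ofHom i) (ModuleCat.ofHom p) _ hs.se
    exact ⟨s.hom, congrArg ModuleCat.Hom.hom hs'⟩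
  · intro h W i p w hs
    obtain ⟨s, hs'⟩ := h W i.hom p.hom ⟨(ModuleCat.mono_iff_injective _).1 hs.mono_f,
      (ShortComplex.ShortExact.moduleCat_exact_iff_function_exact _).1 hs.exact,
      (ModuleCat.epi_iff_surjective _).1 hs.epi_g⟩
    exact ⟨ModuleCat.ofHom s, ModuleCat.hom_ext hs'⟩

theorem rperp_iff (X Y : ModuleCat.{u} A) : rperp X Y ↔ RP A X Y := by
  rw [rperp, RP, homZero_iff, extZero_iff]

theorem lperp_iff (X Y : ModuleCat.{u} A) : lperp X Y ↔ RP A Y X := by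
  rw [lperp, RP, homZero_iff, extZero_iff]

theorem H0_sub_dom [Subsingleton X] : H0 A X N := fun φ => by
  ext x; rw [Subsingleton.elim x 0]; simp
theorem H0_sub_cod [Subsingleton X] : H0 A N X := fun φ => by
  ext x; exact Subsingleton.elim _ _

theorem ses_equiv (e : X ≃ₗ[A] Y) : SES e.toLinearMap (0 : Y →ₗ[A] PUnit.{u+1}) where
  inj := e.injective
  ex := fun y => by simp
  surj := fun y => ⟨0, Subsingleton.elim _ _⟩

theorem H1_equiv (e : X ≃ₗ[A] Y) (h : H1 A N Y) : H1 A N X :=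
  (ses_equiv e).H1_sub H0_sub_cod h

theorem H1_equiv' (e : X ≃ₗ[A] Y) (h : H1 A X N) : H1 A Y N := by
  have := ses_ker e.surjective
  have hs : Subsingleton (LinearMap.ker e.toLinearMap) := by
    have : LinearMap.ker e.toLinearMap = ⊥ := e.ker
    rw [this]; infer_instance
  exact SES.H1_quot' (f := (LinearMap.ker e.toLinearMap).subtype) (g := e.toLinearMap) (ses_ker e.surjective) H0_sub_dom h

theorem RP.equiv (e : X ≃ₗ[A] Y) (h : RP A N Y) : RP A N X := ⟨H0_of_inj e.injective h.1, H1_equiv e h.2⟩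
theorem RP.equiv' (e : X ≃ₗ[A] Y) (h : RP A X N) : RP A Y N :=
  ⟨H0_of_surj (g := e.toLinearMap) e.surjective h.1, H1_equiv' e h.2⟩

theorem H1_sub_dom [Subsingleton X] : H1 A X N := fun e => by
  have : Module.Projective A X := Module.Projective.of_equiv (LinearEquiv.ofSubsingleton PUnit.{u+1} X (R := A))
  exact proj_H1 X N e
theorem H1_sub_cod [Subsingleton X] : H1 A N X := by
  rw [H1_iff]
  intro W _ _ i p hs
  have hi : Function.Injective p := by
    rw [injective_iff_map_eq_zero]
    intro w hw
    obtain ⟨x, rfl⟩ := (hs.ex w).1 hw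
    rw [Subsingleton.elim x 0, map_zero]
  let e := LinearEquiv.ofBijective p ⟨hi, hs.surj⟩
  exact ⟨e.symm, by ext x; exact e.apply_symm_apply x⟩

/-! wide subcategory lemmas -/
section wide
variable (hA : Hereditary A) {f : X →ₗ[A] Y}

theorem RP.range (hA : Hereditary A) (hX : RP A N X) (hY : RP A N Y) : RP A N (LinearMap.range f) :=
  ⟨H0_of_inj (f := (LinearMap.range f).subtype) Subtype.val_injective hY.1, (ses_range f).H1_quot hA hX.2⟩

theorem RP.ker (hA : Hereditary A) (hX : RP A N X) (hY : RP A N Y) : RP A N (LinearMap.ker f) :=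
  ⟨H0_of_inj (f := (LinearMap.ker f).subtype) Subtype.val_injective hX.1,
    (ses_range f).H1_sub (RP.range hA hX hY).1 hX.2⟩

theorem RP.coker (hA : Hereditary A) (hX : RP A N X) (hY : RP A N Y) : RP A N (Y ⧸ LinearMap.range f) :=
  ⟨(ses_sub (LinearMap.range f)).H0_quot hY.1 (RP.range hA hX hY).2, (ses_sub (LinearMap.range f)).H1_quot hA hY.2⟩

theorem RP.range' (hA : Hereditary A) (hX : RP A X N) (hY : RP A Y N) : RP A (LinearMap.range f) N :=
  ⟨H0_of_surj (g := f.rangeRestrict) f.surjective_rangeRestrict hX.1, (ses_sub (LinearMap.range f)).H1_sub' hA hY.2⟩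

theorem RP.ker' (hA : Hereditary A) (hX : RP A X N) (hY : RP A Y N) : RP A (LinearMap.ker f) N :=
  ⟨(ses_range f).H0_sub' hX.1 (RP.range' hA hX hY).2, (ses_range f).H1_sub' hA hX.2⟩

theorem RP.coker' (hA : Hereditary A) (hX : RP A X N) (hY : RP A Y N) : RP A (Y ⧸ LinearMap.range f) N :=
  ⟨H0_of_surj (LinearMap.range f).mkQ_surjective hY.1, (ses_sub (LinearMap.range f)).H1_quot' (RP.range' hA hX hY).1 hY.2⟩

end wide

theorem SES.RP_mid {f : X →ₗ[A] Y} {g : Y →ₗ[A] Z} (h : SES f g) (h1 : RP A N X) (h2 : RP A N Z) : RP A N Y :=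
  ⟨h.H0_mid h1.1 h2.1, h.H1_mid h1.2 h2.2⟩
theorem SES.RP_mid' {f : X →ₗ[A] Y} {g : Y →ₗ[A] Z} (h : SES f g) (h1 : RP A X N) (h2 : RP A Z N) : RP A Y N :=
  ⟨h.H0_mid' h1.1 h2.1, h.H1_mid' h1.2 h2.2⟩
theorem SES.RP_sub {f : X →ₗ[A] Y} {g : Y →ₗ[A] Z} (h : SES f g) (h1 : RP A N Y) (h2 : RP A N Z) : RP A N X :=
  ⟨H0_of_inj h.inj h1.1, h.H1_sub h2.1 h1.2⟩
theorem SES.RP_sub' {f : X →ₗ[A] Y} {g : Y →ₗ[A] Z} (h : SES f g) (hA : Hereditary A) (h1 : RP A Y N) (h2 : RP A Z N) : RP A X N :=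
  ⟨h.H0_sub' h1.1 h2.2, h.H1_sub' hA h1.2⟩
theorem SES.RP_quot {f : X →ₗ[A] Y} {g : Y →ₗ[A] Z} (h : SES f g) (hA : Hereditary A) (h1 : RP A N X) (h2 : RP A N Y) : RP A N Z :=
  ⟨h.H0_quot h2.1 h1.2, h.H1_quot hA h2.2⟩
theorem SES.RP_quot' {f : X →ₗ[A] Y} {g : Y →ₗ[A] Z} (h : SES f g) (h1 : RP A X N) (h2 : RP A Y N) : RP A Z N :=
  ⟨H0_of_surj h.surj h2.1, h.H1_quot' h1.1 h2.2⟩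

/-! direct sums -/
variable (I : Type u)

theorem ses_sum {f : X →ₗ[A] Y} {g : Y →ₗ[A] Z} (h : SES f g) :
    SES (Finsupp.mapRange.linearMap (α := I) f) (Finsupp.mapRange.linearMap (α := I) g) where
  inj := by
    intro a b hab
    ext i
    apply h.inj
    simpa using DFunLike.congr_fun hab i
  ex := by
    intro y
    constructor
    · intro hy
      have : ∀ i, ∃ x, f x = y i := fun i => (h.ex (y i)).1 (by simpa using DFunLike.congr_fun hy i)
      choose x hx using this
      refine ⟨Finsupp.onFinset y.support x fun i hi => ?_, ?_⟩
      · rw [Finsupp.mem_support_iff, ← hx]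
        intro h0
        exact hi (h.inj (by simpa using h0))
      · ext i
        simp [hx]
    · rintro ⟨x, rfl⟩
      ext i
      simp [h.ex.apply_apply_eq_zero]
  surj := Finsupp.mapRange_surjective _ (map_zero _) h.surj

theorem H0_sum (h : H0 A X N) : H0 A (I →₀ X) N := fun φ => by
  apply Finsupp.lhom_ext'
  intro i
  rw [h (φ ∘ₗ _)]; simp

theorem H0_sum' (h : H0 A N X) : H0 A N (I →₀ X) := fun φ => by
  ext n i
  exact LinearMap.congr_fun (h (Finsupp.lapply i ∘ₗ φ)) n

theorem H1_sum (h : H1 A X N) : H1 A (I →₀ X) N := by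
  obtain ⟨O, F, _, _, _, _, j, p, hs, hF⟩ := pres A X
  have : Module.Projective A (I →₀ F) := by
    classical
    exact Module.Projective.of_equiv (finsuppLequivDFinsupp A).symm
  refine (ses_sum I hs).H1_crit (proj_H1 _ _) fun φ => ?_
  have := fun i => hs.ext h (φ ∘ₗ Finsupp.lsingle i)
  choose ψ hψ using this
  refine ⟨Finsupp.lsum ℕ ψ, ?_⟩
  ext i o
  have := LinearMap.congr_fun (hψ i) o
  simpa using this

theorem RP_sum (h : RP A X N) : RP A (I →₀ X) N := ⟨H0_sum I h.1, H1_sum I h.2⟩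

end part2

section part3

structure Good (A : Type u) [Ring A] : Prop where
  her : Hereditary A
  fd : ∃ (K : Type u) (_ : Field K) (_ : Algebra K A), FiniteDimensional K A

variable {A : Type u} [Ring A]
variable {X Y Z N F O M E : Type u} [AddCommGroup X] [Module A X] [AddCommGroup Y] [Module A Y]
  [AddCommGroup Z] [Module A Z] [AddCommGroup N] [Module A N]
  [AddCommGroup F] [Module A F] [AddCommGroup O] [Module A O]
  [AddCommGroup M] [Module A M] [AddCommGroup E] [Module A E]

theorem Good.noeth (hA : Good A) : IsNoetherianRing A := by
  obtain ⟨K, _, _, _⟩ := hA.fd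
  exact IsNoetherianRing.of_finite K A

theorem Good.art (hA : Good A) : IsArtinianRing A := by
  obtain ⟨K, _, _, _⟩ := hA.fd
  exact IsArtinianRing.of_finite K A

/-- multiplication by a central element -/
def cEnd (X : Type u) [AddCommGroup X] [Module A X] (c : Subring.center A) : X →ₗ[A] X where
  toFun x := (c : A) • x
  map_add' := smul_add _
  map_smul' a x := by
    simp only [smul_smul, RingHom.id_apply]
    rw [(Subring.mem_center_iff.1 c.2 a)]

theorem span_hom (hA : Good A) (X Y : Type u) [AddCommGroup X] [Module A X] [AddCommGroup Y] [Module A Y]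
    [Module.Finite A X] [Module.Finite A Y] :
    ∃ (n : ℕ) (v : Fin n → (X →ₗ[A] Y)), ∀ φ : X →ₗ[A] Y, ∃ c : Fin n → Subring.center A,
      φ = ∑ i, cEnd Y (c i) ∘ₗ v i := by
  obtain ⟨K, _, _, _⟩ := hA.fd
  let _ : Module K X := Module.compHom X (algebraMap K A)
  let _ : Module K Y := Module.compHom Y (algebraMap K A)
  have : IsScalarTower K A X := IsScalarTower.of_algebraMap_smul fun r x => rfl
  have : IsScalarTower K A Y := IsScalarTower.of_algebraMap_smul fun r x => rfl
  have : Module.Finite K X := Module.Finite.trans A X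
  have : Module.Finite K Y := Module.Finite.trans A Y
  have : SMulCommClass K A Y := IsScalarTower.to_smulCommClass
  have : SMulCommClass A K Y := SMulCommClass.symm K A Y
  let T : (X →ₗ[A] Y) →ₗ[K] (X →ₗ[K] Y) :=
    { toFun := fun f => f.restrictScalars K
      map_add' := fun _ _ => rfl
      map_smul' := fun _ _ => rfl }
  have hT : Function.Injective T := fun f g h => by
    ext x
    exact LinearMap.congr_fun h x
  have : Module.Finite K (X →ₗ[A] Y) := Module.Finite.of_injective T hT
  let b := Module.finBasis K (X →ₗ[A] Y)
  refine ⟨_, b, fun φ => ⟨fun i => ⟨algebraMap K A (b.repr φ i), ?_⟩, ?_⟩⟩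
  · rw [Subring.mem_center_iff]
    intro a
    exact (Algebra.commutes _ _).symm
  · conv_lhs => rw [← b.sum_repr φ]
    rfl

theorem retract (hA : Good A) (I : Type u) (E : Type u) [AddCommGroup E] [Module A E] [Module.Finite A E] :
    ∃ R : (I → E) →ₗ[A] (I →₀ E), ∀ v : I →₀ E, R v = v := by
  obtain ⟨K, _, _, _⟩ := hA.fd
  let _ : Module K E := Module.compHom E (algebraMap K A)
  have : IsScalarTower K A E := IsScalarTower.of_algebraMap_smul fun r x => rfl
  have : Module.Finite K E := Module.Finite.trans A E
  have : SMulCommClass K A E := IsScalarTower.to_smulCommClass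
  have : SMulCommClass A K E := SMulCommClass.symm K A E
  obtain ⟨r, hr⟩ := LinearMap.exists_leftInverse_of_injective
    (Finsupp.lcoeFun : (I →₀ K) →ₗ[K] (I → K)) (LinearMap.ker_eq_bot.2 DFunLike.coe_injective)
  have hr : ∀ c : I →₀ K, r c = c := fun c => LinearMap.congr_fun hr c
  let b := Module.finBasis K E
  let ι := Fin (Module.finrank K E)
  let T (c : I → K) : E →ₗ[K] (I →₀ E) :=
    { toFun := fun e => (r c).mapRange (fun x => x • e) (zero_smul _ _)
      map_add' := fun x y => by ext i; simp
      map_smul' := fun x y => by ext i; simp [smul_comm x] }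
  have hTa : ∀ c (a : A) e, T c (a • e) = a • T c e := fun c a e => by
    ext i
    simp only [T, LinearMap.coe_mk, AddHom.coe_mk, Finsupp.mapRange_apply, Finsupp.smul_apply]
    exact smul_comm _ _ _
  let C (j : ι) (v : I → E) : I → K := fun i => b.repr (v i) j
  let R0 (v : I → E) : I →₀ E := ∑ j, T (C j v) (b j)
  have hadd : ∀ v w, R0 (v + w) = R0 v + R0 w := fun v w => by
    simp only [R0, ← Finset.sum_add_distrib]
    refine Finset.sum_congr rfl fun j _ => ?_
    have : C j (v + w) = C j v + C j w := by ext i; simp [C]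
    rw [this]
    ext i
    simp [T, add_smul]
  have hsing : ∀ (c : I → K) e, R0 (fun i => c i • e) = T c e := fun c e => by
    have : ∀ j, T (C j fun i => c i • e) (b j) = b.repr e j • T c (b j) := fun j => by
      have : (C j fun i => c i • e) = b.repr e j • c := by ext i; simp [C, mul_comm]
      rw [this]
      ext i
      simp [T, smul_smul]
    simp only [R0, this]
    conv_rhs => rw [← b.sum_repr e]
    rw [map_sum]
    simp only [map_smul]
    rfl
  have hdec : ∀ v : I → E, v = ∑ j, fun i => C j v i • b j := fun v => by
    ext i
    simp only [Finset.sum_apply, C]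
    exact (b.sum_repr (v i)).symm
  have hzero : R0 0 = 0 := by
    have := hadd 0 0
    simpa using this
  have hsum : ∀ (s : Finset ι) (g : ι → (I → E)), R0 (∑ j ∈ s, g j) = ∑ j ∈ s, R0 (g j) := fun s g => by
    classical
    induction s using Finset.induction_on with
    | empty => simpa using hzero
    | insert a s ha ih => rw [Finset.sum_insert ha, Finset.sum_insert ha, hadd, ih]
  refine ⟨{ toFun := R0, map_add' := hadd, map_smul' := fun a v => ?_ }, fun v => ?_⟩
  · have : a • v = ∑ j, fun i => C j v i • (a • b j) := by
      conv_lhs => rw [hdec v]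
      rw [Finset.smul_sum]
      refine Finset.sum_congr rfl fun j _ => ?_
      ext i
      simp [smul_comm a]
    rw [this, hsum]
    simp only [hsing, hTa, RingHom.id_apply, R0, Finset.smul_sum]
  · change R0 v = v
    have : ∀ j, T (C j v) (b j) = (v.mapRange (fun e => b.repr e j) (by simp)).mapRange (fun x => x • b j) (zero_smul _ _) := fun j => by
      have : C j v = (v.mapRange (fun e => b.repr e j) (by simp) : I →₀ K) := by
        ext i; simp [C]
      simp only [T, this, hr]
      rfl
    simp only [R0, this]
    ext i
    simp only [Finsupp.finsetSum_apply, Finsupp.mapRange_apply]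
    exact b.sum_repr (v i)

theorem H1_sum' (hA : Good A) (I : Type u) [Module.Finite A E] (h : H1 A N E) : H1 A N (I →₀ E) := by
  obtain ⟨O, F, _, _, _, _, j, p, hs, hF⟩ := pres A N
  obtain ⟨R, hR⟩ := retract hA I E
  refine hs.H1_crit (proj_H1 _ _) fun φ => ?_
  have := fun i => hs.ext h (Finsupp.lapply i ∘ₗ φ)
  choose ψ hψ using this
  refine ⟨R ∘ₗ LinearMap.pi ψ, ?_⟩
  ext1 o
  rw [← hR (φ o)]
  simp only [LinearMap.comp_apply]
  congr 1
  ext i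
  exact LinearMap.congr_fun (hψ i) o

theorem RP_sum' (hA : Good A) (I : Type u) [Module.Finite A E] (h : RP A N E) : RP A N (I →₀ E) :=
  ⟨H0_sum' I h.1, H1_sum' hA I h.2⟩

theorem SES.fin_mid {f : X →ₗ[A] Y} {g : Y →ₗ[A] Z} (h : SES f g) [Module.Finite A X] [Module.Finite A Z] :
    Module.Finite A Y :=
  Module.Finite.of_exact h.ex h.surj

/-- first half of reflection: kill Ext -/
theorem refl1 {j : O →ₗ[A] F} {p : F →ₗ[A] E} (hs : SES j p) [Module.Projective A F]
    (I : Type u) (hEI : H1 A E (I →₀ E)) (v : I → (O →ₗ[A] M))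
    (hv : ∀ (W : Type u) [AddCommGroup W] [Module A W] (i : M →ₗ[A] W),
      (∀ t, ∃ ψ : F →ₗ[A] W, ψ ∘ₗ j = i ∘ₗ v t) → ∀ φ : O →ₗ[A] M, ∃ ψ : F →ₗ[A] W, ψ ∘ₗ j = i ∘ₗ φ) :
    ∃ (W : Type u) (_ : AddCommGroup W) (_ : Module A W) (i : M →ₗ[A] W) (q : W →ₗ[A] (I →₀ E)),
      SES i q ∧ H1 A E W := by
  obtain ⟨W, _, _, i, q, w, -, hW, h1, h2, -⟩ := push (ses_sum I hs) (Finsupp.lsum ℕ v)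
  refine ⟨W, _, _, i, q, hW, hs.H1_crit (proj_H1 _ _) fun φ => ?_⟩
  obtain ⟨α, hα⟩ := hs.ext hEI (q ∘ₗ φ)
  obtain ⟨β, hβ⟩ := Module.projective_lifting_property q α hW.surj
  obtain ⟨φ', hφ'⟩ := hW.factor (φ - β ∘ₗ j) (by
    rw [LinearMap.comp_sub, ← LinearMap.comp_assoc, hβ, hα, sub_self])
  obtain ⟨γ, hγ⟩ := hv W i (fun t => ⟨w ∘ₗ Finsupp.lsingle t, by
    ext o
    have := LinearMap.congr_fun h1 (Finsupp.single t o)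
    simpa using this⟩) φ'
  refine ⟨γ + β, ?_⟩
  rw [LinearMap.add_comp, hγ, hφ', sub_add_cancel]

/-- second half: kill Hom -/
theorem refl2 (hA : Good A) [Module.Finite A E] (hE : H1 A E E) (h : H1 A E M) :
    ∃ (B : Type u) (φ : (B →₀ E) →ₗ[A] M), RP A E (M ⧸ LinearMap.range φ) := by
  refine ⟨E →ₗ[A] M, Finsupp.lsum ℕ fun f => f, ?_⟩
  set φ : ((E →ₗ[A] M) →₀ E) →ₗ[A] M := Finsupp.lsum ℕ fun f => f
  refine ⟨fun f => ?_, (ses_sub _).H1_quot hA.her h⟩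
  have h1 : H1 A E (LinearMap.range φ) := (ses_range φ).H1_quot hA.her (H1_sum' hA _ hE)
  obtain ⟨ψ, rfl⟩ := (ses_sub (LinearMap.range φ)).lift h1 f
  ext e
  simp only [LinearMap.comp_apply, Submodule.mkQ_apply, LinearMap.zero_apply, Submodule.Quotient.mk_eq_zero]
  exact ⟨Finsupp.single ψ e, by simp [φ]⟩

structure ReflData (E M W1 W' : Type u) [AddCommGroup E] [Module A E] [AddCommGroup M] [Module A M]
    [AddCommGroup W1] [Module A W1] [AddCommGroup W'] [Module A W'] (I B : Type u)
    (i : M →ₗ[A] W1) (q : W1 →ₗ[A] (I →₀ E)) (φ : (B →₀ E) →ₗ[A] W1) (r : W1 →ₗ[A] W') : Prop where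
  s1 : SES i q
  s2 : SES (LinearMap.range φ).subtype r
  perp : RP A E W'

theorem reflect (hA : Good A) (E : Type u) [AddCommGroup E] [Module A E] [Module.Finite A E] (hE : H1 A E E)
    (M : Type u) [AddCommGroup M] [Module A M] :
    ∃ (W1 W' I B : Type u) (_ : AddCommGroup W1) (_ : Module A W1) (_ : AddCommGroup W') (_ : Module A W')
      (i : M →ₗ[A] W1) (q : W1 →ₗ[A] (I →₀ E)) (φ : (B →₀ E) →ₗ[A] W1) (r : W1 →ₗ[A] W'),
      ReflData E M W1 W' I B i q φ r ∧ (Module.Finite A M → Module.Finite A W') := by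
  have := hA.noeth
  have key : ∃ (I : Type u) (W : Type u) (_ : AddCommGroup W) (_ : Module A W) (i : M →ₗ[A] W) (q : W →ₗ[A] (I →₀ E)),
      (SES i q ∧ H1 A E W) ∧ (Module.Finite A M → Module.Finite A W) := by
    obtain ⟨O, F, _, _, _, _, j, p, hs, _, _, _⟩ := presfg (A := A) E
    by_cases hM : Module.Finite A M
    · obtain ⟨n, v, hv⟩ := span_hom hA O M
      obtain ⟨W, _, _, i, q, h, h'⟩ := refl1 hs (ULift.{u} (Fin n)) (H1_sum' hA _ hE) (fun t => v t.down) (M := M) (by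
        intro W _ _ i h φ
        choose ψ hψ using h
        obtain ⟨c, rfl⟩ := hv φ
        refine ⟨∑ t, cEnd W (c t) ∘ₗ ψ ⟨t⟩, ?_⟩
        ext o
        simp only [LinearMap.comp_apply, LinearMap.sum_apply, map_sum]
        refine Finset.sum_congr rfl fun t _ => ?_
        have := LinearMap.congr_fun (hψ ⟨t⟩) o
        simp only [LinearMap.comp_apply] at this
        rw [this]
        simp [cEnd])
      exact ⟨_, W, _, _, i, q, ⟨h, h'⟩, fun _ => h.fin_mid⟩
    · obtain ⟨W, _, _, i, q, h⟩ := refl1 hs (O →ₗ[A] M) (H1_sum' hA _ hE) (fun t => t) (M := M)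
        (fun W _ _ i h φ => h φ)
      exact ⟨_, W, _, _, i, q, h, fun h => absurd h hM⟩
  obtain ⟨I, W, _, _, i, q, ⟨h1, h2⟩, h3⟩ := key
  obtain ⟨B, φ, h4⟩ := refl2 hA hE h2
  refine ⟨W, _, I, B, _, _, _, _, i, q, φ, (LinearMap.range φ).mkQ, ⟨h1, ses_sub _, h4⟩, fun h => ?_⟩
  have := h3 h
  infer_instance

/-- coreflection, first half -/
theorem corefl1 (hA : Good A) (E : Type u) [AddCommGroup E] [Module A E] [Module.Finite A E] (hE : H1 A E E)
    (M : Type u) [AddCommGroup M] [Module A M] [Module.Finite A M] :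
    ∃ (n : ℕ) (W : Type u) (_ : AddCommGroup W) (_ : Module A W) (i : (ULift.{u} (Fin n) →₀ E) →ₗ[A] W) (q : W →ₗ[A] M),
      SES i q ∧ H1 A W E ∧ Module.Finite A W := by
  have := hA.noeth
  obtain ⟨O, F, _, _, _, _, j, p, hs, _, _, _⟩ := presfg (A := A) M
  obtain ⟨n, v, hv⟩ := span_hom hA O E
  let V : O →ₗ[A] (ULift.{u} (Fin n) →₀ E) := ∑ t, Finsupp.lsingle (ULift.up t) ∘ₗ v t
  obtain ⟨W, _, _, i, q, w, π, hW, h1, h2, h3⟩ := push hs V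
  refine ⟨n, W, _, _, i, q, hW, ?_, hW.fin_mid⟩
  have hmid : H1 A ((ULift.{u} (Fin n) →₀ E) × F) E := by
    have : SES (LinearMap.inl A (ULift.{u} (Fin n) →₀ E) F) (LinearMap.snd A (ULift.{u} (Fin n) →₀ E) F) :=
      ⟨LinearMap.inl_injective, Function.Exact.inl_snd, LinearMap.snd_surjective⟩
    exact this.H1_mid' (H1_sum _ hE) (proj_H1 _ _)
  refine h3.H1_crit hmid fun φ => ?_
  obtain ⟨c, rfl⟩ := hv φ
  refine ⟨(Finsupp.lsum ℕ fun t => cEnd E (c t.down)) ∘ₗ LinearMap.fst _ _ _, ?_⟩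
  ext o
  simp only [V, LinearMap.comp_apply, LinearMap.prod_apply, Function.prod_apply, LinearMap.fst_apply, LinearMap.sum_apply, map_sum]
  refine Finset.sum_congr rfl fun t _ => ?_
  simp

end part3

section part4
variable {A : Type u} [Ring A]

def inC {n : ℕ} (E : Fin n → ModuleCat.{u} A) (t : ℕ) (X : Type u) [AddCommGroup X] [Module A X] : Prop :=
  ∀ j : Fin n, t ≤ j.val → RP A (E j) X

def inL {n : ℕ} (E : Fin n → ModuleCat.{u} A) (t : ℕ) (X : Type u) [AddCommGroup X] [Module A X] : Prop :=
  ∀ j : Fin n, j.val < t → RP A X (E j)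

theorem ExceptionalMod.h1 {X : ModuleCat.{u} A} (h : ExceptionalMod X) : H1 A X X :=
  (extZero_iff _ _).1 h.2.1

theorem ExceptionalMod.brick {X : ModuleCat.{u} A} (h : ExceptionalMod X) (f : X →ₗ[A] X) (hf : f ≠ 0) :
    Function.Bijective f := by
  have := h.2.2.2 (ModuleCat.ofHom f) (fun h0 => hf (congrArg ModuleCat.Hom.hom h0))
  exact (ConcreteCategory.isIso_iff_bijective (ModuleCat.ofHom f)).1 this

theorem exc_of {X : ModuleCat.{u} A} (h1 : Module.Finite A X) (h2 : H1 A X X) (h3 : Nontrivial X)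
    (h4 : ∀ f : X →ₗ[A] X, f ≠ 0 → Function.Bijective f) : ExceptionalMod X := by
  refine ⟨h1, (extZero_iff _ _).2 h2, h3, fun f hf => ?_⟩
  refine (ConcreteCategory.isIso_iff_bijective f).2 (h4 f.hom fun h0 => hf ?_)
  exact ModuleCat.hom_ext h0

theorem IsExcSeq.rp {n : ℕ} {E : Fin n → ModuleCat.{u} A} (h : IsExcSeq E) {i j : Fin n} (hij : i < j) :
    RP A (E j) (E i) := (rperp_iff _ _).1 (h.2 i j hij)

theorem H0_self_sub {N : Type u} [AddCommGroup N] [Module A N] (h : H0 A N N) : Subsingleton N :=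
  subsingleton_of_forall_eq 0 fun x => LinearMap.congr_fun (h LinearMap.id) x

section
variable {E M W1 W' D : Type u} [AddCommGroup E] [Module A E] [AddCommGroup M] [Module A M]
    [AddCommGroup W1] [Module A W1] [AddCommGroup W'] [Module A W'] {I B : Type u}
    [AddCommGroup D] [Module A D]
    {i : M →ₗ[A] W1} {q : W1 →ₗ[A] (I →₀ E)} {φ : (B →₀ E) →ₗ[A] W1} {r : W1 →ₗ[A] W'}

theorem ReflData.rpW1 (h : ReflData E M W1 W' I B i q φ r) (hA : Good A) [Module.Finite A E]
    (h1 : RP A D M) (h2 : RP A D E) : RP A D W1 := h.s1.RP_mid h1 (RP_sum' hA _ h2)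
theorem ReflData.rpW' (h : ReflData E M W1 W' I B i q φ r) (hA : Good A) [Module.Finite A E]
    (h1 : RP A D M) (h2 : RP A D E) : RP A D W' :=
  h.s2.RP_quot hA.her (RP.range hA.her (RP_sum' hA _ h2) (h.rpW1 hA h1 h2)) (h.rpW1 hA h1 h2)
theorem ReflData.rpK (h : ReflData E M W1 W' I B i q φ r) (hA : Good A) [Module.Finite A E]
    (h1 : RP A D M) (h2 : RP A D E) : RP A D (LinearMap.ker φ) :=
  RP.ker hA.her (RP_sum' hA _ h2) (h.rpW1 hA h1 h2)
theorem ReflData.lpW1 (h : ReflData E M W1 W' I B i q φ r)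
    (h1 : RP A M D) (h2 : RP A E D) : RP A W1 D := h.s1.RP_mid' h1 (RP_sum _ h2)
theorem ReflData.lpW' (h : ReflData E M W1 W' I B i q φ r) (hA : Good A)
    (h1 : RP A M D) (h2 : RP A E D) : RP A W' D :=
  h.s2.RP_quot' (RP.range' hA.her (RP_sum _ h2) (h.lpW1 h1 h2)) (h.lpW1 h1 h2)
end

theorem inC_refl (hA : Good A) {n : ℕ} {E : Fin n → ModuleCat.{u} A} (hE : IsExcSeq E) {t : ℕ} (ht : t < n)
    {M W1 W' I B : Type u} [AddCommGroup M] [Module A M]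
    [AddCommGroup W1] [Module A W1] [AddCommGroup W'] [Module A W']
    {i : M →ₗ[A] W1} {q : W1 →ₗ[A] (I →₀ E ⟨t, ht⟩)} {φ : (B →₀ E ⟨t, ht⟩) →ₗ[A] W1} {r : W1 →ₗ[A] W'}
    (h : ReflData (E ⟨t, ht⟩) M W1 W' I B i q φ r) (hM : inC E (t + 1) M) :
    inC E t W' ∧ inC E (t + 1) (LinearMap.ker φ) := by
  have := (hE.1 ⟨t, ht⟩).1
  constructor
  · intro j hj
    rcases hj.eq_or_lt with hj | hj
    · have : j = ⟨t, ht⟩ := Fin.ext hj.symm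
      rw [this]
      exact h.perp
    · exact h.rpW' hA (hM j hj) (hE.rp (by exact hj))
  · intro j hj
    exact h.rpK hA (hM j hj) (hE.rp (by exact hj))

theorem Zlem (hA : Good A) {n : ℕ} {E : Fin n → ModuleCat.{u} A} (hE : IsExcSeq E)
    (hz : ∀ (W : Type u) [AddCommGroup W] [Module A W], inC E 0 W → Subsingleton W) {t : ℕ} (ht : t ≤ n)
    (N : Type u) [AddCommGroup N] [Module A N] (hC : inC E t N) (hL : inL E t N) : Subsingleton N := by
  have key : ∀ s : ℕ, s ≤ t → ∀ (M : Type u) [AddCommGroup M] [Module A M], inC E s M → RP A N M := by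
    intro s
    induction s with
    | zero =>
      intro _ M _ _ hM
      have := hz M hM
      exact ⟨H0_sub_cod, H1_sub_cod⟩
    | succ s ih =>
      intro hst
      have hs : s < n := by omega
      have hNE : RP A N (E ⟨s, hs⟩) := hL ⟨s, hs⟩ (by exact hst)
      have := (hE.1 ⟨s, hs⟩).1
      have first : ∀ (M : Type u) [AddCommGroup M] [Module A M], inC E (s + 1) M → H1 A N M := by
        intro M _ _ hM
        obtain ⟨W1, W', I, B, _, _, _, _, i, q, φ, r, h, -⟩ := reflect hA (E ⟨s, hs⟩) (hE.1 ⟨s, hs⟩).h1 M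
        have hW := ih (by omega) W' (inC_refl hA hE hs h hM).1
        exact h.s1.H1_sub (H0_sum' _ hNE.1)
          (h.s2.H1_mid ((ses_range φ).H1_quot hA.her (H1_sum' hA _ hNE.2)) hW.2)
      intro M _ _ hM
      refine ⟨?_, first M hM⟩
      obtain ⟨W1, W', I, B, _, _, _, _, i, q, φ, r, h, -⟩ := reflect hA (E ⟨s, hs⟩) (hE.1 ⟨s, hs⟩).h1 M
      have hW := ih (by omega) W' (inC_refl hA hE hs h hM).1
      have hK := first _ (inC_refl hA hE hs h hM).2
      exact H0_of_inj h.s1.inj (h.s2.H0_mid ((ses_range φ).H0_quot (H0_sum' _ hNE.1) hK) hW.1)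
  exact H0_self_sub (key t le_rfl N hC).1

theorem brick_step {Q : Type u} [AddCommGroup Q] [Module A Q] [IsNoetherian A Q] [IsArtinian A Q]
    (f : Q →ₗ[A] Q) (hf : ¬ Function.Bijective f) :
    Module.length A (LinearMap.range f) < Module.length A Q := by
  apply Submodule.length_lt
  intro h
  rw [LinearMap.range_eq_top] at h
  exact hf ⟨IsNoetherian.injective_of_surjective_endomorphism f h, h⟩

theorem Xlem (hA : Good A) {n : ℕ} {E : Fin n → ModuleCat.{u} A} (hE : IsExcSeq E) {t : ℕ} (ht : t ≤ n)
    (P : Type u) [AddCommGroup P] [Module A P] [Module.Finite A P] [Module.Projective A P]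
    (hP : ∀ j : Fin n, j.val < t → H0 A P (E j))
    (W : Type u) [AddCommGroup W] [Module A W] (hW : inC E t W) (hPW : ¬ H0 A P W) :
    ∃ Q : ModuleCat.{u} A, ExceptionalMod Q ∧ inC E t Q ∧ inL E t Q ∧
      ∀ (V : Type u) [AddCommGroup V] [Module A V], inC E t V → H1 A Q V := by
  have := hA.noeth
  have := hA.art
  have stepA : ∀ d s, s + d = n → ∃ Q : ModuleCat.{u} A, Module.Finite A Q ∧ inC E s Q ∧
      (∀ (V : Type u) [AddCommGroup V] [Module A V], inC E s V → H1 A Q V ∧ (H0 A Q V ↔ H0 A P V)) := by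
    intro d
    induction d with
    | zero =>
      intro s hs
      refine ⟨ModuleCat.of A P, ‹_›, fun j hj => absurd j.2 (by omega), fun V _ _ _ => ⟨proj_H1 _ _, Iff.rfl⟩⟩
    | succ d ih =>
      intro s hs
      have hsn : s < n := by omega
      obtain ⟨Q, hQf, hQC, hQ⟩ := ih (s + 1) (by omega)
      have := (hE.1 ⟨s, hsn⟩).1
      obtain ⟨W1, W', I, B, _, _, _, _, i, q, φ, r, h, hf⟩ := reflect hA (E ⟨s, hsn⟩) (hE.1 ⟨s, hsn⟩).h1 Q
      refine ⟨ModuleCat.of A W', hf hQf, (inC_refl hA hE hsn h hQC).1, fun V _ _ hV => ?_⟩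
      have hV' : inC E (s + 1) V := fun j hj => hV j (by omega)
      have hEV := hV ⟨s, hsn⟩ le_rfl
      obtain ⟨q1, q2⟩ := hQ V hV'
      have hr : H0 A (LinearMap.range φ) V := H0_of_surj φ.surjective_rangeRestrict (H0_sum _ hEV.1)
      refine ⟨h.s2.H1_quot' hr (h.s1.H1_mid' q1 (H1_sum _ hEV.2)), ?_⟩
      rw [← q2]
      constructor
      · intro h0
        exact h.s1.H0_sub' (h.s2.H0_mid' hr h0) (H1_sum _ hEV.2)
      · intro h0
        exact H0_of_surj h.s2.surj (h.s1.H0_mid' h0 (H0_sum _ hEV.1))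
  have hEj : ∀ j : Fin n, j.val < t → inC E t (E j) := fun j hj i hi => hE.rp (Fin.lt_def.2 (by omega))
  have stepB : ∀ (l : ℕ∞) (Q : ModuleCat.{u} A), Module.length A Q = l → Module.Finite A Q → Nontrivial Q → inC E t Q →
      (∀ (V : Type u) [AddCommGroup V] [Module A V], inC E t V → H1 A Q V) → (∀ j : Fin n, j.val < t → H0 A Q (E j)) →
      ∃ Q : ModuleCat.{u} A, ExceptionalMod Q ∧ inC E t Q ∧ inL E t Q ∧
      ∀ (V : Type u) [AddCommGroup V] [Module A V], inC E t V → H1 A Q V := by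
    intro l
    induction l using WellFoundedLT.induction with
    | ind l ih =>
      intro Q hl hf hn hC h1 h0
      by_cases hb : ∀ f : Q →ₗ[A] Q, f ≠ 0 → Function.Bijective f
      · exact ⟨Q, exc_of hf (h1 Q hC) hn hb, hC, fun j hj => ⟨h0 j hj, h1 _ (hEj j hj)⟩, h1⟩
      · push Not at hb
        obtain ⟨f, hf0, hfb⟩ := hb
        refine ih _ (hl ▸ brick_step f hfb) (ModuleCat.of A (LinearMap.range f)) rfl ?_ ?_ ?_ ?_ ?_
        · change Module.Finite A (LinearMap.range f)
          infer_instance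
        · change Nontrivial (LinearMap.range f)
          rw [Submodule.nontrivial_iff_ne_bot]
          rwa [Ne, LinearMap.range_eq_bot]
        · exact fun j hj => RP.range hA.her (hC j hj) (hC j hj)
        · exact fun V _ _ hV => (ses_sub (LinearMap.range f)).H1_sub' hA.her (h1 V hV)
        · exact fun j hj => H0_of_surj f.surjective_rangeRestrict (h0 j hj)
  obtain ⟨Q, hQf, hQC, hQ⟩ := stepA (n - t) t (by omega)
  refine stepB _ Q rfl hQf ?_ hQC (fun V _ _ hV => (hQ V hV).1) fun j hj => ((hQ _ (hEj j hj)).2).2 (hP j hj)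
  by_contra hn
  rw [not_nontrivial_iff_subsingleton] at hn
  exact hPW ((hQ W hW).2.1 H0_sub_dom)

theorem insert_exc {n : ℕ} {E : Fin n → ModuleCat.{u} A} (hE : IsExcSeq E) (t : Fin (n + 1))
    {Q : ModuleCat.{u} A} (hQ : ExceptionalMod Q) (hC : inC E t Q) (hL : inL E t Q) :
    IsExcSeq (t.insertNth Q E : Fin (n + 1) → ModuleCat.{u} A) := by
  refine ⟨fun i => ?_, fun i j hij => ?_⟩
  · rcases Fin.eq_self_or_eq_succAbove t i with rfl | ⟨i, rfl⟩
    · rwa [Fin.insertNth_apply_same]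
    · rw [Fin.insertNth_apply_succAbove]
      exact hE.1 i
  · rw [rperp_iff]
    rcases Fin.eq_self_or_eq_succAbove t i with rfl | ⟨i, rfl⟩
    · rcases Fin.eq_self_or_eq_succAbove i j with rfl | ⟨j, rfl⟩
      · exact absurd hij (lt_irrefl _)
      · rw [Fin.insertNth_apply_same, Fin.insertNth_apply_succAbove]
        exact hC j (by rw [Fin.lt_succAbove_iff_le_castSucc] at hij; exact hij)
    · rcases Fin.eq_self_or_eq_succAbove t j with rfl | ⟨j, rfl⟩
      · rw [Fin.insertNth_apply_same, Fin.insertNth_apply_succAbove]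
        exact hL i (by rw [Fin.succAbove_lt_iff_castSucc_lt] at hij; exact hij)
      · rw [Fin.insertNth_apply_succAbove, Fin.insertNth_apply_succAbove]
        exact hE.rp (by simpa using hij)

theorem hzero (hA : Good A) {n : ℕ} {E : Fin n → ModuleCat.{u} A} (hE : CompleteES E)
    (W : Type u) [AddCommGroup W] [Module A W] (hW : inC E 0 W) : Subsingleton W := by
  by_contra hn
  obtain ⟨Q, h1, h2, h3, -⟩ := Xlem hA hE.1 (Nat.zero_le n) A (fun j hj => absurd hj (Nat.not_lt_zero _)) W hW (by
    intro h
    apply hn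
    refine subsingleton_of_forall_eq 0 fun w => ?_
    have := LinearMap.congr_fun (h (LinearMap.toSpanSingleton A W w)) 1
    simpa using this)
  have := hE.2 _ _ (insert_exc hE.1 0 h1 h2 h3)
  omega

/-- slot lemma -/
theorem Zslot (hA : Good A) {m : ℕ} {E' : Fin m → ModuleCat.{u} A} (hE' : IsExcSeq E')
    (hmax : ∀ (l : ℕ) (F : Fin l → ModuleCat.{u} A), IsExcSeq F → l ≤ m + 1) (k : Fin (m + 1))
    {Q : ModuleCat.{u} A} (hQ : ExceptionalMod Q) (hC : inC E' k Q) (hL : inL E' k Q)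
    (N : Type u) [AddCommGroup N] [Module A N] (hNC : inC E' k N) (hNL : inL E' k N) (hQN : RP A Q N) :
    Subsingleton N := by
  have hG := insert_exc hE' k hQ hC hL
  refine Zlem hA hG (fun W _ _ hW => hzero hA ⟨hG, hmax⟩ W hW) (t := k) k.2.le N ?_ ?_
  · intro j hj
    rcases Fin.eq_self_or_eq_succAbove k j with rfl | ⟨j, rfl⟩
    · rwa [Fin.insertNth_apply_same]
    · rw [Fin.insertNth_apply_succAbove]
      apply hNC j
      have := lt_of_le_of_ne (Fin.le_def.2 hj) (Fin.succAbove_ne k j).symm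
      rw [Fin.lt_succAbove_iff_le_castSucc] at this
      exact this
  · intro j hj
    rcases Fin.eq_self_or_eq_succAbove k j with rfl | ⟨j, rfl⟩
    · exact absurd hj (lt_irrefl _)
    · rw [Fin.insertNth_apply_succAbove]
      apply hNL j
      have : k.succAbove j < k := hj
      rw [Fin.succAbove_lt_iff_castSucc_lt] at this
      exact this

end part4

section part5
variable {A : Type u} [Ring A]

structure inD {m : ℕ} (E' : Fin m → ModuleCat.{u} A) (k : ℕ) (X : Type u) [AddCommGroup X] [Module A X] : Prop where
  c : inC E' k X
  l : inL E' k X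

section
variable {m : ℕ} {E' : Fin m → ModuleCat.{u} A} {k : ℕ} {X Y : Type u} [AddCommGroup X] [Module A X]
  [AddCommGroup Y] [Module A Y]

theorem inD.ker (hA : Good A) (hX : inD E' k X) (hY : inD E' k Y) (f : X →ₗ[A] Y) : inD E' k (LinearMap.ker f) :=
  ⟨fun j hj => RP.ker hA.her (hX.c j hj) (hY.c j hj), fun j hj => RP.ker' hA.her (hX.l j hj) (hY.l j hj)⟩
theorem inD.range (hA : Good A) (hX : inD E' k X) (hY : inD E' k Y) (f : X →ₗ[A] Y) : inD E' k (LinearMap.range f) :=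
  ⟨fun j hj => RP.range hA.her (hX.c j hj) (hY.c j hj), fun j hj => RP.range' hA.her (hX.l j hj) (hY.l j hj)⟩
theorem inD.coker (hA : Good A) (hX : inD E' k X) (hY : inD E' k Y) (f : X →ₗ[A] Y) : inD E' k (Y ⧸ LinearMap.range f) :=
  ⟨fun j hj => RP.coker hA.her (hX.c j hj) (hY.c j hj), fun j hj => RP.coker' hA.her (hX.l j hj) (hY.l j hj)⟩
theorem inD.sum (hA : Good A) (I : Type u) [Module.Finite A X] (hX : inD E' k X) : inD E' k (I →₀ X) :=
  ⟨fun j hj => RP_sum' hA _ (hX.c j hj), fun j hj => RP_sum _ (hX.l j hj)⟩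
end

def Gen {Q N : Type u} [AddCommGroup Q] [Module A Q] [AddCommGroup N] [Module A N] (U : Submodule A N) : Prop :=
  U ≤ ⨆ g : {g : Q →ₗ[A] N // LinearMap.range g ≤ U}, LinearMap.range g.1

section
variable {Q N : Type u} [AddCommGroup Q] [Module A Q] [AddCommGroup N] [Module A N]

theorem gen_mono {U V : Submodule A N} (hU : Gen (Q := Q) U) (h : U ≤ V) :
    U ≤ ⨆ g : {g : Q →ₗ[A] N // LinearMap.range g ≤ V}, LinearMap.range g.1 :=
  hU.trans (iSup_le fun g => le_iSup (fun g : {g : Q →ₗ[A] N // LinearMap.range g ≤ V} => LinearMap.range g.1) ⟨g.1, g.2.trans h⟩)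

theorem gen_sup {U V : Submodule A N} (hU : Gen (Q := Q) U) (hV : Gen (Q := Q) V) : Gen (Q := Q) (U ⊔ V) :=
  sup_le (gen_mono hU le_sup_left) (gen_mono hV le_sup_right)

theorem gen_range (g : Q →ₗ[A] N) : Gen (Q := Q) (LinearMap.range g) :=
  le_iSup (fun h : {h : Q →ₗ[A] N // LinearMap.range h ≤ LinearMap.range g} => LinearMap.range h.1) ⟨g, le_rfl⟩

theorem gen_sSup (c : Set (Submodule A N)) (hc : ∀ U ∈ c, Gen (Q := Q) U) : Gen (Q := Q) (sSup c) :=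
  sSup_le fun U hU => gen_mono (hc U hU) (le_sSup hU)

theorem gen_map {U : Submodule A N} (hU : Gen (Q := Q) U) :
    ∃ (G : Type u) (φ : (G →₀ Q) →ₗ[A] N), LinearMap.range φ = U := by
  refine ⟨{g : Q →ₗ[A] N // LinearMap.range g ≤ U}, Finsupp.lsum ℕ fun g => g.1, le_antisymm ?_ ?_⟩
  · rintro _ ⟨x, rfl⟩
    rw [Finsupp.lsum_apply]
    exact Submodule.sum_mem _ fun g _ => g.2 ⟨_, rfl⟩
  · refine hU.trans (iSup_le fun g => ?_)
    rintro _ ⟨q, rfl⟩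
    exact ⟨Finsupp.single g q, by simp⟩
end

/-- filler data -/
structure Filler {m : ℕ} (E' : Fin m → ModuleCat.{u} A) (k : Fin (m + 1)) (Q : ModuleCat.{u} A) : Prop where
  exc : ExceptionalMod Q
  d : inD E' k Q
  pr : ∀ (V : Type u) [AddCommGroup V] [Module A V], inC E' k V → H1 A Q V

section split
variable {m : ℕ} {E' : Fin m → ModuleCat.{u} A} {k : Fin (m + 1)} {Q : ModuleCat.{u} A}
  {N : Type u} [AddCommGroup N] [Module A N]

theorem Filler.sub (hQ : Filler E' k Q) (hA : Good A) (hE' : IsExcSeq E')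
    (hmax : ∀ (l : ℕ) (F : Fin l → ModuleCat.{u} A), IsExcSeq F → l ≤ m + 1)
    (hN : inD E' k N) (h : H0 A Q N) : Subsingleton N :=
  Zslot hA hE' hmax k hQ.exc hQ.d.c hQ.d.l N hN.c hN.l ⟨h, hQ.pr N hN.c⟩

theorem Filler.inj (hQ : Filler E' k Q) (hA : Good A) (hE' : IsExcSeq E')
    (hmax : ∀ (l : ℕ) (F : Fin l → ModuleCat.{u} A), IsExcSeq F → l ≤ m + 1)
    (hN : inD E' k N) (g : Q →ₗ[A] N) (hg : g ≠ 0) : Function.Injective g := by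
  rw [← LinearMap.ker_eq_bot]
  by_contra hk
  have h1 : ¬ H0 A Q (LinearMap.ker g) := fun h => by
    have := hQ.sub hA hE' hmax (hQ.d.ker hA hN g) h
    exact hk (Submodule.subsingleton_iff_eq_bot.1 this)
  apply h1
  intro h
  by_contra hh
  apply hg
  have hb := hQ.exc.brick ((LinearMap.ker g).subtype ∘ₗ h) (by
    intro h0
    apply hh
    ext x
    exact LinearMap.congr_fun h0 x)
  ext x
  obtain ⟨y, rfl⟩ := hb.2 x
  exact (h y).2

theorem Filler.genTop (hQ : Filler E' k Q) (hA : Good A) (hE' : IsExcSeq E')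
    (hmax : ∀ (l : ℕ) (F : Fin l → ModuleCat.{u} A), IsExcSeq F → l ≤ m + 1)
    (hN : inD E' k N) (T : Submodule A N) (hT : ∀ g : Q →ₗ[A] N, LinearMap.range g ≤ T) : T = ⊤ := by
  have := hQ.exc.1
  let φ : ((Q →ₗ[A] N) →₀ Q) →ₗ[A] N := Finsupp.lsum ℕ fun f => f
  have hφT : LinearMap.range φ ≤ T := by
    rintro _ ⟨x, rfl⟩
    simp only [φ]
    rw [Finsupp.lsum_apply]
    exact Submodule.sum_mem _ fun g _ => hT g ⟨_, rfl⟩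
  have hD := hQ.d.sum hA (Q →ₗ[A] N)
  have := hQ.sub hA hE' hmax (hD.coker hA hN φ) (fun f => by
    obtain ⟨ψ, rfl⟩ := (ses_sub (LinearMap.range φ)).lift (hQ.pr _ (hD.range hA hN φ).c) f
    ext e
    simp only [LinearMap.comp_apply, Submodule.mkQ_apply, LinearMap.zero_apply, Submodule.Quotient.mk_eq_zero]
    exact ⟨Finsupp.single ψ e, by simp [φ]⟩)
  rw [Submodule.Quotient.subsingleton_iff] at this
  rw [this] at hφT
  exact top_le_iff.1 hφT

theorem Filler.split (hQ : Filler E' k Q) (hA : Good A) (hE' : IsExcSeq E')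
    (hmax : ∀ (l : ℕ) (F : Fin l → ModuleCat.{u} A), IsExcSeq F → l ≤ m + 1)
    (hN : inD E' k N) (f : Q →ₗ[A] N) (hf : f ≠ 0) : ∃ r : N →ₗ[A] Q, r ∘ₗ f = LinearMap.id := by
  have := hQ.exc.1
  have hfi := hQ.inj hA hE' hmax hN f hf
  have hzorn : ∃ U, Maximal (fun U => U ∈ {U : Submodule A N | Gen (Q := Q) U ∧ Disjoint U (LinearMap.range f)}) U := by
    apply zorn_le₀
    intro c hc hch
    refine ⟨sSup c, ⟨gen_sSup c fun U hU => (hc hU).1, ?_⟩, fun U hU => le_sSup hU⟩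
    rw [DirectedOn.disjoint_sSup_left hch.directedOn]
    exact fun U hU => (hc hU).2
  obtain ⟨U, ⟨hUg, hUd⟩, hUmax⟩ := hzorn
  have hTop : U ⊔ LinearMap.range f = ⊤ := by
    apply hQ.genTop hA hE' hmax hN
    intro g
    by_contra hg
    obtain ⟨G, φ, hφ⟩ := gen_map (gen_sup hUg (gen_range f))
    have hgi := hQ.inj hA hE' hmax ((hQ.d.sum hA G).coker hA hN φ) ((LinearMap.range φ).mkQ ∘ₗ g) (by
      intro h0
      apply hg
      rintro _ ⟨q, rfl⟩
      have := LinearMap.congr_fun h0 q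
      simp only [LinearMap.comp_apply, Submodule.mkQ_apply, LinearMap.zero_apply, Submodule.Quotient.mk_eq_zero] at this
      rwa [hφ] at this)
    have hdis : Disjoint (LinearMap.range g) (U ⊔ LinearMap.range f) := by
      rw [← hφ, Submodule.disjoint_def]
      rintro _ ⟨q, rfl⟩ hq
      have : q = 0 := hgi (by simpa using hq)
      simp [this]
    have h3 : Disjoint (LinearMap.range g ⊔ U) (LinearMap.range f) :=
      Disjoint.disjoint_sup_left_of_disjoint_sup_right hUd hdis
    have := hUmax (y := LinearMap.range g ⊔ U) ⟨gen_sup (gen_range g) hUg, h3⟩ le_sup_right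
    exact hg (le_sup_left.trans (this.trans le_sup_left))
  have hcompl : IsCompl U (LinearMap.range f) := ⟨hUd, codisjoint_iff.2 hTop⟩
  refine ⟨LinearMap.ofIsCompl hcompl 0 (LinearEquiv.ofInjective f hfi).symm.toLinearMap, ?_⟩
  ext x
  have := LinearMap.ofIsCompl_apply_right hcompl (φ := (0 : U →ₗ[A] Q)) (ψ := (LinearEquiv.ofInjective f hfi).symm.toLinearMap) (LinearEquiv.ofInjective f hfi x)
  simp only [LinearEquiv.coe_coe, LinearEquiv.symm_apply_apply] at this
  exact this

end split

end part5

section part6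
variable {A : Type u} [Ring A]

structure BP (P : ModuleCat.{u} A) : Prop where
  fin : Module.Finite A P
  proj : Module.Projective A P
  nt : Nontrivial P
  brick : ∀ f : P →ₗ[A] P, f ≠ 0 → Function.Bijective f

theorem BP.exc {P : ModuleCat.{u} A} (h : BP P) : ExceptionalMod P := by
  have := h.proj
  exact exc_of h.fin (proj_H1 _ _) h.nt h.brick

theorem BP.indec {P : ModuleCat.{u} A} (h : BP P) : IndecMod P := by
  refine ⟨h.nt, fun N₁ N₂ hc => ?_⟩
  let f : P →ₗ[A] P := LinearMap.ofIsCompl hc N₁.subtype 0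
  have h1 : ∀ x : N₁, f x = x := fun x => LinearMap.ofIsCompl_apply_left hc x
  have h2 : ∀ x : N₂, f x = 0 := fun x => LinearMap.ofIsCompl_apply_right hc x
  by_cases hf : f = 0
  · left
    rw [eq_bot_iff]
    intro x hx
    have := h1 ⟨x, hx⟩
    rw [hf] at this
    exact this.symm
  · right
    have := (h.brick f hf).1
    rw [eq_bot_iff]
    intro x hx
    exact this (by simpa using h2 ⟨x, hx⟩)

theorem cover (hA : Good A) (S : ModuleCat.{u} A) [IsSimpleModule A S] :
    ∃ P : ModuleCat.{u} A, BP P ∧ ¬ H0 A P S := by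
  have := hA.noeth
  have := hA.art
  have key : ∀ (l : ℕ∞) (P : ModuleCat.{u} A), Module.length A P = l → Module.Finite A P → Module.Projective A P →
      ¬ H0 A P S → ∃ P : ModuleCat.{u} A, BP P ∧ ¬ H0 A P S := by
    intro l
    induction l using WellFoundedLT.induction with
    | ind l ih =>
      intro P hl hf hp h0
      by_cases hb : ∀ f : P →ₗ[A] P, f ≠ 0 → Function.Bijective f
      · refine ⟨P, ⟨hf, hp, ?_, hb⟩, h0⟩
        by_contra hn
        rw [not_nontrivial_iff_subsingleton] at hn
        exact h0 H0_sub_dom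
      · push Not at hb
        obtain ⟨f, hf0, hfb⟩ := hb
        by_cases hR : H0 A (LinearMap.range f) S
        · have hK : ¬ H0 A (LinearMap.ker f) S := fun hK => h0 ((ses_range f).H0_mid' hK hR)
          have hlt : Module.length A (LinearMap.ker f) < Module.length A P :=
            Submodule.length_lt fun h => hf0 (LinearMap.ker_eq_top.1 h)
          refine ih _ (hl ▸ hlt) (ModuleCat.of A (LinearMap.ker f)) rfl ?_ ?_ hK
          · change Module.Finite A (LinearMap.ker f)
            infer_instance
          · exact her_proj hA.her P _
        · refine ih _ (hl ▸ brick_step f hfb) (ModuleCat.of A (LinearMap.range f)) rfl ?_ ?_ hR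
          · change Module.Finite A (LinearMap.range f)
            infer_instance
          · exact her_proj hA.her P _
  refine key _ (ModuleCat.of A A) rfl ?_ ?_ ?_
  · change Module.Finite A A
    infer_instance
  · change Module.Projective A A
    infer_instance
  · intro h
    have := IsSimpleModule.nontrivial A S
    obtain ⟨w, hw⟩ := exists_ne (0 : S)
    have := LinearMap.congr_fun (h (LinearMap.toSpanSingleton A S w)) (1 : A)
    apply hw
    rw [← one_smul A w]
    exact this

theorem hom_of_supp {P S M : ModuleCat.{u} A} (hP : Module.Projective A P) (hPS : ¬ H0 A P S)
    (h : InSupport S M) : ¬ H0 A P M := by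
  intro h0
  apply hPS
  intro φ
  obtain ⟨N₁, N₂, -, ⟨e⟩⟩ := h
  let e' := e.toLinearEquiv
  obtain ⟨ψ, hψ⟩ := Module.projective_lifting_property (e'.toLinearMap ∘ₗ (Submodule.comap N₂.subtype N₁).mkQ) φ
    (e'.surjective.comp (Submodule.mkQ_surjective _))
  have : ψ = 0 := by
    ext x
    exact LinearMap.congr_fun (h0 (N₂.subtype ∘ₗ ψ)) x
  rw [← hψ, this, LinearMap.comp_zero]

theorem supp_of_hom {P S M : ModuleCat.{u} A} [IsSimpleModule A S] (hP : BP P) (hPS : ¬ H0 A P S)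
    (h : ¬ H0 A P M) : InSupport S M := by
  have := hP.proj
  unfold H0 at h hPS
  push Not at h hPS
  obtain ⟨f, hf⟩ := h
  obtain ⟨π, hπ⟩ := hPS
  have hπs : Function.Surjective π := (LinearMap.surjective_or_eq_zero π).resolve_right hπ
  have hk : π ∘ₗ (LinearMap.ker f).subtype = 0 := by
    refine (LinearMap.surjective_or_eq_zero _).resolve_left fun hs => ?_
    obtain ⟨ψ, hψ⟩ := Module.projective_lifting_property _ π hs
    have hb := hP.brick ((LinearMap.ker f).subtype ∘ₗ ψ) (by
      intro h0
      rw [LinearMap.comp_assoc, h0, LinearMap.comp_zero] at hψ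
      exact hπ hψ.symm)
    apply hf
    ext x
    obtain ⟨y, rfl⟩ := hb.2 x
    exact (ψ y).2
  obtain ⟨g, hg⟩ := (ses_range f).cofactor π hk
  have hgs : Function.Surjective g := by
    rw [← hg] at hπs
    exact Function.Surjective.of_comp hπs
  refine ⟨(LinearMap.ker g).map (LinearMap.range f).subtype, LinearMap.range f, Submodule.map_subtype_le _ _, ⟨?_⟩⟩
  exact LinearEquiv.toModuleIso ((Submodule.quotEquivOfEq _ _
    (Submodule.comap_map_eq_of_injective Subtype.val_injective _)).trans (g.quotKerEquivOfSurjective hgs))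

def Core {m : ℕ} (E : Fin (m + 1) → ModuleCat.{u} A) (k : Fin (m + 1)) : Prop :=
  ∃ P : ModuleCat.{u} A, BP P ∧ ∀ j, j ≠ k → H0 A P (E j)

section
variable {m : ℕ} {E : Fin (m + 1) → ModuleCat.{u} A} {k : Fin (m + 1)}

theorem core_k (hE : CompleteES E) {P : ModuleCat.{u} A} (hP : BP P) (h : ∀ j, j ≠ k → H0 A P (E j)) :
    ¬ H0 A P (E k) := by
  intro h0
  have := hP.proj
  have := hE.2 _ _ (insert_exc hE.1 (Fin.last (m + 1)) hP.exc
    (fun j hj => absurd j.2 (by simp at hj; omega))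
    (fun j _ => ⟨by
      by_cases hj : j = k
      · rw [hj]; exact h0
      · exact h j hj, proj_H1 _ _⟩))
  omega

theorem exc_remove (hE : IsExcSeq E) (k : Fin (m + 1)) : IsExcSeq (fun i : Fin m => E (k.succAbove i)) :=
  ⟨fun i => hE.1 _, fun i j hij => hE.2 _ _ (by simpa using hij)⟩

theorem core_iff3 (hE : CompleteES E) : Core E k ↔
      (∃ P : ModuleCat.{u} A, Projective P ∧ IndecMod P ∧
        CompleteES (Fin.snoc (fun i : Fin m => E (k.succAbove i)) P)) := by
  constructor
  · rintro ⟨P, hP, h⟩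
    have := hP.proj
    refine ⟨P, (IsProjective.iff_projective P).1 hP.proj, hP.indec, ?_, hE.2⟩
    have := insert_exc (exc_remove hE.1 k) (Fin.last m) hP.exc
      (fun j hj => absurd j.2 (by simp at hj; omega))
      (fun j _ => ⟨h _ (Fin.succAbove_ne k j), proj_H1 _ _⟩)
    rw [Fin.insertNth_last'] at this
    exact this
  · rintro ⟨P, hp, -, hC, -⟩
    have hP := hC.1 (Fin.last m)
    simp only [Fin.snoc_last] at hP
    refine ⟨P, ⟨hP.1, (IsProjective.iff_projective P).2 hp, hP.2.2.1, hP.brick⟩, fun j hj => ?_⟩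
    obtain ⟨i, rfl⟩ := Fin.exists_succAbove_eq hj
    have := (hC.2 _ _ (Fin.castSucc_lt_last i)).1
    simp only [Fin.snoc_last, Fin.snoc_castSucc] at this
    exact (homZero_iff _ _).1 this

theorem core_iff2 (hA : Good A) (hE : CompleteES E) : Core E k ↔
      (∃ S : ModuleCat.{u} A, IsSimpleModule A S ∧ InSupport S (E k) ∧
        ∀ j : Fin (m + 1), j ≠ k → ¬ InSupport S (E j)) := by
  constructor
  · rintro ⟨P, hP, h⟩
    have := hP.fin
    have := hP.nt
    obtain ⟨N, hN, -⟩ := (eq_top_or_exists_le_coatom (⊥ : Submodule A P)).resolve_left bot_ne_top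
    have hS : IsSimpleModule A (P ⧸ N) := isSimpleModule_iff_isCoatom.2 hN
    have hS' : IsSimpleModule A (ModuleCat.of A (P ⧸ N)) := hS
    have h0 : ¬ H0 A P (ModuleCat.of A (P ⧸ N)) := fun h0 => by
      have := h0 N.mkQ
      apply hN.1
      rw [← N.ker_mkQ, LinearMap.ker_eq_top]
      exact this
    exact ⟨ModuleCat.of A (P ⧸ N), hS', supp_of_hom hP h0 (core_k hE hP h),
      fun j hj hs => hom_of_supp hP.proj h0 hs (h j hj)⟩
  · rintro ⟨S, hS, -, h⟩
    obtain ⟨P, hP, hPS⟩ := cover hA S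
    refine ⟨P, hP, fun j hj => ?_⟩
    by_contra h0
    exact h j hj (supp_of_hom hP hPS h0)

theorem Aperp_iff (X : ModuleCat.{u} A) : Aperp E k X ↔ inC (fun i : Fin m => E (k.succAbove i)) k X := by
  constructor
  · intro h j hj
    exact (rperp_iff _ _).1 (h _ (by rw [Fin.lt_succAbove_iff_le_castSucc]; exact hj))
  · intro h j hj
    obtain ⟨i, rfl⟩ := Fin.exists_succAbove_eq hj.ne'
    rw [Fin.lt_succAbove_iff_le_castSucc] at hj
    exact (rperp_iff _ _).2 (h i hj)

theorem Bperp_iff (X : ModuleCat.{u} A) : Bperp E k X ↔ inL (fun i : Fin m => E (k.succAbove i)) k X := by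
  constructor
  · intro h j hj
    exact (lperp_iff _ _).1 (h _ (by rw [Fin.succAbove_lt_iff_castSucc_lt]; exact hj))
  · intro h j hj
    obtain ⟨i, rfl⟩ := Fin.exists_succAbove_eq hj.ne
    rw [Fin.succAbove_lt_iff_castSucc_lt] at hj
    exact (lperp_iff _ _).2 (h i hj)

theorem inD_k (hE : IsExcSeq E) : inD (fun i : Fin m => E (k.succAbove i)) k (E k) :=
  ⟨(Aperp_iff _).1 fun _ hj => hE.2 _ _ hj, (Bperp_iff _).1 fun _ hj => hE.2 _ _ hj⟩

theorem H1_of_retr {X Y : Type u} [AddCommGroup X] [Module A X] [AddCommGroup Y] [Module A Y]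
    (H : ∀ (W : Type u) [AddCommGroup W] [Module A W] (i : Y →ₗ[A] W) (p : W →ₗ[A] X),
    SES i p → ∃ r : W →ₗ[A] Y, r ∘ₗ i = LinearMap.id) : H1 A X Y := by
  rw [H1_iff]
  intro W _ _ i p hs
  obtain ⟨r, hr⟩ := H W i p hs
  obtain ⟨s, h⟩ := hs.cofactor (LinearMap.id - i ∘ₗ r) (by
    rw [LinearMap.sub_comp, LinearMap.comp_assoc, hr]; simp)
  refine ⟨s, ?_⟩
  ext x
  obtain ⟨w, rfl⟩ := hs.surj x
  have := LinearMap.congr_fun h w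
  simp only [LinearMap.comp_apply] at this ⊢
  rw [this]
  simp [hs.ex.apply_apply_eq_zero]

theorem relProj_iff (hA : Good A) (hE : IsExcSeq E) : RelProj E k ↔
    ∀ (V : Type u) [AddCommGroup V] [Module A V], inC (fun i : Fin m => E (k.succAbove i)) k V → H1 A (E k) V := by
  constructor
  · rintro ⟨h1, h2⟩ V _ _ hV
    rw [H1_iff]
    intro W _ _ i p hs
    obtain ⟨g, hg⟩ := h2 (ModuleCat.of A W) (E k) ((Aperp_iff _).2 fun j hj => hs.RP_mid (hV j hj) ((inD_k hE).c j hj)) h1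
      (ModuleCat.ofHom p) ((ModuleCat.epi_iff_surjective _).2 hs.surj) (𝟙 _)
    exact ⟨g.hom, congrArg ModuleCat.Hom.hom hg⟩
  · intro h
    refine ⟨fun j hj => hE.2 _ _ hj, fun Y Z hY hZ p hp f => ?_⟩
    rw [Aperp_iff] at hY hZ
    obtain ⟨g, hg⟩ := (ses_ker ((ModuleCat.epi_iff_surjective p).1 hp)).lift
      (h _ fun j hj => RP.ker hA.her (hY j hj) (hZ j hj)) f.hom
    exact ⟨ModuleCat.ofHom g, ModuleCat.hom_ext hg⟩

theorem relInj_iff (hA : Good A) (hE : IsExcSeq E) : RelInj E k ↔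
    ∀ (V : Type u) [AddCommGroup V] [Module A V], inL (fun i : Fin m => E (k.succAbove i)) k V → H1 A V (E k) := by
  constructor
  · rintro ⟨h1, h2⟩ V _ _ hV
    apply H1_of_retr
    intro W _ _ i p hs
    obtain ⟨g, hg⟩ := h2 (E k) (ModuleCat.of A W) h1 ((Bperp_iff _).2 fun j hj => hs.RP_mid' ((inD_k hE).l j hj) (hV j hj))
      (ModuleCat.ofHom i) ((ModuleCat.mono_iff_injective _).2 hs.inj) (𝟙 _)
    exact ⟨g.hom, congrArg ModuleCat.Hom.hom hg⟩
  · intro h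
    refine ⟨fun j hj => hE.2 _ _ hj, fun Y Z hY hZ i hi f => ?_⟩
    rw [Bperp_iff] at hY hZ
    have hs : SES i.hom (LinearMap.range i.hom).mkQ :=
      ⟨(ModuleCat.mono_iff_injective i).1 hi, LinearMap.exact_map_mkQ_range i.hom, Submodule.mkQ_surjective _⟩
    obtain ⟨g, hg⟩ := hs.ext (h _ fun j hj => RP.coker' hA.her (hY j hj) (hZ j hj)) f.hom
    exact ⟨ModuleCat.ofHom g, ModuleCat.hom_ext hg⟩

end

end part6

section part7
variable {A : Type u} [Ring A]
variable {m : ℕ} {E : Fin (m + 1) → ModuleCat.{u} A} {k : Fin (m + 1)}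

theorem ne_zero_of_not_H0 {X Y : Type u} [AddCommGroup X] [Module A X] [AddCommGroup Y] [Module A Y]
    (h : ¬ H0 A X Y) : ∃ f : X →ₗ[A] Y, f ≠ 0 := by
  unfold H0 at h
  push Not at h
  exact h

theorem core_filler (hA : Good A) (hE : CompleteES E) (h : Core E k) :
    Filler (fun i : Fin m => E (k.succAbove i)) k (E k) := by
  obtain ⟨P, hP, h⟩ := h
  have := hP.proj
  have := hP.fin
  have hE' := exc_remove hE.1 k
  have hD := inD_k (k := k) hE.1
  obtain ⟨Q, q1, q2, q3, q4⟩ := Xlem hA hE' (t := k) (by omega) P (fun j _ => h _ (Fin.succAbove_ne k j)) (E k)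
    hD.c (core_k hE hP h)
  have hQ : Filler (fun i : Fin m => E (k.succAbove i)) k Q := ⟨q1, ⟨q2, q3⟩, q4⟩
  have hn := (hE.1.1 k).2.2.1
  obtain ⟨f, hf⟩ := ne_zero_of_not_H0 (fun h0 => not_subsingleton (E k) (hQ.sub hA hE' hE.2 hD h0))
  obtain ⟨r, hr⟩ := hQ.split hA hE' hE.2 hD f hf
  have hb := (hE.1.1 k).brick (f ∘ₗ r) (by
    intro h0
    apply hf
    have : f ∘ₗ (r ∘ₗ f) = 0 := by rw [← LinearMap.comp_assoc, h0, LinearMap.zero_comp]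
    rwa [hr, LinearMap.comp_id] at this)
  have hinj : Function.Injective f := Function.LeftInverse.injective (g := r) fun x => LinearMap.congr_fun hr x
  have hsurj : Function.Surjective f := Function.Surjective.of_comp (g := r) hb.2
  exact ⟨hE.1.1 k, hD, fun V _ _ hV => H1_equiv' (LinearEquiv.ofBijective f ⟨hinj, hsurj⟩) (q4 V hV)⟩

theorem core_relInj (hA : Good A) (hE : CompleteES E) (hcore : Core E k) :
    ∀ (V : Type u) [AddCommGroup V] [Module A V], inL (fun i : Fin m => E (k.succAbove i)) k V → H1 A V (E k) := by
  have hF := core_filler hA hE hcore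
  obtain ⟨P, hP, h⟩ := hcore
  have := hP.proj
  have := hP.fin
  have hE' := exc_remove hE.1 k
  have hD := inD_k (k := k) hE.1
  intro W _ _ hW
  apply H1_of_retr
  intro V _ _ i p hs
  have hV : inL (fun i : Fin m => E (k.succAbove i)) k V := fun j hj => hs.RP_mid' (hD.l j hj) (hW j hj)
  have step : ∀ d s, s + d = m → k.val ≤ s → ∃ (V' : Type u) (_ : AddCommGroup V') (_ : Module A V') (g : V →ₗ[A] V'),
      inC (fun i : Fin m => E (k.succAbove i)) s V' ∧ inL (fun i : Fin m => E (k.succAbove i)) k V' ∧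
      ∀ φ : P →ₗ[A] V, φ ≠ 0 → g ∘ₗ φ ≠ 0 := by
    intro d
    induction d with
    | zero =>
      intro s hs hk
      exact ⟨V, _, _, LinearMap.id, fun j hj => absurd j.2 (by omega), hV, fun φ hφ => hφ⟩
    | succ d ih =>
      intro s hs hk
      obtain ⟨V', _, _, g, g1, g2, g3⟩ := ih (s + 1) (by omega) (by omega)
      have hsm : s < m := by omega
      have := (hE'.1 ⟨s, hsm⟩).1
      obtain ⟨W1, W', I, B, _, _, _, _, a, q, φ, r, hr, -⟩ := reflect hA (E (k.succAbove ⟨s, hsm⟩)) (hE'.1 ⟨s, hsm⟩).h1 V'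
      refine ⟨W', _, _, r ∘ₗ a ∘ₗ g, (inC_refl hA hE' hsm hr g1).1, fun j hj =>
        hr.lpW' hA (g2 j hj) (hE'.rp (i := j) (j := ⟨s, hsm⟩) (Fin.lt_def.2 (by simp only; omega))), fun φ' hφ' h0 => ?_⟩
      apply g3 φ' hφ'
      have h1 : H0 A P (LinearMap.range φ) :=
        (ses_range φ).H0_quot (H0_sum' _ (h _ (Fin.succAbove_ne k _))) (proj_H1 _ _)
      obtain ⟨ψ, hψ⟩ := hr.s2.factor (a ∘ₗ g ∘ₗ φ') (by
        rw [← h0]; rfl)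
      rw [h1 ψ, LinearMap.comp_zero] at hψ
      ext x
      apply hr.s1.inj
      rw [LinearMap.zero_apply, map_zero]
      exact (LinearMap.congr_fun hψ x).symm
  obtain ⟨V', _, _, g, g1, g2, g3⟩ := step (m - k) k (by omega) le_rfl
  obtain ⟨α, hα⟩ := ne_zero_of_not_H0 (core_k hE hP h)
  have h1 : g ∘ₗ i ≠ 0 := by
    intro h0
    refine g3 (i ∘ₗ α) ?_ ?_
    · intro h2
      apply hα
      ext x
      apply hs.inj
      rw [LinearMap.zero_apply, map_zero]
      exact LinearMap.congr_fun h2 x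
    · rw [← LinearMap.comp_assoc, h0, LinearMap.zero_comp]
  obtain ⟨r, hr⟩ := hF.split hA hE' hE.2 ⟨g1, g2⟩ (g ∘ₗ i) h1
  exact ⟨r ∘ₗ g, hr⟩

theorem rel_H1 (hA : Good A) (hE : CompleteES E)
    (hp : ∀ (V : Type u) [AddCommGroup V] [Module A V], inC (fun i : Fin m => E (k.succAbove i)) k V → H1 A (E k) V)
    (hi : ∀ (V : Type u) [AddCommGroup V] [Module A V], inL (fun i : Fin m => E (k.succAbove i)) k V → H1 A V (E k))
    (Y : Type u) [AddCommGroup Y] [Module A Y] (hY : inC (fun i : Fin m => E (k.succAbove i)) 0 Y)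
    (M : Type u) [AddCommGroup M] [Module A M] [Module.Finite A M] : H1 A M Y := by
  have := hA.noeth
  have hYj : ∀ j, j ≠ k → RP A (E j) Y := fun j hj => by
    obtain ⟨i, rfl⟩ := Fin.exists_succAbove_eq hj
    exact hY i (Nat.zero_le _)
  have h1Y : ∀ j, H1 A (E j) Y := fun j => by
    by_cases hj : j = k
    · rw [hj]
      exact hp Y fun j _ => hY j (Nat.zero_le _)
    · exact (hYj j hj).2
  have key : ∀ d s, s + d = m + 1 → ∀ (M : Type u) [AddCommGroup M] [Module A M], Module.Finite A M → inL E s M → H1 A M Y := by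
    intro d
    induction d with
    | zero =>
      intro s hs M _ _ _ hM
      have := Zlem hA hE.1 (fun W _ _ hW => hzero hA hE W hW) (t := m + 1) le_rfl M
        (fun j hj => absurd j.2 (by omega)) (fun j hj => hM j (by omega))
      exact H1_sub_dom
    | succ d ih =>
      intro s hs M _ _ _ hM
      have hsm : s < m + 1 := by omega
      have := (hE.1.1 ⟨s, hsm⟩).1
      have h11 := (hE.1.1 ⟨s, hsm⟩).h1
      have hes : ∀ j : Fin (m + 1), j.val < s → RP A (E ⟨s, hsm⟩) (E j) := fun j hj => hE.1.rp (by exact hj)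
      have sub : ∃ (W : Type u) (_ : AddCommGroup W) (_ : Module A W), Module.Finite A W ∧ H1 A W (E ⟨s, hsm⟩) ∧
          inL E s W ∧ (H1 A W Y → H1 A M Y) := by
        by_cases hk : (⟨s, hsm⟩ : Fin (m + 1)) = k
        · refine ⟨M, _, _, ‹_›, ?_, hM, id⟩
          rw [hk]
          refine hi M ((Bperp_iff (ModuleCat.of A M)).1 fun j hj => (lperp_iff _ _).2 (hM j ?_))
          rw [← hk] at hj
          exact hj
        · obtain ⟨n, W, _, _, i, q, h1, h2, h3⟩ := corefl1 hA (E ⟨s, hsm⟩) h11 M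
          exact ⟨W, _, _, h3, h2, fun j hj => h1.RP_mid' (RP_sum _ (hes j hj)) (hM j hj),
            fun h => h1.H1_quot' (H0_sum _ (hYj _ hk).1) h⟩
      obtain ⟨W, _, _, hWf, hWe, hWL, hWY⟩ := sub
      apply hWY
      obtain ⟨n, v, hv⟩ := span_hom hA W (E ⟨s, hsm⟩)
      let φ : W →ₗ[A] (ULift.{u} (Fin n) →₀ E ⟨s, hsm⟩) := ∑ t, Finsupp.lsingle (ULift.up t) ∘ₗ v t
      have hφ : ∀ w, φ w = 0 → ∀ t, v t w = 0 := fun w hw t => by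
        have := DFunLike.congr_fun hw (ULift.up t)
        simpa [φ, Finsupp.single_apply, ULift.up_inj] using this
      have hr : ∀ (D : Type u) [AddCommGroup D] [Module A D], H1 A (E ⟨s, hsm⟩) D → H1 A (LinearMap.range φ) D :=
        fun D _ _ hD => (ses_sub (LinearMap.range φ)).H1_sub' hA.her (H1_sum _ hD)
      refine (ses_range φ).H1_mid' (ih (s + 1) (by omega) (LinearMap.ker φ) inferInstance ?_) (hr Y (h1Y _))
      intro j hj
      rcases (Nat.lt_succ_iff.1 hj).eq_or_lt with hj | hj
      · have : j = ⟨s, hsm⟩ := Fin.ext hj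
        rw [this]
        refine ⟨fun f => ?_, (ses_range φ).H1_sub' hA.her hWe⟩
        obtain ⟨g, rfl⟩ := (ses_range φ).ext (hr _ h11) f
        obtain ⟨c, rfl⟩ := hv g
        ext x
        simp only [LinearMap.comp_apply, LinearMap.sum_apply, LinearMap.zero_apply]
        refine Finset.sum_eq_zero fun t _ => ?_
        rw [Submodule.subtype_apply, hφ x x.2 t, map_zero]
      · exact RP.ker' hA.her (hWL j hj) (RP_sum _ (hes j hj))
  exact key (m + 1) 0 (by omega) M ‹_› fun j hj => absurd hj (Nat.not_lt_zero _)

theorem rel_core (hA : Good A) (hE : CompleteES E)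
    (hp : ∀ (V : Type u) [AddCommGroup V] [Module A V], inC (fun i : Fin m => E (k.succAbove i)) k V → H1 A (E k) V)
    (hi : ∀ (V : Type u) [AddCommGroup V] [Module A V], inL (fun i : Fin m => E (k.succAbove i)) k V → H1 A V (E k)) :
    Core E k := by
  have := hA.art
  have := hA.noeth
  have hD := inD_k (k := k) hE.1
  have hn := (hE.1.1 k).2.2.1
  have : ∃ Y : ModuleCat.{u} A, inC (fun i : Fin m => E (k.succAbove i)) 0 Y ∧ Nontrivial Y := by
    by_contra hno
    refine not_subsingleton (E k) (Zlem hA (exc_remove hE.1 k) (fun W _ _ hW => ?_) (t := k) (by omega) (E k) hD.c hD.l)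
    by_contra hs
    exact hno ⟨ModuleCat.of A W, hW, not_subsingleton_iff_nontrivial.1 hs⟩
  obtain ⟨Y, hY, hYn⟩ := this
  obtain ⟨y, hy⟩ := exists_ne (0 : Y)
  have : Nontrivial (Submodule.span A {y}) := by
    rw [Submodule.nontrivial_iff_ne_bot]
    simpa using hy
  have : IsAtomic (Submodule A (Submodule.span A {y})) := isAtomic_of_orderBot_wellFounded_lt wellFounded_lt
  obtain ⟨T, hT, -⟩ := (eq_bot_or_exists_atom_le (⊤ : Submodule A (Submodule.span A {y}))).resolve_left top_ne_bot
  have hS : IsSimpleModule A (ModuleCat.of A T) := isSimpleModule_iff_isAtom.2 hT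
  let ι : T →ₗ[A] Y := (Submodule.span A {y}).subtype ∘ₗ T.subtype
  have hι : Function.Injective ι := Subtype.val_injective.comp Subtype.val_injective
  obtain ⟨P, hP, hPS⟩ := cover hA (ModuleCat.of A T)
  refine ⟨P, hP, fun j hj => ?_⟩
  by_contra h0
  obtain ⟨N₁, N₂, -, ⟨e⟩⟩ := supp_of_hom hP hPS h0
  have hfin := (hE.1.1 j).1
  let e' := e.toLinearEquiv
  let π : N₂ →ₗ[A] T := e'.toLinearMap ∘ₗ (Submodule.comap N₂.subtype N₁).mkQ
  have hπ : Function.Surjective π := e'.surjective.comp (Submodule.mkQ_surjective _)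
  obtain ⟨g, hg⟩ := (ses_sub N₂).ext (rel_H1 hA hE hp hi Y hY (E j ⧸ N₂)) (ι ∘ₗ π)
  obtain ⟨i, rfl⟩ := Fin.exists_succAbove_eq hj
  rw [(hY i (Nat.zero_le _)).1 g, LinearMap.zero_comp] at hg
  have hTn := IsSimpleModule.nontrivial A (ModuleCat.of A T)
  obtain ⟨t, ht⟩ := exists_ne (0 : ModuleCat.of A T)
  obtain ⟨x, hx⟩ := hπ t
  apply ht
  apply hι
  have := LinearMap.congr_fun hg x
  rw [← hx, map_zero]
  exact this.symm

theorem core_iff1 (hA : Good A) (hE : CompleteES E) : (RelProj E k ∧ RelInj E k) ↔ Core E k := by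
  rw [relProj_iff hA hE.1, relInj_iff hA hE.1]
  exact ⟨fun h => rel_core hA hE h.1 h.2, fun h => ⟨(core_filler hA hE h).pr, core_relInj hA hE h⟩⟩

end part7


end Helpers

/-- For a complete exceptional sequence `(E₁, …, Eₙ)` the following are
equivalent: (1) `Eₖ` is both relatively projective and relatively injective; (2) some
simple module (vertex) is in the support of `Eₖ` but of no other term; (3) there is an
indecomposable projective module `P` such that `(E₁, …, Êₖ, …, Eₙ, P)` is a complete
exceptional sequence. -/
theorem stmt10 {K : Type u} [Field K] {A : Type u} [Ring A] [Algebra K A]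
    [FiniteDimensional K A] (hA : Hereditary A)
    {m : ℕ} (E : Fin (m + 1) → ModuleCat.{u} A) (hE : CompleteES E) (k : Fin (m + 1)) :
    ((RelProj E k ∧ RelInj E k) ↔
      (∃ S : ModuleCat.{u} A, IsSimpleModule A S ∧ InSupport S (E k) ∧
        ∀ j : Fin (m + 1), j ≠ k → ¬ InSupport S (E j)))
    ∧
    ((RelProj E k ∧ RelInj E k) ↔
      (∃ P : ModuleCat.{u} A, Projective P ∧ IndecMod P ∧
        CompleteES (Fin.snoc (fun i : Fin m => E (k.succAbove i)) P))) := by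
  have hG : Good A := ⟨hA, K, inferInstance, inferInstance, inferInstance⟩
  exact ⟨(core_iff1 hG hE).trans (core_iff2 hG hE), (core_iff1 hG hE).trans (core_iff3 hE)⟩

end ExcSeq
end

section
/- For a hereditary path algebra of Dynkin type with Coxeter number h, the probability that the k-th term of a uniformly random complete exceptional sequence is both relatively projective and relatively injective equals 2/h, for every k. -/
open CategoryTheory

universe u

variable {A : Type u} [Ring A]

namespace ExcSeq

/-- The setoid on sequences of modules identifying termwise isomorphic sequences. -/
def isoSetoid (n : ℕ) : Setoid (Fin n → ModuleCat.{u} A) where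
  r E F := ∀ i, Nonempty (E i ≅ F i)
  iseqv := ⟨fun _ i => ⟨Iso.refl _⟩, fun h i => ⟨(h i).some.symm⟩,
    fun h h' i => ⟨(h i).some.trans ((h' i).some)⟩⟩

/-- The number of isomorphism classes of sequences of modules belonging to `S`. -/
noncomputable def isoClassCount {n : ℕ} (S : Set (Fin n → ModuleCat.{u} A)) : ℕ :=
  Nat.card (Quotient (Setoid.comap (Subtype.val : S → (Fin n → ModuleCat.{u} A))
    (isoSetoid n)))


section Generic

open Limits
open Abelian (Ext)

attribute [local instance] Abelian.hasFiniteBiproducts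

universe w v u'

variable {C : Type u'} [Category.{v} C] [Abelian C] [HasExt.{w} C]

/-- `Ext¹` vanishing through Mathlib's `Ext`. -/
def Eo (X Y : C) : Prop := ∀ e : Ext X Y 1, e = 0

/-- `Hom` vanishing. -/
def Ho (X Y : C) : Prop := ∀ f : X ⟶ Y, f = 0

/-- short exact sequences. -/
def SES_s11 {X Y Z : C} (i : X ⟶ Y) (p : Y ⟶ Z) : Prop :=
  ∃ w : i ≫ p = 0, (ShortComplex.mk i p w).ShortExact

/-- the category is hereditary. -/
def Her (C : Type u') [Category.{v} C] [Abelian C] [HasExt.{w} C] : Prop :=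
  ∀ (X Y : C) (e : Ext X Y 2), e = 0

variable {X Y Z B : C} {i : X ⟶ Y} {p : Y ⟶ Z}

lemma SES_s11.mono (h : SES_s11 i p) : Mono i := h.2.mono_f
lemma SES_s11.epi (h : SES_s11 i p) : Epi p := h.2.epi_g

lemma ses_ker_s11 (f : X ⟶ Y) : SES_s11 (kernel.ι f) (factorThruImage f) := by
  have w : kernel.ι f ≫ factorThruImage f = 0 := by
    rw [← cancel_mono (image.ι f)]; simp
  refine ⟨w, ?_⟩
  have : (ShortComplex.mk _ _ w).Exact := by
    apply ShortComplex.exact_of_f_is_kernel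
    refine KernelFork.IsLimit.ofι _ _ (fun g hg => kernel.lift f g ?_) ?_ ?_
    · dsimp at hg
      rw [← image.fac f, ← Category.assoc, hg, zero_comp]
    · intros; simp
    · intro _ g hg m hm
      rw [← cancel_mono (kernel.ι f)]; simpa using hm
  exact { exact := this }

lemma ses_coker (f : X ⟶ Y) : SES_s11 (image.ι f) (cokernel.π f) := by
  have w : image.ι f ≫ cokernel.π f = 0 := by
    rw [← cancel_epi (factorThruImage f)]; simp
  refine ⟨w, ?_⟩
  have : (ShortComplex.mk _ _ w).Exact := by
    apply ShortComplex.exact_of_g_is_cokernel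
    refine CokernelCofork.IsColimit.ofπ _ _ (fun g hg => cokernel.desc f g ?_) ?_ ?_
    · dsimp at hg
      rw [← image.fac f, Category.assoc, hg, comp_zero]
    · intros; simp
    · intro _ g hg m hm
      rw [← cancel_epi (cokernel.π f)]; simpa using hm
  exact { exact := this }

lemma ses_of_epi (f : X ⟶ Y) [Epi f] : SES_s11 (kernel.ι f) f :=
  ⟨kernel.condition f, { exact := ShortComplex.exact_kernel f }⟩

lemma ses_of_mono (f : X ⟶ Y) [Mono f] : SES_s11 f (cokernel.π f) :=
  ⟨cokernel.condition f, { exact := ShortComplex.exact_cokernel f }⟩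

/-- lifting along the epi -/
lemma SES_s11.lift (h : SES_s11 i p) (hB : Eo B X) (f : B ⟶ Z) : ∃ g : B ⟶ Y, g ≫ p = f := by
  obtain ⟨w, h⟩ := h
  obtain ⟨φ, hφ⟩ := Ext.covariant_sequence_exact₃ _ h (Ext.mk₀ f) (zero_add 1) (hB _)
  obtain ⟨φ, rfl⟩ := Ext.homEquiv₀.symm.surjective φ
  exact ⟨φ, Ext.homEquiv₀.symm.injective (by simpa using! hφ)⟩

lemma SES_s11.desc (h : SES_s11 i p) (hB : Eo Z B) (f : X ⟶ B) : ∃ g : Y ⟶ B, i ≫ g = f := by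
  obtain ⟨w, h⟩ := h
  obtain ⟨φ, hφ⟩ := Ext.contravariant_sequence_exact₁ h _ (Ext.mk₀ f) (add_zero 1) (hB _)
  obtain ⟨φ, rfl⟩ := Ext.homEquiv₀.symm.surjective φ
  exact ⟨φ, Ext.homEquiv₀.symm.injective (by simpa using! hφ)⟩

lemma SES_s11.lift_ker (h : SES_s11 i p) (f : B ⟶ Y) (hf : f ≫ p = 0) : ∃ g : B ⟶ X, g ≫ i = f := by
  obtain ⟨w, h⟩ := h
  haveI := h.mono_f
  exact ⟨h.exact.lift f hf, h.exact.lift_f _ _⟩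

lemma SES_s11.desc_coker (h : SES_s11 i p) (f : Y ⟶ B) (hf : i ≫ f = 0) : ∃ g : Z ⟶ B, p ≫ g = f := by
  obtain ⟨w, h⟩ := h
  haveI := h.epi_g
  exact ⟨h.exact.desc f hf, h.exact.g_desc _ _⟩

lemma SES_s11.cH1 (h : SES_s11 i p) (hY : Ho B Y) : Ho B X := fun f => by
  haveI := h.mono
  rw [← cancel_mono i, hY (f ≫ i), zero_comp]

lemma SES_s11.cH2 (h : SES_s11 i p) (hX : Ho B X) (hZ : Ho B Z) : Ho B Y := fun f => by
  obtain ⟨g, rfl⟩ := h.lift_ker f (hZ _)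
  rw [hX g, zero_comp]

lemma SES_s11.cH3 (h : SES_s11 i p) (hX : Eo B X) (hY : Ho B Y) : Ho B Z := fun f => by
  obtain ⟨g, rfl⟩ := h.lift hX f
  rw [hY g, zero_comp]

lemma SES_s11.cE1' (h : SES_s11 i p) (hY : Eo B Y) (hs : ∀ f : B ⟶ Z, ∃ g : B ⟶ Y, g ≫ p = f) :
    Eo B X := fun e => by
  obtain ⟨w, h⟩ := h
  obtain ⟨x, rfl⟩ := Ext.covariant_sequence_exact₁ _ h e (hY _) (zero_add 1)
  obtain ⟨x, rfl⟩ := Ext.homEquiv₀.symm.surjective x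
  obtain ⟨g, rfl⟩ := hs x
  have : Ext.homEquiv₀.symm (g ≫ p) = (Ext.mk₀ g).comp (Ext.mk₀ p) (zero_add 0) := by
    simp [Ext.mk₀_comp_mk₀]
  rw [this]
  have h2 := h.comp_extClass
  dsimp at h2 ⊢
  rw [Ext.comp_assoc _ _ _ (zero_add 0) (zero_add 1) (by simp), h2, Ext.comp_zero]

lemma SES_s11.cE1 (h : SES_s11 i p) (hY : Eo B Y) (hZ : Ho B Z) : Eo B X :=
  h.cE1' hY fun f => ⟨0, by rw [hZ f, zero_comp]⟩

lemma SES_s11.cE2 (h : SES_s11 i p) (hX : Eo B X) (hZ : Eo B Z) : Eo B Y := fun e => by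
  obtain ⟨w, h⟩ := h
  obtain ⟨x, rfl⟩ := Ext.covariant_sequence_exact₂ _ h e (hZ _)
  rw [hX x, Ext.zero_comp]

lemma SES_s11.cE3 (hC : Her.{w} C) (h : SES_s11 i p) (hY : Eo B Y) : Eo B Z := fun e => by
  obtain ⟨w, h⟩ := h
  obtain ⟨x, rfl⟩ := Ext.covariant_sequence_exact₃ _ h e rfl (hC _ _ _)
  rw [hY x, Ext.zero_comp]

lemma SES_s11.dH3 (h : SES_s11 i p) (hY : Ho Y B) : Ho Z B := fun f => by
  haveI := h.epi
  rw [← cancel_epi p, hY (p ≫ f), comp_zero]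

lemma SES_s11.dH2 (h : SES_s11 i p) (hX : Ho X B) (hZ : Ho Z B) : Ho Y B := fun f => by
  obtain ⟨g, rfl⟩ := h.desc_coker f (hX _)
  rw [hZ g, comp_zero]

lemma SES_s11.dH1 (h : SES_s11 i p) (hZ : Eo Z B) (hY : Ho Y B) : Ho X B := fun f => by
  obtain ⟨g, rfl⟩ := h.desc hZ f
  rw [hY g, comp_zero]

lemma SES_s11.dE3' (h : SES_s11 i p) (hY : Eo Y B) (hs : ∀ f : X ⟶ B, ∃ g : Y ⟶ B, i ≫ g = f) :
    Eo Z B := fun e => by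
  obtain ⟨w, h⟩ := h
  obtain ⟨x, rfl⟩ := Ext.contravariant_sequence_exact₃ h _ e (hY _) (add_zero 1)
  obtain ⟨x, rfl⟩ := Ext.homEquiv₀.symm.surjective x
  obtain ⟨g, rfl⟩ := hs x
  have : Ext.homEquiv₀.symm (i ≫ g) = (Ext.mk₀ i).comp (Ext.mk₀ g) (zero_add 0) := by
    simp [Ext.mk₀_comp_mk₀]
  rw [this]
  have h2 := h.extClass_comp
  dsimp at h2 ⊢
  rw [← Ext.comp_assoc _ _ _ (add_zero 1) (zero_add 0) (by simp), h2, Ext.zero_comp]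

lemma SES_s11.dE3 (h : SES_s11 i p) (hY : Eo Y B) (hX : Ho X B) : Eo Z B :=
  h.dE3' hY fun f => ⟨0, by rw [hX f, comp_zero]⟩

lemma SES_s11.dE2 (h : SES_s11 i p) (hX : Eo X B) (hZ : Eo Z B) : Eo Y B := fun e => by
  obtain ⟨w, h⟩ := h
  obtain ⟨x, rfl⟩ := Ext.contravariant_sequence_exact₂ h _ e (hX _)
  rw [hZ x, Ext.comp_zero]

lemma SES_s11.dE1 (hC : Her.{w} C) (h : SES_s11 i p) (hY : Eo Y B) : Eo X B := fun e => by
  obtain ⟨w, h⟩ := h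
  obtain ⟨x, rfl⟩ := Ext.contravariant_sequence_exact₁ h _ e rfl (hC _ _ _)
  rw [hY x, Ext.comp_zero]

/-- perpendicularity: `Y ∈ X^⊥`. -/
def Pp (X Y : C) : Prop := Ho X Y ∧ Eo X Y

lemma SES_s11.c2 (h : SES_s11 i p) (hX : Pp B X) (hZ : Pp B Z) : Pp B Y :=
  ⟨h.cH2 hX.1 hZ.1, h.cE2 hX.2 hZ.2⟩
lemma SES_s11.c1 (h : SES_s11 i p) (hY : Pp B Y) (hZ : Pp B Z) : Pp B X :=
  ⟨h.cH1 hY.1, h.cE1 hY.2 hZ.1⟩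
lemma SES_s11.c3 (hC : Her.{w} C) (h : SES_s11 i p) (hX : Pp B X) (hY : Pp B Y) : Pp B Z :=
  ⟨h.cH3 hX.2 hY.1, h.cE3 hC hY.2⟩
lemma SES_s11.d2 (h : SES_s11 i p) (hX : Pp X B) (hZ : Pp Z B) : Pp Y B :=
  ⟨h.dH2 hX.1 hZ.1, h.dE2 hX.2 hZ.2⟩
lemma SES_s11.d3 (h : SES_s11 i p) (hX : Pp X B) (hY : Pp Y B) : Pp Z B :=
  ⟨h.dH3 hY.1, h.dE3 hY.2 hX.1⟩
lemma SES_s11.d1 (hC : Her.{w} C) (h : SES_s11 i p) (hY : Pp Y B) (hZ : Pp Z B) : Pp X B :=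
  ⟨h.dH1 hZ.2 hY.1, h.dE1 hC hY.2⟩

lemma pp_image (hC : Her.{w} C) (f : X ⟶ Y) (hX : Pp B X) (hY : Pp B Y) : Pp B (image f) :=
  ⟨(ses_coker f).cH1 hY.1, (ses_ker_s11 f).cE3 hC hX.2⟩
lemma pp_kernel (hC : Her.{w} C) (f : X ⟶ Y) (hX : Pp B X) (hY : Pp B Y) : Pp B (kernel f) :=
  (ses_ker_s11 f).c1 hX (pp_image hC f hX hY)
lemma pp_cokernel (hC : Her.{w} C) (f : X ⟶ Y) (hX : Pp B X) (hY : Pp B Y) : Pp B (cokernel f) :=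
  (ses_coker f).c3 hC (pp_image hC f hX hY) hY
lemma pd_image (hC : Her.{w} C) (f : X ⟶ Y) (hX : Pp X B) (hY : Pp Y B) : Pp (image f) B :=
  ⟨(ses_ker_s11 f).dH3 hX.1, (ses_coker f).dE1 hC hY.2⟩
lemma pd_kernel (hC : Her.{w} C) (f : X ⟶ Y) (hX : Pp X B) (hY : Pp Y B) : Pp (kernel f) B :=
  (ses_ker_s11 f).d1 hC hX (pd_image hC f hX hY)
lemma pd_cokernel (hC : Her.{w} C) (f : X ⟶ Y) (hX : Pp X B) (hY : Pp Y B) : Pp (cokernel f) B :=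
  (ses_coker f).d3 (pd_image hC f hX hY) hY

/-- from kernel and cokernel to the target -/
lemma pp_of_ker_coker (hC : Her.{w} C) (f : X ⟶ Y) (hX : Pp B X) (hK : Pp B (kernel f))
    (hQ : Pp B (cokernel f)) : Pp B Y :=
  (ses_coker f).c2 ((ses_ker_s11 f).c3 hC hK hX) hQ
lemma pd_of_ker_coker (hC : Her.{w} C) (f : X ⟶ Y) (hY : Pp Y B) (hK : Pp (kernel f) B)
    (hQ : Pp (cokernel f) B) : Pp X B :=
  (ses_ker_s11 f).d2 hK ((ses_coker f).d1 hC hY hQ)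

lemma Eo.iso_left {X X' : C} (e : X ≅ X') (h : Eo X B) : Eo X' B := fun x => by
  have : x = (Ext.mk₀ e.inv).comp ((Ext.mk₀ e.hom).comp x (zero_add 1)) (zero_add 1) := by
    rw [Ext.mk₀_comp_mk₀_assoc]; simp
  rw [this, h ((Ext.mk₀ e.hom).comp x (zero_add 1)), Ext.comp_zero]
lemma Eo.iso_right {X X' : C} (e : X ≅ X') (h : Eo B X) : Eo B X' := fun x => by
  have : x = (x.comp (Ext.mk₀ e.inv) (add_zero 1)).comp (Ext.mk₀ e.hom) (add_zero 1) := by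
    rw [Ext.comp_assoc_of_third_deg_zero, Ext.mk₀_comp_mk₀]; simp
  rw [this, h (x.comp (Ext.mk₀ e.inv) (add_zero 1)), Ext.zero_comp]
lemma Ho.iso_left {X X' : C} (e : X ≅ X') (h : Ho X B) : Ho X' B := fun x => by
  rw [← cancel_epi e.hom, h (e.hom ≫ x), comp_zero]
lemma Ho.iso_right {X X' : C} (e : X ≅ X') (h : Ho B X) : Ho B X' := fun x => by
  rw [← cancel_mono e.inv, h (x ≫ e.inv), zero_comp]
lemma Pp.iso {X X' Y Y' : C} (e : X ≅ X') (e' : Y ≅ Y') (h : Pp X Y) : Pp X' Y' :=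
  ⟨(h.1.iso_left e).iso_right e', (h.2.iso_left e).iso_right e'⟩

section bip
variable {n : ℕ} {G : C}

/-- powers -/
noncomputable abbrev pw (n : ℕ) (G : C) : C := ⨁ (fun _ : Fin n => G)

lemma pw_total : ∑ j, biproduct.π (fun _ : Fin n => G) j ≫ biproduct.ι (fun _ : Fin n => G) j
    = 𝟙 (pw n G) := biproduct.total

lemma Eo.pw_right (h : Eo B G) : Eo B (pw n G) := fun x => by
  rw [← Ext.comp_mk₀_id x, ← pw_total, Ext.mk₀_sum, Ext.comp_sum]
  refine Finset.sum_eq_zero fun j _ => ?_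
  rw [← Ext.mk₀_comp_mk₀, ← Ext.comp_assoc_of_third_deg_zero, h (x.comp _ _), Ext.zero_comp]
lemma Eo.pw_left (h : Eo G B) : Eo (pw n G) B := fun x => by
  rw [← Ext.mk₀_id_comp x, ← pw_total, Ext.mk₀_sum, Ext.sum_comp]
  refine Finset.sum_eq_zero fun j _ => ?_
  rw [← Ext.mk₀_comp_mk₀, Ext.comp_assoc _ _ _ (zero_add 0) (zero_add 1) (by simp),
    h (Ext.comp _ x _), Ext.comp_zero]
lemma Ho.pw_right (h : Ho B G) : Ho B (pw n G) := fun x => by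
  ext j; rw [h (x ≫ _), zero_comp]
lemma Ho.pw_left (h : Ho G B) : Ho (pw n G) B := fun x => by
  ext j; rw [h (_ ≫ x), comp_zero]
lemma Pp.pw_right (h : Pp B G) : Pp B (pw n G) := ⟨h.1.pw_right, h.2.pw_right⟩
lemma Pp.pw_left (h : Pp G B) : Pp (pw n G) B := ⟨h.1.pw_left, h.2.pw_left⟩
lemma Eo.of_pw_right (hn : 0 < n) (h : Eo B (pw n G)) : Eo B G := fun x => by
  have : x = (x.comp (Ext.mk₀ (biproduct.ι (fun _ : Fin n => G) ⟨0, hn⟩)) (add_zero 1)).comp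
      (Ext.mk₀ (biproduct.π (fun _ : Fin n => G) ⟨0, hn⟩)) (add_zero 1) := by
    rw [Ext.comp_assoc_of_third_deg_zero, Ext.mk₀_comp_mk₀]; simp
  rw [this, h (x.comp (Ext.mk₀ (biproduct.ι (fun _ : Fin n => G) ⟨0, hn⟩)) (add_zero 1)), Ext.zero_comp]
end bip

/-- realization of extension classes -/
lemma realize [EnoughProjectives C] (ξ : Ext X Y 1) :
    ∃ (E : C) (i : Y ⟶ E) (p : E ⟶ X) (w : i ≫ p = 0) (h : (ShortComplex.mk i p w).ShortExact),
      h.extClass = ξ := by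
  let q := Projective.π X
  have hq : (ShortComplex.mk (kernel.ι q) q (kernel.condition q)).ShortExact :=
    { exact := ShortComplex.exact_kernel q }
  obtain ⟨f, hf⟩ := Ext.contravariant_sequence_exact₃ hq _ ξ
    (Ext.eq_zero_of_projective _) (add_zero 1)
  obtain ⟨f : kernel q ⟶ Y, rfl⟩ := Ext.homEquiv₀.symm.surjective f
  let g : pushout f (kernel.ι q) ⟶ X := pushout.desc 0 q (by simp)
  have g1 : pushout.inl f (kernel.ι q) ≫ g = 0 := pushout.inl_desc _ _ _
  have g2 : pushout.inr f (kernel.ι q) ≫ g = q := pushout.inr_desc _ _ _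
  haveI : Epi g := by
    have : Epi (pushout.inr f (kernel.ι q) ≫ g) := by
      rw [g2]; infer_instance
    exact epi_of_epi (pushout.inr f (kernel.ι q)) _
  have hex : (ShortComplex.mk _ _ g1).Exact := by
    apply ShortComplex.exact_of_g_is_cokernel
    have key : ∀ {W : C} (k : pushout f (kernel.ι q) ⟶ W), pushout.inl f (kernel.ι q) ≫ k = 0 →
        ∃ l : X ⟶ W, g ≫ l = k := by
      intro W k hk
      obtain ⟨l, hl⟩ := SES_s11.desc_coker ⟨_, hq⟩ (pushout.inr f (kernel.ι q) ≫ k)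
        (by rw [← pushout.condition_assoc, hk, comp_zero])
      refine ⟨l, ?_⟩
      apply pushout.hom_ext
      · rw [reassoc_of% g1, zero_comp, hk]
      · rw [reassoc_of% g2, hl]
    refine CokernelCofork.IsColimit.ofπ _ _
      (fun k hk => (key k hk).choose) (fun k hk => (key k hk).choose_spec) ?_
    intro _ k hk m hm
    rw [← cancel_epi g]
    exact hm.trans (key k hk).choose_spec.symm
  have hS : (ShortComplex.mk _ _ g1).ShortExact := { exact := hex }
  refine ⟨_, _, _, g1, hS, ?_⟩
  let φ : ShortComplex.mk (kernel.ι q) q (kernel.condition q) ⟶ ShortComplex.mk _ _ g1 :=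
    { τ₁ := f, τ₂ := pushout.inr _ _, τ₃ := 𝟙 _, comm₁₂ := pushout.condition,
      comm₂₃ := by dsimp; rw [g2, Category.comp_id] }
  have := ShortComplex.ShortExact.extClass_naturality hq hS φ
  rw [← hf]
  refine Eq.trans ?_ this.symm
  exact (Ext.mk₀_id_comp _).symm

lemma eo_iff [EnoughProjectives C] : Eo X Y ↔ ∀ (E : C) (i : Y ⟶ E) (p : E ⟶ X) (w : i ≫ p = 0),
    (ShortComplex.mk i p w).ShortExact → ∃ s : X ⟶ E, s ≫ p = 𝟙 X := by
  constructor
  · intro h E i p w hS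
    exact SES_s11.lift ⟨w, hS⟩ h (𝟙 X)
  · intro h ξ
    obtain ⟨E, i, p, w, hS, rfl⟩ := realize ξ
    obtain ⟨s, hs⟩ := h E i p w hS
    have h2 := hS.comp_extClass
    have h3 := Ext.mk₀_id_comp hS.extClass
    dsimp at h2 h3 ⊢
    rw [← h3, ← hs, ← Ext.mk₀_comp_mk₀,
      Ext.comp_assoc _ _ _ (zero_add 0) (zero_add 1) (by simp), h2, Ext.comp_zero]

lemma Eo.of_projective [Projective X] : Eo X Y := fun e => Ext.eq_zero_of_projective e

end Generic


section Fin

open Limits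
open Abelian (Ext)
attribute [local instance] Abelian.hasFiniteBiproducts

/-- finitely generated -/
abbrev Fg (X : ModuleCat.{u} A) : Prop := Module.Finite A X

/-- The properties of the module category used below. -/
structure Fd (A : Type u) [Ring A] : Prop where
  her : Her.{u} (ModuleCat.{u} A)
  art : IsArtinianRing A
  spanHom : ∀ X Y : ModuleCat.{u} A, Fg X → Fg Y → ∃ (n : ℕ) (f : Fin n → (X ⟶ Y)), ∀ g : X ⟶ Y,
    (∃ d : Fin n → (X ⟶ X), g = ∑ i, d i ≫ f i) ∧ (∃ d : Fin n → (Y ⟶ Y), g = ∑ i, f i ≫ d i)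
  spanExt : ∀ X Y : ModuleCat.{u} A, Fg X → Fg Y → ∃ (n : ℕ) (f : Fin n → Ext X Y 1),
    ∀ g : Ext X Y 1,
    (∃ d : Fin n → (X ⟶ X), g = ∑ i, (Ext.mk₀ (d i)).comp (f i) (zero_add 1)) ∧
    (∃ d : Fin n → (Y ⟶ Y), g = ∑ i, (f i).comp (Ext.mk₀ (d i)) (add_zero 1))
  inj : ∀ P : ModuleCat.{u} A, Fg P → Projective P → Nontrivial P → (∀ f : P ⟶ P, f ≠ 0 → IsIso f) →
    ∃ Y : ModuleCat.{u} A, Fg Y ∧ (∀ B, Eo B Y) ∧ ∀ M : ModuleCat.{u} A, Ho P M ↔ Ho M Y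

section
variable {X Y Z : ModuleCat.{u} A}

lemma Fg.of_mono [IsArtinianRing A] (hY : Fg Y) (f : X ⟶ Y) [Mono f] : Fg X :=
  Module.Finite.of_injective f.hom ((ModuleCat.mono_iff_injective f).1 inferInstance)

lemma Fg.of_epi (hX : Fg X) (f : X ⟶ Y) [Epi f] : Fg Y :=
  Module.Finite.of_surjective f.hom ((ModuleCat.epi_iff_surjective f).1 inferInstance)

lemma Fg.iso (hX : Fg X) (e : X ≅ Y) : Fg Y := hX.of_epi e.hom

lemma Fg.pw {n : ℕ} (hX : Fg X) : Fg (pw n X) := by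
  have : Fg (ModuleCat.of A (Fin n → X)) := inferInstanceAs (Module.Finite A (Fin n → X))
  exact this.iso (ModuleCat.biproductIsoPi (fun _ : Fin n => X)).symm

lemma Fg.ext [IsArtinianRing A] {i : X ⟶ Y} {p : Y ⟶ Z} (h : SES_s11 i p) (hX : Fg X) (hZ : Fg Z) :
    Fg Y := by
  obtain ⟨w, h⟩ := h
  have h1 := (ModuleCat.mono_iff_injective _).1 h.mono_f
  have h2 := (ModuleCat.epi_iff_surjective _).1 h.epi_g
  have h3 := (ShortComplex.ShortExact.moduleCat_exact_iff_function_exact _).1 h.exact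
  haveI : IsNoetherian A X := inferInstance
  haveI : IsNoetherian A Z := inferInstance
  haveI : IsNoetherian A Y := isNoetherian_of_range_eq_ker i.hom p.hom
    (LinearMap.exact_iff.1 h3).symm
  exact inferInstance

lemma exists_free (hX : Fg X) : ∃ (r : ℕ) (q : pw r (ModuleCat.of A A) ⟶ X), Epi q := by
  obtain ⟨r, f, hf⟩ := Module.Finite.exists_fin' A X
  have : Epi (ModuleCat.ofHom f : ModuleCat.of A (Fin r → A) ⟶ X) :=
    (ModuleCat.epi_iff_surjective _).2 hf
  exact ⟨r, (ModuleCat.biproductIsoPi (fun _ : Fin r => ModuleCat.of A A)).hom ≫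
    (ModuleCat.ofHom f : ModuleCat.of A (Fin r → A) ⟶ X), epi_comp _ _⟩

instance projA : Projective (ModuleCat.of A A) := ModuleCat.projective_of_free (Module.Basis.singleton PUnit.{1} A)

lemma fgA : Fg (ModuleCat.of A A) := inferInstanceAs (Module.Finite A A)

instance projpw {n : ℕ} [Projective X] : Projective (pw n X) := by
  constructor
  intro E Z f e he
  refine ⟨biproduct.desc fun j => Projective.factorThru (biproduct.ι (fun _ : Fin n => X) j ≫ f) e, ?_⟩
  apply biproduct.hom_ext'
  intro j
  simp
end

lemma her_of (hA : Hereditary A) : Her.{u} (ModuleCat.{u} A) := by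
  have key : ∀ X Y : ModuleCat.{u} A, Projective Y → ∀ f : X ⟶ Y, Mono f → Projective X := by
    intro X Y hY f hf
    have h1 := hA Y hY (LinearMap.range f.hom)
    refine Projective.of_iso (P := ModuleCat.of A (LinearMap.range f.hom)) ?_ h1
    exact (LinearEquiv.ofInjective f.hom ((ModuleCat.mono_iff_injective f).1 hf)).symm.toModuleIso
  intro X Y e
  have h := ses_of_epi (Projective.π X)
  have := key _ _ inferInstance (kernel.ι (Projective.π X)) inferInstance
  obtain ⟨w, h⟩ := h
  obtain ⟨x, rfl⟩ := Ext.contravariant_sequence_exact₃ h _ e (Ext.eq_zero_of_projective _) (n₀ := 1) rfl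
  rw [Ext.eq_zero_of_projective x, Ext.comp_zero]

section dual
variable (K : Type u) [Field K] (A) [Algebra K A]

/-- the dual of the regular right module -/
def Du : Type u := A →ₗ[K] K

noncomputable instance : AddCommGroup (Du A K) := inferInstanceAs (AddCommGroup (A →ₗ[K] K))

noncomputable instance : Module A (Du A K) where
  smul b φ := LinearMap.comp (show A →ₗ[K] K from φ) (LinearMap.mulRight K b)
  one_smul φ := LinearMap.ext fun a => congrArg (show A →ₗ[K] K from φ) (mul_one a)
  mul_smul b c φ := LinearMap.ext fun a => congrArg (show A →ₗ[K] K from φ) (mul_assoc a b c).symm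
  smul_zero b := rfl
  smul_add b φ ψ := rfl
  add_smul b c φ := LinearMap.ext fun a =>
    (congrArg (show A →ₗ[K] K from φ) (mul_add a b c)).trans (map_add (show A →ₗ[K] K from φ) _ _)
  zero_smul φ := LinearMap.ext fun a =>
    (congrArg (show A →ₗ[K] K from φ) (mul_zero a)).trans (map_zero (show A →ₗ[K] K from φ))

variable {K A}
/-- evaluation -/
def Du.ev (φ : Du A K) : A →ₗ[K] K := φ
lemma Du.ev_smul (b : A) (φ : Du A K) (a : A) : (b • φ).ev a = φ.ev (a * b) := rfl
lemma Du.ev_add (ψ φ : Du A K) (a : A) : (ψ + φ).ev a = ψ.ev a + φ.ev a := rfl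
lemma Du.ext {ψ φ : Du A K} (h : ∀ a, ψ.ev a = φ.ev a) : ψ = φ := LinearMap.ext h
lemma Du.ev_zero (a : A) : (0 : Du A K).ev a = 0 := rfl

variable {M : Type u} [AddCommGroup M] [Module A M] [Module K M] [IsScalarTower K A M]

/-- coinduction -/
def coind (ψ : M →ₗ[K] K) : M →ₗ[A] Du A K where
  toFun m := (ψ.comp ((LinearMap.toSpanSingleton A M m).restrictScalars K) : A →ₗ[K] K)
  map_add' x y := Du.ext fun a => (congrArg ψ (smul_add a x y)).trans (map_add ψ _ _)
  map_smul' b x := Du.ext fun a => congrArg ψ (mul_smul a b x).symm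

lemma coind_ev (ψ : M →ₗ[K] K) (m : M) (a : A) : (coind ψ m).ev a = ψ (a • m) := rfl

lemma coind_surj (f : M →ₗ[A] Du A K) : ∃ ψ : M →ₗ[K] K, f = coind ψ := by
  refine ⟨{ toFun := fun m => (f m).ev 1, map_add' := ?_, map_smul' := ?_ }, ?_⟩
  · intro x y; rw [map_add, Du.ev_add]
  · intro c x
    rw [← algebraMap_smul A c x, map_smul, Du.ev_smul, one_mul, Algebra.algebraMap_eq_smul_one,
      map_smul]; rfl
  · ext m
    apply Du.ext
    intro a
    rw [coind_ev]
    simp [map_smul, Du.ev_smul]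

/-- endomorphism of the dual -/
def Du.lm (e : A) : Du A K →ₗ[A] Du A K where
  toFun φ := φ.ev.comp (LinearMap.mulLeft K e)
  map_add' _ _ := rfl
  map_smul' b φ := Du.ext fun a => congrArg φ.ev (mul_assoc e a b)

lemma Du.lm_ev (e : A) (φ : Du A K) (a : A) : (Du.lm e φ).ev a = φ.ev (e * a) := rfl

open scoped ModuleCat in
lemma Du.injective : Injective (ModuleCat.of A (Du A K)) := by
  constructor
  intro X Y f i hi
  have hinj := (ModuleCat.mono_iff_injective i).1 hi
  letI := ModuleCat.moduleOfAlgebraModule (k := K) X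
  letI := ModuleCat.moduleOfAlgebraModule (k := K) Y
  obtain ⟨ψ, hψ⟩ := coind_surj (K := K) f.hom
  obtain ⟨l, hl⟩ := LinearMap.exists_leftInverse_of_injective (i.hom.restrictScalars K)
    (LinearMap.ker_eq_bot.2 hinj)
  refine ⟨ModuleCat.ofHom (coind (ψ.comp l)), ?_⟩
  ext m
  apply Du.ext
  intro a
  have h1 : l (i.hom (a • m)) = a • m := LinearMap.congr_fun hl (a • m)
  change (coind (ψ.comp l) (i.hom m)).ev a = (f.hom m).ev a
  rw [hψ, coind_ev, coind_ev, ← map_smul, LinearMap.comp_apply, h1]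

end dual

end Fin


section Fin2

open Limits
open Abelian (Ext)
attribute [local instance] Abelian.hasFiniteBiproducts

open scoped ModuleCat in
lemma fin_hom (K : Type u) [Field K] [Algebra K A] [FiniteDimensional K A]
    (X Y : ModuleCat.{u} A) (hX : Fg X) (hY : Fg Y) : Module.Finite K (X ⟶ Y) := by
  haveI : Module.Finite K X := Module.Finite.trans A X
  haveI : Module.Finite K Y := Module.Finite.trans A Y
  let F : (X ⟶ Y) →ₗ[K] (X →ₗ[K] Y) :=
    { toFun := fun f => f.hom.restrictScalars K
      map_add' := fun _ _ => rfl
      map_smul' := fun _ _ => rfl }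
  refine Module.Finite.of_injective F ?_
  intro f g h
  ext x
  exact LinearMap.congr_fun h x

lemma span_hom_s11 (K : Type u) [Field K] [Algebra K A] [FiniteDimensional K A]
    (X Y : ModuleCat.{u} A) (hX : Fg X) (hY : Fg Y) :
    ∃ (n : ℕ) (f : Fin n → (X ⟶ Y)), ∀ g : X ⟶ Y, ∃ c : Fin n → K, g = ∑ i, c i • f i := by
  haveI := fin_hom K X Y hX hY
  obtain ⟨n, f, hf⟩ := Module.Finite.exists_fin (R := K) (M := X ⟶ Y)
  refine ⟨n, f, fun g => ?_⟩
  have : g ∈ Submodule.span K (Set.range f) := hf ▸ Submodule.mem_top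
  obtain ⟨c, hc⟩ := (Submodule.mem_span_range_iff_exists_fun K).1 this
  exact ⟨c, hc.symm⟩

lemma fd_inj (K : Type u) [Field K] [Algebra K A] [FiniteDimensional K A]
    [IsArtinianRing A] (P : ModuleCat.{u} A) (hP : Fg P) (hPp : Projective P) (hn : Nontrivial P)
    (hdiv : ∀ f : P ⟶ P, f ≠ 0 → IsIso f) :
    ∃ Y : ModuleCat.{u} A, Fg Y ∧ (∀ B, Eo B Y) ∧ ∀ M : ModuleCat.{u} A, Ho P M ↔ Ho M Y := by
  obtain ⟨r, q, hq⟩ := exists_free hP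
  let s := Projective.factorThru (𝟙 P) q
  have hs : s ≫ q = 𝟙 P := Projective.factorThru_comp _ _
  have : ∃ j, (s ≫ biproduct.π (fun _ : Fin r => ModuleCat.of A A) j) ≫
      (biproduct.ι (fun _ : Fin r => ModuleCat.of A A) j ≫ q) ≠ 0 := by
    by_contra! hcon
    have h1 : 𝟙 P = 0 := by
      rw [← hs, ← Category.id_comp q, ← pw_total, Preadditive.sum_comp, Preadditive.comp_sum]
      refine Finset.sum_eq_zero fun j _ => ?_
      simpa using hcon j
    obtain ⟨x, hx⟩ := exists_ne (0 : P)
    exact hx (by simpa using! congrArg (fun f : P ⟶ P => f.hom x) h1)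
  obtain ⟨j, hj⟩ := this
  obtain ⟨s, t, hst⟩ : ∃ (s : P ⟶ ModuleCat.of A A) (t : ModuleCat.of A A ⟶ P), s ≫ t = 𝟙 P := by
    haveI := hdiv _ hj
    exact ⟨s ≫ biproduct.π (fun _ : Fin r => ModuleCat.of A A) j,
      (biproduct.ι (fun _ : Fin r => ModuleCat.of A A) j ≫ q) ≫ inv _,
      by rw [← Category.assoc]; exact IsIso.hom_inv_id _⟩
  let e : A := s.hom (t.hom (1 : A))
  have hts : ∀ x : P, t.hom (s.hom x) = x := fun x => congrArg (fun f : P ⟶ P => f.hom x) hst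
  have hta : ∀ a : A, t.hom a = a • t.hom (1 : A) := fun a => by
    rw [← map_smul]; congr 1; exact (mul_one a).symm
  have he : e * e = e := by
    change e • s.hom (t.hom (1 : A)) = e
    rw [← map_smul, ← hta]
    exact congrArg s.hom (hts _)
  have hPM : ∀ M : ModuleCat.{u} A, Ho P M ↔ ∀ m : M, e • m = 0 := by
    intro M
    constructor
    · intro h m
      have h1 := h (s ≫ ModuleCat.ofHom (LinearMap.toSpanSingleton A M m))
      exact congrArg (fun f : P ⟶ M => f.hom (t.hom (1 : A))) h1
    · intro h f
      ext x
      have h1 : t.hom e = t.hom (1 : A) := hts _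
      have h2 : x = (s.hom x : A) • (e • t.hom (1 : A)) := by
        rw [← hta, h1, ← hta, hts]
      change f.hom x = 0
      rw [h2, map_smul, map_smul, h, smul_zero]
  let J := ModuleCat.of A (Du A K)
  haveI : Injective J := Du.injective
  let ε : J ⟶ J := ModuleCat.ofHom (Du.lm e)
  have hε : ε ≫ ε = ε := by
    ext φ
    apply Du.ext
    intro a
    change (φ : Du A K).ev (e * (e * a)) = (φ : Du A K).ev (e * a)
    rw [← mul_assoc, he]
  obtain ⟨Y, i, p, hip, hpi⟩ := IsIdempotentComplete.idempotents_split J ε hε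
  haveI : Epi p := (SplitEpi.mk i hip).epi
  haveI : Injective Y := by
    constructor
    intro X Z f g hg
    refine ⟨Injective.factorThru (f ≫ i) g ≫ p, ?_⟩
    rw [← Category.assoc, Injective.comp_factorThru, Category.assoc, hip, Category.comp_id]
  have hJ : Fg J := by
    letI : Module K J := ModuleCat.moduleOfAlgebraModule (k := K) J
    haveI : IsScalarTower K A J := ModuleCat.isScalarTower_of_algebra_moduleCat (k := K) J
    let F : J →ₗ[K] (A →ₗ[K] K) :=
      { toFun := fun φ => Du.ev φ
        map_add' := fun _ _ => rfl
        map_smul' := fun c φ => by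
          ext a
          have : c • φ = (algebraMap K A c) • φ := (algebraMap_smul A c φ).symm
          rw [this]
          change (φ : Du A K).ev (a * algebraMap K A c) = c • (φ : Du A K).ev a
          rw [← Algebra.commutes, ← Algebra.smul_def, map_smul] }
    haveI : Module.Finite K J := Module.Finite.of_injective F (fun _ _ h => h)
    exact Module.Finite.of_restrictScalars_finite K A J
  refine ⟨Y, hJ.of_epi p, fun B x => Ext.eq_zero_of_injective x, fun M => ?_⟩
  letI : Module K M := ModuleCat.moduleOfAlgebraModule (k := K) M
  haveI : IsScalarTower K A M := ModuleCat.isScalarTower_of_algebra_moduleCat (k := K) M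
  rw [hPM]
  constructor
  · intro h g
    have h1 : g = (g ≫ i) ≫ p := by simp [hip]
    have h2 : (g ≫ i) ≫ ε = 0 := by
      obtain ⟨ψ, hψ⟩ := coind_surj (K := K) (g ≫ i).hom
      ext m
      apply Du.ext
      intro a
      change ((g ≫ i).hom m : Du A K).ev (e * a) = 0
      rw [hψ, coind_ev, mul_smul, h, map_zero]
    have h3 : (g ≫ i) ≫ ε = g ≫ i := by rw [← hpi, Category.assoc, reassoc_of% hip]
    rw [h1, ← h3, h2, zero_comp]
  · intro h m
    by_contra hm
    obtain ⟨ψ, hψ⟩ := Module.Projective.exists_dual_ne_zero K hm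
    apply hψ
    have h1 := h ((ModuleCat.ofHom (coind ψ) : M ⟶ J) ≫ p)
    have h2 : (ModuleCat.ofHom (coind ψ) : M ⟶ J) ≫ ε = 0 := by
      rw [← hpi, ← Category.assoc, h1, zero_comp]
    have h3 := congrArg (fun f : M ⟶ J => Du.ev (K := K) (A := A) (f.hom m) 1) h2
    have h4 : (coind ψ m).ev (e * 1) = 0 := h3
    rwa [coind_ev, mul_one] at h4

lemma fd_of (K : Type u) [Field K] [Algebra K A] [FiniteDimensional K A]
    (hA : Hereditary A) : Fd A := by
  haveI : IsArtinianRing A := IsArtinianRing.of_finite K A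
  have spanHom := span_hom_s11 K (A := A)
  refine ⟨her_of hA, inferInstance, ?_, ?_, fd_inj K⟩
  · intro X Y hX hY
    obtain ⟨n, f, hf⟩ := spanHom X Y hX hY
    refine ⟨n, f, fun g => ?_⟩
    obtain ⟨c, hc⟩ := hf g
    exact ⟨⟨fun i => c i • 𝟙 X, by simpa using! hc⟩, ⟨fun i => c i • 𝟙 Y, by simpa using! hc⟩⟩
  · intro X Y hX hY
    obtain ⟨r, q, hq⟩ := exists_free hX
    obtain ⟨w, hS⟩ := ses_of_epi q
    have hR : Fg (kernel q) := (fgA.pw (n := r)).of_mono (kernel.ι q)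
    obtain ⟨n, f, hf⟩ := spanHom (kernel q) Y hR hY
    refine ⟨n, fun i => hS.extClass.comp (Ext.mk₀ (f i)) (add_zero 1), fun g => ?_⟩
    obtain ⟨x, rfl⟩ := Ext.contravariant_sequence_exact₃ hS _ g (Ext.eq_zero_of_projective _)
      (add_zero 1)
    obtain ⟨x : kernel q ⟶ Y, rfl⟩ := Ext.homEquiv₀.symm.surjective x
    obtain ⟨c, rfl⟩ := hf x
    have key : hS.extClass.comp (Ext.homEquiv₀.symm (∑ i, c i • f i)) (add_zero 1)
        = ∑ i, c i • hS.extClass.comp (Ext.mk₀ (f i)) (add_zero 1) := by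
      change hS.extClass.comp (Ext.mk₀ (∑ i, c i • f i)) (add_zero 1) = _
      rw [Ext.mk₀_sum, Ext.comp_sum]
      simp [Ext.mk₀_smul, Ext.comp_smul]
    rw [key]
    refine ⟨⟨fun i => c i • 𝟙 X, ?_⟩, ⟨fun i => c i • 𝟙 Y, ?_⟩⟩
    · refine Finset.sum_congr rfl fun i _ => ?_
      rw [Ext.mk₀_smul, Ext.smul_comp, Ext.mk₀_id_comp]
    · refine Finset.sum_congr rfl fun i _ => ?_
      rw [Ext.mk₀_smul, Ext.comp_smul, Ext.comp_mk₀_id]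

end Fin2


section Appr

open Limits
open Abelian (Ext)
attribute [local instance] Abelian.hasFiniteBiproducts

lemma min_fam {N D : Type*} [AddCommGroup N] [AddCommGroup D] (act : D →+ N →+ N)
    (hinv : ∀ d : D, d ≠ 0 → ∀ c : D, ∃ (T : D → D) (S : N →+ N),
      ∀ x, S (act d x) = act c x ∧ ∀ b, S (act b x) = act (T b) x)
    (hspan : ∃ (n : ℕ) (f : Fin n → N), ∀ g, ∃ c : Fin n → D, g = ∑ i, act (c i) (f i)) :
    ∃ (n : ℕ) (f : Fin n → N), (∀ g, ∃ c : Fin n → D, g = ∑ i, act (c i) (f i)) ∧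
      ∀ c : Fin n → D, ∑ i, act (c i) (f i) = 0 → ∀ i, c i = 0 := by
  classical
  let P : ℕ → Prop := fun n => ∃ (f : Fin n → N), ∀ g, ∃ c : Fin n → D, g = ∑ i, act (c i) (f i)
  have hP : ∃ n, P n := hspan
  have hmin : ∀ k, P k → Nat.find hP ≤ k := fun k hk => Nat.find_min' hP hk
  have hspec := Nat.find_spec hP
  generalize Nat.find hP = n at hmin hspec
  obtain ⟨f, hf⟩ := hspec
  refine ⟨n, f, hf, fun d hd j => ?_⟩
  by_contra hj
  obtain _ | n := n
  · exact j.elim0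
  have : P n := by
    refine ⟨fun i => f (j.succAbove i), fun g => ?_⟩
    obtain ⟨c, rfl⟩ := hf g
    obtain ⟨T, S, hTS⟩ := hinv (d j) hj (c j)
    have h1 : act (c j) (f j) = - ∑ i, act (T (d (j.succAbove i))) (f (j.succAbove i)) := by
      rw [Fin.sum_univ_succAbove _ j] at hd
      have h2 := congrArg S hd
      rw [map_add, map_zero, (hTS _).1, map_sum] at h2
      rw [eq_neg_of_add_eq_zero_left h2]
      congr 1
      exact Finset.sum_congr rfl fun i _ => (hTS _).2 _
    refine ⟨fun i => c (j.succAbove i) - T (d (j.succAbove i)), ?_⟩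
    rw [Fin.sum_univ_succAbove _ j, h1]
    simp only [map_sub, AddMonoidHom.sub_apply, Finset.sum_sub_distrib]
    abel
  have := hmin n this
  omega

/-- brick -/
def Br (G : ModuleCat.{u} A) : Prop := ∀ f : G ⟶ G, f ≠ 0 → IsIso f

variable {G M : ModuleCat.{u} A}

lemma min_left (hF : Fd A) (hG : Fg G) (hM : Fg M) (hb : Br G) :
    ∃ (n : ℕ) (f : pw n G ⟶ M), (∀ g : G ⟶ M, ∃ d : G ⟶ pw n G, d ≫ f = g) ∧
      ∀ d : G ⟶ pw n G, d ≫ f = 0 → d = 0 := by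
  obtain ⟨n, f, h1, h2⟩ := min_fam (N := (G ⟶ M)) (D := (G ⟶ G))
    (AddMonoidHom.mk' (fun d => AddMonoidHom.mk' (fun x => d ≫ x)
      (fun a b => Preadditive.comp_add (C := ModuleCat.{u} A) _ _ _ _ _ _))
      (fun a b => AddMonoidHom.ext fun x => Preadditive.add_comp (C := ModuleCat.{u} A) _ _ _ _ _ _)) (by
      intro d hd c
      haveI := hb d hd
      refine ⟨fun b => c ≫ inv d ≫ b, AddMonoidHom.mk' (fun y => c ≫ inv d ≫ y) ?_, ?_⟩
      · intro a b; simp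
      · intro x; simp) (by
      obtain ⟨n, f, hf⟩ := hF.spanHom G M hG hM
      exact ⟨n, f, fun g => (hf g).1⟩)
  have key : ∀ d : G ⟶ pw n G, d ≫ biproduct.desc f =
      ∑ i, (d ≫ biproduct.π (fun _ : Fin n => G) i) ≫ f i := by
    intro d
    conv_lhs => rw [← Category.comp_id d, ← pw_total, Preadditive.comp_sum, Preadditive.sum_comp]
    refine Finset.sum_congr rfl fun i _ => ?_
    simp
  refine ⟨n, biproduct.desc f, fun g => ?_, fun d hd => ?_⟩
  · obtain ⟨c, hc⟩ := h1 g
    refine ⟨biproduct.lift c, ?_⟩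
    rw [key, hc]
    refine Finset.sum_congr rfl fun i _ => ?_
    simp
  · rw [key] at hd
    apply biproduct.hom_ext
    intro i
    rw [zero_comp]
    exact h2 _ hd i

lemma min_right (hF : Fd A) (hG : Fg G) (hM : Fg M) (hb : Br G) :
    ∃ (n : ℕ) (f : M ⟶ pw n G), (∀ g : M ⟶ G, ∃ d : pw n G ⟶ G, f ≫ d = g) ∧
      ∀ d : pw n G ⟶ G, f ≫ d = 0 → d = 0 := by
  obtain ⟨n, f, h1, h2⟩ := min_fam (N := (M ⟶ G)) (D := (G ⟶ G))
    (AddMonoidHom.mk' (fun d => AddMonoidHom.mk' (fun x => x ≫ d)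
      (fun a b => Preadditive.add_comp (C := ModuleCat.{u} A) _ _ _ _ _ _))
      (fun a b => AddMonoidHom.ext fun x => Preadditive.comp_add (C := ModuleCat.{u} A) _ _ _ _ _ _)) (by
      intro d hd c
      haveI := hb d hd
      refine ⟨fun b => b ≫ inv d ≫ c, AddMonoidHom.mk' (fun y => y ≫ inv d ≫ c) ?_, ?_⟩
      · intro a b; simp
      · intro x; simp) (by
      obtain ⟨n, f, hf⟩ := hF.spanHom M G hM hG
      exact ⟨n, f, fun g => (hf g).2⟩)
  have key : ∀ d : pw n G ⟶ G, biproduct.lift f ≫ d =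
      ∑ i, f i ≫ (biproduct.ι (fun _ : Fin n => G) i ≫ d) := by
    intro d
    conv_lhs => rw [← Category.id_comp d, ← pw_total, Preadditive.sum_comp, Preadditive.comp_sum]
    refine Finset.sum_congr rfl fun i _ => ?_
    simp
  refine ⟨n, biproduct.lift f, fun g => ?_, fun d hd => ?_⟩
  · obtain ⟨c, hc⟩ := h1 g
    refine ⟨biproduct.desc c, ?_⟩
    rw [key, hc]
    refine Finset.sum_congr rfl fun i _ => ?_
    simp
  · rw [key] at hd
    apply biproduct.hom_ext'
    intro i
    rw [comp_zero]
    exact h2 _ hd i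

/-- exceptional modules via `Ext` -/
structure Ex (G : ModuleCat.{u} A) : Prop where
  fg : Fg G
  eo : Eo G G
  nt : Nontrivial G
  br : Br G

lemma approx (hF : Fd A) (hG : Ex G) (hM : Fg M) (h : Eo G M) :
    ∃ (n : ℕ) (f : pw n G ⟶ M), Pp G (kernel f) ∧ Pp G (cokernel f) := by
  obtain ⟨n, f, h1, h2⟩ := min_left hF hG.fg hM hG.br
  have hi : Eo G (image f) := (ses_ker_s11 f).cE3 hF.her hG.eo.pw_right
  refine ⟨n, f, ⟨fun x => ?_, ?_⟩, ⟨fun x => ?_, ?_⟩⟩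
  · rw [← cancel_mono (kernel.ι f), zero_comp]
    exact h2 _ (by simp)
  · refine (ses_ker_s11 f).cE1' hG.eo.pw_right fun x => ?_
    obtain ⟨d, hd⟩ := h1 (x ≫ image.ι f)
    refine ⟨d, ?_⟩
    rw [← cancel_mono (image.ι f)]
    simpa using hd
  · obtain ⟨y, rfl⟩ := (ses_coker f).lift hi x
    obtain ⟨d, rfl⟩ := h1 y
    simp
  · exact (ses_coker f).cE3 hF.her h

lemma approx' (hF : Fd A) (hG : Ex G) (hM : Fg M) (h : Eo M G) :
    ∃ (n : ℕ) (f : M ⟶ pw n G), Pp (kernel f) G ∧ Pp (cokernel f) G := by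
  obtain ⟨n, f, h1, h2⟩ := min_right hF hG.fg hM hG.br
  have hi : Eo (image f) G := (ses_coker f).dE1 hF.her hG.eo.pw_left
  refine ⟨n, f, ⟨fun x => ?_, ?_⟩, ⟨fun x => ?_, ?_⟩⟩
  · obtain ⟨y, rfl⟩ := (ses_ker_s11 f).desc hi x
    obtain ⟨d, rfl⟩ := h1 y
    simp
  · exact (ses_ker_s11 f).dE1 hF.her h
  · rw [← cancel_epi (cokernel.π f), comp_zero]
    exact h2 _ (by simp)
  · refine (ses_coker f).dE3' hG.eo.pw_left fun x => ?_
    obtain ⟨d, hd⟩ := h1 (factorThruImage f ≫ x)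
    refine ⟨d, ?_⟩
    rw [← cancel_epi (factorThruImage f)]
    simpa using hd

lemma uext (hF : Fd A) (hG : Ex G) (hM : Fg M) :
    ∃ (n : ℕ) (M1 : ModuleCat.{u} A) (i : M ⟶ M1) (p : M1 ⟶ pw n G), SES_s11 i p ∧ Eo G M1 ∧ Fg M1 := by
  obtain ⟨n, x, hx⟩ := hF.spanExt G M hG.fg hM
  let ξ : Ext (pw n G) M 1 :=
    ∑ j, (Ext.mk₀ (biproduct.π (fun _ : Fin n => G) j)).comp (x j) (zero_add 1)
  obtain ⟨M1, i, p, w, hS, hξ⟩ := realize ξ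
  have hS' : SES_s11 i p := ⟨w, hS⟩
  haveI := hF.art
  refine ⟨n, M1, i, p, hS', fun e => ?_, Fg.ext hS' hM hG.fg.pw⟩
  obtain ⟨y, rfl⟩ := Ext.covariant_sequence_exact₂ _ hS e (hG.eo.pw_right _)
  obtain ⟨d, hd⟩ := (hx y).1
  have h1 : y = (Ext.mk₀ (biproduct.lift d : G ⟶ pw n G)).comp hS.extClass (zero_add 1) := by
    rw [hξ, hd, Ext.comp_sum]
    refine Finset.sum_congr rfl fun j _ => ?_
    rw [Ext.mk₀_comp_mk₀_assoc, biproduct.lift_π]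
  have h2 := hS.extClass_comp
  dsimp at h1 h2 ⊢
  rw [h1, Ext.comp_assoc _ _ _ (zero_add 1) (add_zero 1) (by simp), h2, Ext.comp_zero]

lemma uext' (hF : Fd A) (hG : Ex G) (hM : Fg M) :
    ∃ (n : ℕ) (M1 : ModuleCat.{u} A) (i : pw n G ⟶ M1) (p : M1 ⟶ M), SES_s11 i p ∧ Eo M1 G ∧ Fg M1 := by
  obtain ⟨n, x, hx⟩ := hF.spanExt M G hM hG.fg
  let ξ : Ext M (pw n G) 1 :=
    ∑ j, (x j).comp (Ext.mk₀ (biproduct.ι (fun _ : Fin n => G) j)) (add_zero 1)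
  obtain ⟨M1, i, p, w, hS, hξ⟩ := realize ξ
  have hS' : SES_s11 i p := ⟨w, hS⟩
  haveI := hF.art
  refine ⟨n, M1, i, p, hS', fun e => ?_, Fg.ext hS' hG.fg.pw hM⟩
  obtain ⟨y, rfl⟩ := Ext.contravariant_sequence_exact₂ hS _ e (hG.eo.pw_left _)
  obtain ⟨d, hd⟩ := (hx y).2
  have h1 : y = hS.extClass.comp (Ext.mk₀ (biproduct.desc d : pw n G ⟶ G)) (add_zero 1) := by
    rw [hξ, hd, Ext.sum_comp]
    refine Finset.sum_congr rfl fun j _ => ?_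
    rw [Ext.comp_assoc_of_third_deg_zero, Ext.mk₀_comp_mk₀, biproduct.ι_desc]
  have h2 := hS.comp_extClass
  dsimp at h1 h2 ⊢
  rw [h1, ← Ext.comp_assoc _ _ _ (zero_add 1) (add_zero 1) (by simp), h2, Ext.zero_comp]

end Appr


section StepSec

open Limits
open Abelian (Ext)
attribute [local instance] Abelian.hasFiniteBiproducts

variable {M L : ModuleCat.{u} A}

/-- reflection onto the right perpendicular category of the `F i` with `p i`. -/
structure Rf {ι : Type} (F : ι → ModuleCat.{u} A) (p : ι → Prop) (η : M ⟶ L) : Prop where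
  fg : Fg L
  a : ∀ i, p i → Pp (F i) L
  c : ∀ X, (∀ i, p i → Pp (F i) X) → Pp M X → Pp L X
  d : ∀ Y, (∀ i, p i → Pp (F i) Y) → ∀ f : M ⟶ Y, ∃ g, η ≫ g = f
  d' : ∀ Y, (∀ i, p i → Pp (F i) Y) → ∀ g : L ⟶ Y, η ≫ g = 0 → g = 0
  e : ∀ X, (∀ i, p i → Pp X (F i)) → Eo X L → Eo X M
  f : ∀ P, Projective P → (∀ i, p i → Ho P (F i)) → ∀ f : P ⟶ L, ∃ g : P ⟶ M, g ≫ η = f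
  f' : ∀ P, Projective P → (∀ i, p i → Ho P (F i)) → ∀ g : P ⟶ M, g ≫ η = 0 → g = 0

lemma step (hF : Fd A) {G : ModuleCat.{u} A} (hG : Ex G) (hM : Fg M) :
    ∃ (L K : ModuleCat.{u} A) (η : M ⟶ L), Rf (fun _ : Unit => G) (fun _ => True) η ∧
      Fg K ∧ Pp G K ∧ (∀ X, Pp X G → Pp X M → Pp X L ∧ Pp X K) ∧
      (∀ X, Pp X G → Pp X K → Pp X L → Pp X M) := by
  haveI := hF.art
  obtain ⟨n, M1, i, p, hS, hE, hM1⟩ := uext hF hG hM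
  obtain ⟨h, f, hK, hL⟩ := approx hF hG hM1 hE
  have hm := hS.mono
  refine ⟨cokernel f, kernel f, i ≫ cokernel.π f, ?_, hG.fg.pw.of_mono (kernel.ι f), hK, ?_, ?_⟩
  · constructor
    · exact hM1.of_epi (cokernel.π f)
    · exact fun _ _ => hL
    · intro X hX hMX
      have hGX := hX () trivial
      exact pd_cokernel hF.her f hGX.pw_left (hS.d2 hMX hGX.pw_left)
    · intro Y hY g
      have hGY := hY () trivial
      obtain ⟨g1, rfl⟩ := hS.desc hGY.2.pw_left g
      exact ⟨cokernel.desc f g1 (hGY.1.pw_left _), by simp⟩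
    · intro Y hY g hg
      have hGY := hY () trivial
      rw [Category.assoc] at hg
      obtain ⟨g1, h1⟩ := hS.desc_coker _ hg
      rw [← cancel_epi (cokernel.π f), ← h1, hGY.1.pw_left g1, comp_zero, comp_zero]
    · intro X hX hE
      have hXG := hX () trivial
      have h1 : Eo X (image f) := (ses_ker_s11 f).cE3 hF.her hXG.2.pw_right
      exact hS.cE1 ((ses_coker f).cE2 h1 hE) hXG.1.pw_right
    · intro P hP hX g
      have hXG := hX () trivial
      obtain ⟨g1, h1⟩ := hS.lift_ker (Projective.factorThru g (cokernel.π f)) (hXG.pw_right _)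
      refine ⟨g1, ?_⟩
      rw [← Category.assoc, h1, Projective.factorThru_comp]
    · intro P hP hX g hg
      have hXG := hX () trivial
      rw [← Category.assoc] at hg
      obtain ⟨g1, h1⟩ := (ses_coker f).lift_ker _ hg
      rw [← cancel_mono i, ← h1, ← Projective.factorThru_comp g1 (factorThruImage f),
        hXG.pw_right (Projective.factorThru _ _)]
      simp
  · intro X hXG hXM
    have h1 := hS.c2 hXM hXG.pw_right
    exact ⟨pp_cokernel hF.her f hXG.pw_right h1, pp_kernel hF.her f hXG.pw_right h1⟩
  · intro X hXG hXK hXL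
    exact hS.c1 (pp_of_ker_coker hF.her f hXG.pw_right hXK hXL) hXG.pw_right

lemma mutl (hF : Fd A) {G : ModuleCat.{u} A} (hG : Ex G) (hM : Fg M) :
    ∃ (K L : ModuleCat.{u} A), Fg K ∧ Fg L ∧ Pp K G ∧ Pp L G ∧
      (∀ X, Pp G X → Pp M X → Pp K X ∧ Pp L X) ∧
      (∀ X, Pp G X → Pp K X → Pp L X → Pp M X) := by
  haveI := hF.art
  obtain ⟨n, M1, i, p, hS, hE, hM1⟩ := uext' hF hG hM
  obtain ⟨h, f, hK, hL⟩ := approx' hF hG hM1 hE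
  refine ⟨kernel f, cokernel f, hM1.of_mono (kernel.ι f), hG.fg.pw.of_epi (cokernel.π f), hK, hL,
    ?_, ?_⟩
  · intro X hGX hMX
    have h1 := hS.d2 hGX.pw_left hMX
    exact ⟨pd_kernel hF.her f h1 hGX.pw_left, pd_cokernel hF.her f h1 hGX.pw_left⟩
  · intro X hGX hKX hLX
    exact hS.d3 hGX.pw_left (pd_of_ker_coker hF.her f hGX.pw_left hKX hLX)

/-- exceptional sequences via `Ext` -/
structure ES {m : ℕ} (F : Fin m → ModuleCat.{u} A) : Prop where
  ex : ∀ i, Ex (F i)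
  pp : ∀ i j, i < j → Pp (F j) (F i)

lemma iter (hF : Fd A) {m : ℕ} {F : Fin m → ModuleCat.{u} A} (hE : ES F) (hM : Fg M) (s : ℕ) :
    ∀ t : ℕ, m ≤ t + s → ∃ (L : ModuleCat.{u} A) (η : M ⟶ L), Rf F (fun i => t ≤ i.val) η := by
  induction s with
  | zero =>
    intro t ht
    have hno : ∀ i : Fin m, ¬ t ≤ i.val := fun i => by omega
    refine ⟨M, 𝟙 M, ?_⟩
    constructor
    · exact hM
    · exact fun i hi => (hno i hi).elim
    · exact fun _ _ h => h
    · exact fun _ _ f => ⟨f, by simp⟩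
    · exact fun _ _ g hg => by simpa using hg
    · exact fun _ _ h => h
    · exact fun _ _ _ f => ⟨f, by simp⟩
    · exact fun _ _ _ g hg => by simpa using hg
  | succ s ih =>
    intro t ht
    by_cases htm : m ≤ t
    · exact ih t (by omega)
    obtain ⟨L', η', h'⟩ := ih (t + 1) (by omega)
    let i0 : Fin m := ⟨t, by omega⟩
    obtain ⟨L, K, η, h, -, -, h5, -⟩ := step hF (hE.ex i0) h'.fg
    have hsplit : ∀ i : Fin m, t ≤ i.val → i = i0 ∨ t + 1 ≤ i.val := by
      intro i hi
      by_cases hh : t + 1 ≤ i.val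
      · exact Or.inr hh
      · left; ext; simp [i0]; omega
    have hle : ∀ {q : Fin m → Prop}, (∀ i : Fin m, t ≤ i.val → q i) →
      (∀ i : Fin m, t + 1 ≤ i.val → q i) := fun h i hi => h i (by omega)
    have h0 : t ≤ i0.val := le_refl _
    refine ⟨L, η' ≫ η, ?_⟩
    constructor
    · exact h.fg
    · intro i hi
      rcases hsplit i hi with rfl | hi'
      · exact h.a () trivial
      · exact (h5 _ (hE.pp _ _ (by simp [Fin.lt_def, i0]; omega)) (h'.a i hi')).1
    · intro X hX hMX
      exact h.c X (fun _ _ => hX i0 h0) (h'.c X (hle hX) hMX)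
    · intro Y hY f
      obtain ⟨g, rfl⟩ := h'.d Y (hle hY) f
      obtain ⟨k, rfl⟩ := h.d Y (fun _ _ => hY i0 h0) g
      exact ⟨k, by simp⟩
    · intro Y hY g hg
      rw [Category.assoc] at hg
      exact h.d' Y (fun _ _ => hY i0 h0) g (h'.d' Y (hle hY) _ hg)
    · intro X hX hL
      exact h'.e X (hle hX) (h.e X (fun _ _ => hX i0 h0) hL)
    · intro P hP hX f
      obtain ⟨g, rfl⟩ := h.f P hP (fun _ _ => hX i0 h0) f
      obtain ⟨k, rfl⟩ := h'.f P hP (hle hX) g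
      exact ⟨k, by simp⟩
    · intro P hP hX g hg
      rw [← Category.assoc] at hg
      exact h'.f' P hP (hle hX) g (h.f' P hP (fun _ _ => hX i0 h0) _ hg)

lemma iter' (hF : Fd A) {m : ℕ} {F : Fin m → ModuleCat.{u} A} (hE : ES F) (hM : Fg M) (t : ℕ) :
    ∃ (L : ModuleCat.{u} A) (η : M ⟶ L), Rf F (fun i => t ≤ i.val) η :=
  iter hF hE hM m t (by omega)

lemma nt_iff : Nontrivial M ↔ 𝟙 M ≠ 0 := by
  constructor
  · intro h h1
    obtain ⟨x, hx⟩ := exists_ne (0 : M)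
    exact hx (congrArg (fun f : M ⟶ M => f.hom x) h1)
  · intro h
    by_contra hn
    rw [not_nontrivial_iff_subsingleton] at hn
    exact h (by ext x; exact Subsingleton.elim _ _)

lemma minExc [IsArtinianRing A] (Q : ModuleCat.{u} A → Prop) (hfg : ∀ X, Q X → Fg X)
    (hne : ∃ X, Q X ∧ Nontrivial X)
    (himg : ∀ X, Q X → ∀ f : X ⟶ X, Q (image f)) : ∃ X, Q X ∧ Nontrivial X ∧ Br X := by
  let S : Set ℕ∞ := {l | ∃ X, Q X ∧ Nontrivial X ∧ Module.length A X = l}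
  have hS : S.Nonempty := by
    obtain ⟨X, h1, h2⟩ := hne
    exact ⟨_, X, h1, h2, rfl⟩
  obtain ⟨X, h1, h2, h3⟩ := WellFounded.min_mem wellFounded_lt S hS
  refine ⟨X, h1, h2, fun f hf => ?_⟩
  haveI := hfg X h1
  have hi : Nontrivial (image f : ModuleCat.{u} A) := by
    rw [nt_iff]
    intro h
    apply hf
    rw [← image.fac f, ← Category.id_comp (image.ι f), h]
    simp
  have hlen : ¬ Module.length A (image f : ModuleCat.{u} A) < Module.length A X := by
    rw [h3]
    exact WellFounded.not_lt_min wellFounded_lt S ⟨_, himg X h1 f, hi, rfl⟩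
  have hinj : Function.Injective (image.ι f).hom :=
    (ModuleCat.mono_iff_injective _).1 inferInstance
  have hsur : LinearMap.range (image.ι f).hom = ⊤ := by
    by_contra hr
    apply hlen
    rw [(LinearEquiv.ofInjective _ hinj).length_eq]
    exact Submodule.length_lt hr
  haveI : Epi (image.ι f) := (ModuleCat.epi_iff_surjective _).2 (LinearMap.range_eq_top.1 hsur)
  haveI : Epi f := by rw [← image.fac f]; exact epi_comp _ _
  haveI : Mono f := (ModuleCat.mono_iff_injective _).2
    (IsNoetherian.injective_of_surjective_endomorphism f.hom
      ((ModuleCat.epi_iff_surjective _).1 inferInstance))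
  exact isIso_of_mono_of_epi f

end StepSec


section Main

open Limits
open Abelian (Ext)
attribute [local instance] Abelian.hasFiniteBiproducts

variable {M L X Y : ModuleCat.{u} A}

lemma rperp_iff_s11 : rperp X Y ↔ Pp X Y := and_congr Iff.rfl eo_iff.symm

lemma ex_iff : ExceptionalMod X ↔ Ex X :=
  ⟨fun h => ⟨h.1, eo_iff.2 h.2.1, h.2.2.1, h.2.2.2⟩, fun h => ⟨h.fg, eo_iff.1 h.eo, h.nt, h.br⟩⟩

lemma es_iff {n : ℕ} {E : Fin n → ModuleCat.{u} A} : IsExcSeq E ↔ ES E :=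
  ⟨fun h => ⟨fun i => ex_iff.1 (h.1 i), fun i j hij => rperp_iff_s11.1 (h.2 i j hij)⟩,
   fun h => ⟨fun i => ex_iff.2 (h.ex i), fun i j hij => rperp_iff_s11.2 (h.pp i j hij)⟩⟩

/-- complete sequences via `Ext` -/
structure CS {n : ℕ} (E : Fin n → ModuleCat.{u} A) : Prop extends ES E where
  max : ∀ (m : ℕ) (F : Fin m → ModuleCat.{u} A), ES F → m ≤ n

lemma cs_iff {n : ℕ} {E : Fin n → ModuleCat.{u} A} : CompleteES E ↔ CS E :=
  ⟨fun h => ⟨es_iff.1 h.1, fun m F hF => h.2 m F (es_iff.2 hF)⟩,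
   fun h => ⟨es_iff.2 h.toES, fun m F hF => h.max m F (es_iff.1 hF)⟩⟩

lemma ES.insert {n : ℕ} {E : Fin n → ModuleCat.{u} A} (hE : ES E) (hX : Ex X) (p : Fin (n + 1))
    (h1 : ∀ i, Fin.castSucc i < p → Pp X (E i)) (h2 : ∀ i, p ≤ Fin.castSucc i → Pp (E i) X) :
    ES (Fin.insertNth (α := fun _ => ModuleCat.{u} A) p X E) := by
  constructor
  · intro i
    refine Fin.succAboveCases p ?_ ?_ i
    · rw [Fin.insertNth_apply_same]; exact hX
    · intro i; rw [Fin.insertNth_apply_succAbove]; exact hE.ex i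
  · intro i j
    refine Fin.succAboveCases p ?_ ?_ i
    · refine Fin.succAboveCases p ?_ ?_ j
      · intro h; exact (lt_irrefl _ h).elim
      · intro j h
        rw [Fin.insertNth_apply_same, Fin.insertNth_apply_succAbove]
        exact h2 j (Fin.lt_succAbove_iff_le_castSucc _ _ |>.1 h)
    · intro i
      refine Fin.succAboveCases p ?_ ?_ j
      · intro h
        rw [Fin.insertNth_apply_same, Fin.insertNth_apply_succAbove]
        exact h1 i (Fin.succAbove_lt_iff_castSucc_lt _ _ |>.1 h)
      · intro j h
        rw [Fin.insertNth_apply_succAbove, Fin.insertNth_apply_succAbove]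
        exact hE.pp i j ((Fin.strictMono_succAbove p).lt_iff_lt.1 h)

lemma Rf.eo {ι : Type} {F : ι → ModuleCat.{u} A} {p : ι → Prop} {η : M ⟶ L} (h : Rf F p η)
    [Projective M] (hY : ∀ i, p i → Pp (F i) Y) : Eo L Y := by
  rw [eo_iff]
  intro E i q w hS
  have hS' : SES_s11 i q := ⟨w, hS⟩
  haveI := hS'.epi
  obtain ⟨g, hg⟩ := h.d E (fun j hj => hS'.c2 (hY j hj) (h.a j hj)) (Projective.factorThru η q)
  refine ⟨g, ?_⟩
  have := h.d' L h.a (g ≫ q - 𝟙 L) (by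
    rw [Preadditive.comp_sub, ← Category.assoc, hg, Projective.factorThru_comp]; simp)
  exact sub_eq_zero.1 this

lemma gen (hF : Fd A) {n : ℕ} {E : Fin n → ModuleCat.{u} A} (hE : CS E) (hM : ∀ i, Pp (E i) M) :
    𝟙 M = 0 := by
  haveI := hF.art
  by_contra hcon
  rw [← ne_eq, ← nt_iff] at hcon
  obtain ⟨L, η, hL⟩ := iter' hF hE.toES (fgA (A := A)) 0
  obtain ⟨X, ⟨h1, h2, h3⟩, h4, h5⟩ := minExc (A := A) (fun X => Fg X ∧ (∀ i, Pp (E i) X) ∧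
      ∀ Y, (∀ i, Pp (E i) Y) → Eo X Y) (fun X h => h.1)
    ⟨L, ⟨hL.fg, fun i => hL.a i (Nat.zero_le _), fun Y hY => hL.eo fun i _ => hY i⟩, by
      rw [nt_iff]
      intro h0
      obtain ⟨x, hx⟩ := exists_ne (0 : M)
      obtain ⟨g, hg⟩ := hL.d M (fun i _ => hM i) (ModuleCat.ofHom (LinearMap.toSpanSingleton A M x))
      rw [← Category.id_comp g, h0, zero_comp, comp_zero] at hg
      have := congrArg (fun f : ModuleCat.of A A ⟶ M => f.hom (1 : A)) hg
      apply hx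
      simpa using! this.symm⟩
    (by
      rintro X ⟨h1, h2, h3⟩ f
      exact ⟨h1.of_epi (factorThruImage f), fun i => pp_image hF.her f (h2 i) (h2 i),
        fun Y hY => (ses_coker f).dE1 hF.her (h3 Y hY)⟩)
  have := hE.max _ _ (hE.toES.insert ⟨h1, h3 X h2, h4, h5⟩ 0
    (fun i hi => (not_lt_bot hi).elim) (fun i _ => h2 i))
  omega

lemma dev (hF : Fd A) {n : ℕ} {E : Fin n → ModuleCat.{u} A} (hE : CS E) (B : ModuleCat.{u} A)
    (t : ℕ) : (∀ i : Fin n, i.val < t → Pp B (E i)) → ∀ M, Fg M →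
      (∀ i : Fin n, t ≤ i.val → Pp (E i) M) → Pp B M := by
  induction t with
  | zero =>
    intro _ M _ hM
    have h0 := gen hF hE (fun i => hM i (Nat.zero_le _))
    refine ⟨fun f => ?_, fun e => ?_⟩
    · rw [← Category.comp_id f, h0, comp_zero]
    · rw [← Ext.comp_mk₀_id e, h0]; simp
  | succ t ih =>
    intro hB M hfg hM
    have ih' := ih fun i hi => hB i (by omega)
    by_cases ht : n ≤ t
    · exact ih' M hfg fun i hi => by omega
    let i0 : Fin n := ⟨t, by omega⟩
    obtain ⟨L, K, η, h, hK, hGK, h5, h6⟩ := step hF (hE.ex i0) hfg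
    have hsplit : ∀ i : Fin n, t ≤ i.val → i = i0 ∨ t + 1 ≤ i.val := by
      intro i hi
      by_cases hh : t + 1 ≤ i.val
      · exact Or.inr hh
      · left; ext; simp [i0]; omega
    refine h6 B (hB i0 (by simp [i0])) (ih' K hK ?_) (ih' L h.fg ?_)
    · intro i hi
      rcases hsplit i hi with rfl | hi'
      · exact hGK
      · exact (h5 _ (hE.pp _ _ (by simp [Fin.lt_def, i0]; omega)) (hM i hi')).2
    · intro i hi
      rcases hsplit i hi with rfl | hi'
      · exact h.a () trivial
      · exact (h5 _ (hE.pp _ _ (by simp [Fin.lt_def, i0]; omega)) (hM i hi')).1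

lemma projIn_eo {n : ℕ} {E : Fin n → ModuleCat.{u} A} {k : Fin n} (h : ProjIn (Aperp E k) X)
    (hY : ∀ j, k < j → Pp (E j) Y) : Eo X Y := by
  rw [eo_iff]
  intro Z i q w hS
  have hS' : SES_s11 i q := ⟨w, hS⟩
  exact h.2 Z X (fun j hj => rperp_iff_s11.2 (hS'.c2 (hY j hj) (rperp_iff_s11.1 (h.1 j hj)))) h.1 q hS'.epi
    (𝟙 X)

lemma injIn_eo {n : ℕ} {E : Fin n → ModuleCat.{u} A} {k : Fin n} (h : InjIn (Bperp E k) X)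
    (hY : ∀ j, j < k → Pp Y (E j)) : Eo Y X := by
  rw [eo_iff]
  intro Z i q w hS
  have hS' : SES_s11 i q := ⟨w, hS⟩
  have hX : ∀ j, j < k → Pp X (E j) := fun j hj => rperp_iff_s11.1 (h.1 j hj)
  obtain ⟨g, hg⟩ := h.2 X Z h.1 (fun j hj => rperp_iff_s11.2 (hS'.d2 (hX j hj) (hY j hj))) i hS'.mono
    (𝟙 X)
  obtain ⟨s, hs⟩ := hS'.desc_coker (𝟙 Z - g ≫ i) (by
    rw [Preadditive.comp_sub, ← Category.assoc, hg]; simp)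
  haveI := hS'.epi
  refine ⟨s, ?_⟩
  rw [← cancel_epi q, ← Category.assoc, hs, Preadditive.sub_comp, Category.assoc, w]
  simp

lemma hom_ne {n : ℕ} {E E' : Fin n → ModuleCat.{u} A} {k : Fin n} (hE : CS E) (hE' : CS E')
    (hi : ∀ j, j ≠ k → Nonempty (E j ≅ E' j)) (hP' : RelProj E' k) : ¬ Ho (E' k) (E k) := by
  intro hcon
  have := hE.max _ _ (hE.toES.insert (hE'.ex k) k.succ ?_ ?_)
  · omega
  · intro i h
    have h' : i ≤ k := Fin.castSucc_lt_succ_iff.1 h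
    rcases h'.eq_or_lt with rfl | hlt
    · refine ⟨hcon, projIn_eo hP' fun j hj => ?_⟩
      obtain ⟨e⟩ := hi j hj.ne'
      exact (hE.pp _ _ hj).iso e (Iso.refl _)
    · obtain ⟨e⟩ := hi i hlt.ne
      exact (hE'.pp _ _ hlt).iso (Iso.refl _) e.symm
  · intro i h
    have hlt : k < i := by
      rw [Fin.le_def] at h; rw [Fin.lt_def]; simpa using h
    obtain ⟨e⟩ := hi i hlt.ne'
    exact (hE'.pp _ _ hlt).iso e.symm (Iso.refl _)

lemma mono_of_ne (hF : Fd A) {n : ℕ} {E : Fin n → ModuleCat.{u} A} {k : Fin n}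
    (hb : Br X) (hX : ∀ j, k < j → Pp (E j) X) (hY : ∀ j, k < j → Pp (E j) Y)
    (hp : ∀ Z, (∀ j, k < j → Pp (E j) Z) → Eo Y Z) (f : X ⟶ Y) (hf : f ≠ 0) : Mono f := by
  have h1 : Eo (image f) (kernel f) := (ses_coker f).dE1 hF.her
    (hp _ fun j hj => pp_kernel hF.her f (hX j hj) (hY j hj))
  obtain ⟨s, hs⟩ := (ses_ker_s11 f).lift h1 (𝟙 _)
  have hne : factorThruImage f ≫ s ≠ 0 := by
    intro h0
    apply hf
    have h2 : s = 0 := by rw [← cancel_epi (factorThruImage f), h0, comp_zero]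
    rw [h2, zero_comp] at hs
    rw [← image.fac f, ← Category.id_comp (image.ι f), ← hs]
    simp
  have := hb _ hne
  have : Mono (factorThruImage f) := mono_of_mono _ s
  rw [← image.fac f]
  exact mono_comp _ _

lemma uniq (hF : Fd A) {n : ℕ} {E E' : Fin n → ModuleCat.{u} A} {k : Fin n} (hE : CS E)
    (hE' : CS E') (hi : ∀ j, j ≠ k → Nonempty (E j ≅ E' j)) (hP : RelProj E k)
    (hP' : RelProj E' k) : Nonempty (E k ≅ E' k) := by
  have h1 := hom_ne hE hE' hi hP'
  have h2 := hom_ne hE' hE (fun j hj => (hi j hj).map Iso.symm) hP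
  unfold Ho at h1 h2
  push Not at h1 h2
  obtain ⟨g, hg⟩ := h1
  obtain ⟨f, hf⟩ := h2
  have hX : ∀ j, k < j → Pp (E j) (E k) := fun j hj => hE.pp _ _ hj
  have hX' : ∀ j, k < j → Pp (E j) (E' k) := fun j hj => by
    obtain ⟨e⟩ := hi j hj.ne'
    exact (hE'.pp _ _ hj).iso e.symm (Iso.refl _)
  have e1 : ∀ Z, (∀ j, k < j → Pp (E j) Z) → Eo (E k) Z := fun Z hZ => projIn_eo hP hZ
  have e2 : ∀ Z, (∀ j, k < j → Pp (E j) Z) → Eo (E' k) Z := fun Z hZ => projIn_eo hP' fun j hj => by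
    obtain ⟨e⟩ := hi j hj.ne'
    exact (hZ j hj).iso e (Iso.refl _)
  have := mono_of_ne hF (hE.ex k).br hX hX' e2 f hf
  have := mono_of_ne hF (hE'.ex k).br hX' hX e1 g hg
  have hne : f ≫ g ≠ 0 := by
    intro h0
    apply hf
    rw [← cancel_mono g, h0, zero_comp]
  have := (hE.ex k).br _ hne
  have : Epi g := epi_of_epi f g
  have : IsIso g := isIso_of_mono_of_epi g
  exact ⟨(asIso g).symm⟩

end Main


section Parts

open Limits
open Abelian (Ext)
attribute [local instance] Abelian.hasFiniteBiproducts

variable {M L X Y : ModuleCat.{u} A}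

lemma exists_succAbove {m : ℕ} {k j : Fin (m + 1)} (h : j ≠ k) : ∃ i, j = k.succAbove i := by
  obtain ⟨i, hi⟩ := Fin.exists_succAbove_eq h
  exact ⟨i, hi.symm⟩

lemma relProj_of {n : ℕ} (hF : Fd A) {E : Fin n → ModuleCat.{u} A} {k : Fin n}
    (hX : ∀ j, k < j → Pp (E j) X)
    (h : ∀ Y, (∀ j, k < j → Pp (E j) Y) → Eo X Y) : ProjIn (Aperp E k) X := by
  refine ⟨fun j hj => rperp_iff_s11.2 (hX j hj), fun Y Z hY hZ p hp f => ?_⟩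
  exact (ses_of_epi p).lift (h _ fun j hj => pp_kernel hF.her p (rperp_iff_s11.1 (hY j hj))
    (rperp_iff_s11.1 (hZ j hj))) f

lemma relInj_of {n : ℕ} (hF : Fd A) {E : Fin n → ModuleCat.{u} A} {k : Fin n}
    (hX : ∀ j, j < k → Pp X (E j))
    (h : ∀ Y, (∀ j, j < k → Pp Y (E j)) → Eo Y X) : InjIn (Bperp E k) X := by
  refine ⟨fun j hj => rperp_iff_s11.2 (hX j hj), fun Y Z hY hZ p hp f => ?_⟩
  exact (ses_of_mono p).desc (h _ fun j hj => pd_cokernel hF.her p (rperp_iff_s11.1 (hY j hj))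
    (rperp_iff_s11.1 (hZ j hj))) f

lemma Rf.br {ι : Type} {F : ι → ModuleCat.{u} A} {p : ι → Prop} {η : M ⟶ L} (h : Rf F p η)
    [Projective M] (hM : ∀ i, p i → Ho M (F i)) (hb : Br M) : Br L := by
  intro φ hφ
  obtain ⟨g, hg⟩ := h.f M inferInstance hM (η ≫ φ)
  have hg0 : g ≠ 0 := by
    rintro rfl
    rw [zero_comp] at hg
    exact hφ (h.d' L h.a φ hg.symm)
  have := hb g hg0
  obtain ⟨ψ, hψ⟩ := h.d L h.a (inv g ≫ η)
  refine ⟨ψ, ?_, ?_⟩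
  · refine sub_eq_zero.1 (h.d' L h.a _ ?_)
    rw [Preadditive.comp_sub, ← Category.assoc, ← hg, Category.assoc, hψ]
    simp
  · refine sub_eq_zero.1 (h.d' L h.a _ ?_)
    rw [Preadditive.comp_sub, ← Category.assoc, hψ, Category.assoc, ← hg]
    simp

lemma part1 (hF : Fd A) {m : ℕ} {E' : Fin (m + 1) → ModuleCat.{u} A} (hE' : CS E')
    (hP : Projective (E' (Fin.last m))) (k : Fin (m + 1)) :
    ∃ E : Fin (m + 1) → ModuleCat.{u} A, (∀ i, E (k.succAbove i) = E' (Fin.castSucc i)) ∧ CS E ∧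
      RelProj E k ∧ RelInj E k := by
  let F : Fin m → ModuleCat.{u} A := fun i => E' i.castSucc
  let P := E' (Fin.last m)
  haveI : Projective P := hP
  have hFE : ES F := ⟨fun i => hE'.ex _, fun i j hij => hE'.pp _ _ (by simpa using hij)⟩
  have hPF : ∀ i, Pp P (F i) := fun i => hE'.pp _ _ (Fin.castSucc_lt_last i)
  have hPx : Ex P := hE'.ex _
  obtain ⟨X, η, h⟩ := iter' hF hFE hPx.fg k.val
  have hη : η ≠ 0 := by
    intro h0
    exact nt_iff.1 hPx.nt (h.f' P hP (fun i _ => (hPF i).1) (𝟙 P) (by simp [h0]))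
  have hXx : Ex X := by
    refine ⟨h.fg, h.eo h.a, ?_, h.br (fun i _ => (hPF i).1) hPx.br⟩
    rw [nt_iff]
    intro h0
    exact hη (by rw [← Category.comp_id η, h0, comp_zero])
  have hXF : ∀ i, Fin.castSucc i < k → Pp X (F i) := by
    intro i hi
    refine h.c _ (fun j hj => hFE.pp _ _ ?_) (hPF i)
    rw [Fin.lt_def] at hi ⊢
    simp at hi
    omega
  have hFX : ∀ i, k ≤ Fin.castSucc i → Pp (F i) X := fun i hi => h.a i (by
    rw [Fin.le_def] at hi; simpa using hi)
  let E : Fin (m + 1) → ModuleCat.{u} A := Fin.insertNth (α := fun _ => ModuleCat.{u} A) k X F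
  have hEk : E k = X := Fin.insertNth_apply_same _ _ _
  have hEs : ∀ i, E (k.succAbove i) = F i := fun i => Fin.insertNth_apply_succAbove _ _ _ _
  have hE : CS E := ⟨hFE.insert hXx k hXF hFX, hE'.max⟩
  have hA : ∀ Y, (∀ j, k < j → Pp (E j) Y) → ∀ i : Fin m, k.val ≤ i.val → Pp (F i) Y := by
    intro Y hY i hi
    rw [← hEs]
    refine hY _ ((Fin.lt_succAbove_iff_le_castSucc _ _).2 ?_)
    rw [Fin.le_def]; simpa using hi
  have hXA : ∀ j, k < j → Pp (E j) X := fun j hj => by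
    have := hE.pp _ _ hj
    rwa [hEk] at this
  have hXB : ∀ j, j < k → Pp X (E j) := fun j hj => by
    have := hE.pp _ _ hj
    rwa [hEk] at this
  refine ⟨E, hEs, hE, ?_, ?_⟩
  · unfold RelProj
    rw [hEk]
    exact relProj_of hF hXA fun Y hY => h.eo (hA Y hY)
  · unfold RelInj
    rw [hEk]
    refine relInj_of hF hXB fun B hB => ?_
    obtain ⟨Y, hYfg, hYi, hY⟩ := hF.inj P hPx.fg hP hPx.nt hPx.br
    have hFY : ∀ i, Pp (F i) Y := fun i => ⟨(hY _).1 (hPF i).1, hYi _⟩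
    have hXY : ¬ Ho X Y := fun hcon => hη ((hY X).2 hcon η)
    obtain ⟨n, f, hK, hC⟩ := approx hF hXx hYfg (hYi X)
    have hn : 0 < n := by
      by_contra hn
      obtain rfl : n = 0 := by omega
      have hf0 : f = 0 := by
        apply biproduct.hom_ext'
        exact fun j => j.elim0
      have hi0 : image.ι f = 0 := by
        rw [← cancel_epi (factorThruImage f), image.fac, hf0, comp_zero]
      apply hXY
      intro g
      obtain ⟨g', rfl⟩ := (ses_coker f).lift_ker g (hC.1 _)
      rw [hi0, comp_zero]
    have hperp : ∀ i : Fin (m + 1), k.val ≤ i.val → Pp (E i) (kernel f) ∧ Pp (E i) (cokernel f) := by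
      intro i hi
      rcases (Fin.le_def.2 hi : k ≤ i).eq_or_lt with rfl | hlt
      · rw [hEk]; exact ⟨hK, hC⟩
      · have h1 := hXA i hlt
        obtain ⟨i', rfl⟩ := exists_succAbove hlt.ne'
        have h2 := hFY i'
        rw [← hEs] at h2
        exact ⟨pp_kernel hF.her f h1.pw_right h2, pp_cokernel hF.her f h1.pw_right h2⟩
    haveI := hF.art
    have hBK := dev hF hE B k.val (fun i hi => hB i hi) (kernel f)
      (hXx.fg.pw.of_mono (kernel.ι f)) fun i hi => (hperp i hi).1
    have hBC := dev hF hE B k.val (fun i hi => hB i hi) (cokernel f)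
      (hYfg.of_epi (cokernel.π f)) fun i hi => (hperp i hi).2
    have hBI : Eo B (image f) := (ses_coker f).cE1 (hYi B) hBC.1
    exact ((ses_ker_s11 f).cE2 hBK.2 hBI).of_pw_right hn

lemma proj_of_eo [IsArtinianRing A] (hM : Fg M) (h : ∀ B, Fg B → Eo M B) : Projective M := by
  obtain ⟨r, q, hq⟩ := exists_free hM
  obtain ⟨s, hs⟩ := (ses_of_epi q).lift (h _ ((fgA (A := A)).pw.of_mono (kernel.ι q))) (𝟙 M)
  constructor
  intro E Z f e he
  refine ⟨s ≫ Projective.factorThru (q ≫ f) e, ?_⟩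
  rw [Category.assoc, Projective.factorThru_comp, ← Category.assoc, hs, Category.id_comp]

lemma part2a (hF : Fd A) {n : ℕ} {E : Fin n → ModuleCat.{u} A} (hE : ES E) (k : Fin n) (s : ℕ) :
    ∃ M, Fg M ∧ (∀ j, j ≠ k → j.val < k.val + 1 + s → Pp M (E j)) ∧ ¬ Pp M (E k) := by
  induction s with
  | zero =>
    refine ⟨E k, (hE.ex k).fg, fun j hj hlt => hE.pp _ _ ?_, fun hcon =>
      nt_iff.1 (hE.ex k).nt (hcon.1 _)⟩
    rw [Fin.lt_def]
    have : j.val ≠ k.val := fun h => hj (Fin.ext h)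
    omega
  | succ s ih =>
    obtain ⟨M, h1, h2, h3⟩ := ih
    by_cases hs : n ≤ k.val + 1 + s
    · exact ⟨M, h1, fun j hj hlt => h2 j hj (by omega), h3⟩
    let j0 : Fin n := ⟨k.val + 1 + s, by omega⟩
    obtain ⟨K, C, hK, hC, hKG, hCG, h4, h5⟩ := mutl hF (hE.ex j0) h1
    have h6 : ∀ j, j ≠ k → j.val < k.val + 1 + (s + 1) → Pp K (E j) ∧ Pp C (E j) := by
      intro j hj hlt
      by_cases hj0 : j = j0
      · subst hj0; exact ⟨hKG, hCG⟩
      · have h7 : j.val ≠ k.val + 1 + s := fun h => hj0 (Fin.ext h)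
        have h8 : j.val < k.val + 1 + s := by omega
        exact h4 _ (hE.pp _ _ h8) (h2 j hj h8)
    have h7 : Pp (E j0) (E k) := hE.pp _ _ (by rw [Fin.lt_def]; simp [j0]; omega)
    by_cases h8 : Pp K (E k)
    · exact ⟨C, hC, fun j hj hlt => (h6 j hj hlt).2, fun h9 => h3 (h5 _ h7 h8 h9)⟩
    · exact ⟨K, hK, fun j hj hlt => (h6 j hj hlt).1, h8⟩

lemma part2 (hF : Fd A) {m : ℕ} {E : Fin (m + 1) → ModuleCat.{u} A} (hE : CS E) (k : Fin (m + 1))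
    (hP : RelProj E k) (hI : RelInj E k) :
    ∃ E' : Fin (m + 1) → ModuleCat.{u} A, (∀ i, E (k.succAbove i) = E' (Fin.castSucc i)) ∧ CS E' ∧
      Projective (E' (Fin.last m)) := by
  haveI := hF.art
  obtain ⟨M', hM', h1, h2⟩ := part2a hF hE.toES k (m + 1)
  have hp : ∀ j, j ≠ k → Pp M' (E j) := fun j hj => h1 j hj (by omega)
  have hMp : Projective M' := by
    refine proj_of_eo hM' fun M hM => ?_
    obtain ⟨L, η, h⟩ := iter' hF hE.toES hM (k.val + 1)
    refine h.e M' (fun i hi => hp i (by rintro rfl; omega)) ?_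
    have hL : ∀ j, k < j → Pp (E j) L := fun j hj => h.a j hj
    obtain ⟨n, f, hK, hC⟩ := approx hF (hE.ex k) h.fg (projIn_eo hP hL)
    have hMC := dev hF hE M' k.val (fun i hi => hp i (by rintro rfl; omega)) (cokernel f)
      (h.fg.of_epi (cokernel.π f)) (by
        intro i hi
        rcases (Fin.le_def.2 hi : k ≤ i).eq_or_lt with rfl | hlt
        · exact hC
        · exact pp_cokernel hF.her f (hE.pp _ _ hlt).pw_right (hL i hlt))
    have h3 : Eo M' (E k) := injIn_eo hI fun j hj => hp j hj.ne
    exact (ses_coker f).cE2 ((ses_ker_s11 f).cE3 hF.her h3.pw_right) hMC.2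
  have hMn : Nontrivial M' := by
    rw [nt_iff]
    intro h0
    apply h2
    refine ⟨fun f => ?_, Eo.of_projective⟩
    rw [← Category.id_comp f, h0, zero_comp]
  obtain ⟨P, ⟨q1, q2, q3⟩, q4, q5⟩ := minExc (A := A) (fun P => Fg P ∧ (∀ B, Eo P B) ∧
      ∀ j, j ≠ k → Ho P (E j)) (fun X h => h.1)
    ⟨M', ⟨hM', fun B => Eo.of_projective, fun j hj => (hp j hj).1⟩, hMn⟩
    (by
      rintro X ⟨h1, h2, h3⟩ f
      exact ⟨h1.of_epi (factorThruImage f), fun B => (ses_coker f).dE1 hF.her (h2 B),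
        fun j hj => (ses_ker_s11 f).dH3 (h3 j hj)⟩)
  let F : Fin m → ModuleCat.{u} A := fun i => E (k.succAbove i)
  have hFE : ES F := ⟨fun i => hE.ex _, fun i j hij => hE.pp _ _ (Fin.strictMono_succAbove k hij)⟩
  let E' : Fin (m + 1) → ModuleCat.{u} A :=
    Fin.insertNth (α := fun _ => ModuleCat.{u} A) (Fin.last m) P F
  refine ⟨E', fun i => ?_, ⟨hFE.insert ⟨q1, q2 P, q4, q5⟩ (Fin.last m) ?_ ?_, hE.max⟩, ?_⟩
  · have : E' ((Fin.last m).succAbove i) = F i := Fin.insertNth_apply_succAbove _ _ _ _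
    rw [Fin.succAbove_last] at this
    exact this.symm
  · exact fun i _ => ⟨q3 _ (Fin.succAbove_ne k i), q2 _⟩
  · exact fun i hi => (not_lt_of_ge hi (Fin.castSucc_lt_last i)).elim
  · have : E' (Fin.last m) = P := Fin.insertNth_apply_same _ _ _
    rw [this]
    exact proj_of_eo q1 fun B _ => q2 B

lemma count_eq {n : ℕ} (S T : Set (Fin n → ModuleCat.{u} A))
    (R : (Fin n → ModuleCat.{u} A) → (Fin n → ModuleCat.{u} A) → Prop)
    (h1 : ∀ x ∈ S, ∃ y ∈ T, R x y) (h2 : ∀ y ∈ T, ∃ x ∈ S, R x y)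
    (h3 : ∀ x ∈ S, ∀ x' ∈ S, ∀ y ∈ T, ∀ y' ∈ T, R x y → R x' y' →
      ((isoSetoid n).r x x' ↔ (isoSetoid n).r y y')) : isoClassCount S = isoClassCount T := by
  choose f hfT hfR using h1
  unfold isoClassCount
  refine Nat.card_congr (Equiv.ofBijective
    (Quotient.map (fun x : S => (⟨f x.1 x.2, hfT _ _⟩ : T)) ?_) ⟨?_, ?_⟩)
  · intro x x' hx
    exact (h3 _ x.2 _ x'.2 _ (hfT _ x.2) _ (hfT _ x'.2) (hfR _ x.2) (hfR _ x'.2)).1 hx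
  · intro a b
    induction a using Quotient.inductionOn with | _ x => ?_
    induction b using Quotient.inductionOn with | _ x' => ?_
    intro h
    refine Quotient.sound ?_
    have h' := Quotient.exact h
    exact (h3 _ x.2 _ x'.2 _ (hfT _ x.2) _ (hfT _ x'.2) (hfR _ x.2) (hfR _ x'.2)).2 h'
  · intro b
    induction b using Quotient.inductionOn with | _ y => ?_
    obtain ⟨x, hx, hxy⟩ := h2 _ y.2
    refine ⟨Quotient.mk _ ⟨x, hx⟩, Quotient.sound ?_⟩
    exact (h3 _ hx _ hx _ (hfT _ hx) _ y.2 (hfR _ hx) hxy).1 ((isoSetoid n).refl x)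

lemma counts (hF : Fd A) {m : ℕ} (k : Fin (m + 1)) :
    isoClassCount {E : Fin (m + 1) → ModuleCat.{u} A | CompleteES E ∧ RelProj E k ∧ RelInj E k} =
    isoClassCount {E : Fin (m + 1) → ModuleCat.{u} A |
      CompleteES E ∧ Projective (E (Fin.last m))} := by
  refine count_eq _ _ (fun E E' => ∀ i, Nonempty (E (k.succAbove i) ≅ E' (Fin.castSucc i))) ?_ ?_ ?_
  · rintro E ⟨h1, h2, h3⟩
    obtain ⟨E', q1, q2, q3⟩ := part2 hF (cs_iff.1 h1) k h2 h3
    exact ⟨E', ⟨cs_iff.2 q2, q3⟩, fun i => ⟨eqToIso (q1 i)⟩⟩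
  · rintro E' ⟨h1, h2⟩
    obtain ⟨E, q1, q2, q3, q4⟩ := part1 hF (cs_iff.1 h1) h2 k
    exact ⟨E, ⟨cs_iff.2 q2, q3, q4⟩, fun i => ⟨eqToIso (q1 i)⟩⟩
  · rintro E ⟨h1, h2, -⟩ F ⟨h1', h2', -⟩ E' ⟨p1, p2⟩ F' ⟨p1', p2'⟩ hE hF'
    have hlast : ∀ G : Fin (m + 1) → ModuleCat.{u} A, Projective (G (Fin.last m)) →
        RelProj G (Fin.last m) := by
      intro G hG
      exact relProj_of hF (fun j hj => (not_lt_of_ge (Fin.le_last j) hj).elim)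
        fun Y _ => Eo.of_projective
    constructor
    · intro h i
      have hne : ∀ j, j ≠ Fin.last m → Nonempty (E' j ≅ F' j) := by
        intro j hj
        obtain ⟨i, rfl⟩ := Fin.exists_castSucc_eq.2 hj
        exact ⟨(hE i).some.symm ≪≫ (h (k.succAbove i)).some ≪≫ (hF' i).some⟩
      by_cases hi : i = Fin.last m
      · subst hi
        exact uniq hF (cs_iff.1 p1) (cs_iff.1 p1') hne (hlast _ p2) (hlast _ p2')
      · exact hne i hi
    · intro h i
      have hne : ∀ j, j ≠ k → Nonempty (E j ≅ F j) := by
        intro j hj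
        obtain ⟨i, rfl⟩ := exists_succAbove hj
        exact ⟨(hE i).some ≪≫ (h i.castSucc).some ≪≫ (hF' i).some.symm⟩
      by_cases hi : i = k
      · subst hi
        exact uniq hF (cs_iff.1 h1) (cs_iff.1 h1') hne h2 h2'
      · exact hne i hi

end Parts

/-- Over a (Dynkin type) finite-dimensional hereditary algebra with
Coxeter number `h`, granting Ringel's theorem that the proportion of complete exceptional
sequences whose last term is projective is `2/h`, the probability that the `k`-th term of
a uniformly random complete exceptional sequence is both relatively projective and
relatively injective is also `2/h`, for every `k`. -/
theorem stmt11 {K : Type u} [Field K] {A : Type u} [Ring A] [Algebra K A]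
    [FiniteDimensional K A] (hA : Hereditary A)
    {m : ℕ} (k : Fin (m + 1)) (h : ℕ) (hh : 0 < h)
    (ringel :
      (isoClassCount {E : Fin (m + 1) → ModuleCat.{u} A |
          CompleteES E ∧ Projective (E (Fin.last m))} : ℚ) /
        (isoClassCount {E : Fin (m + 1) → ModuleCat.{u} A | CompleteES E} : ℚ)
        = 2 / (h : ℚ)) :
    (isoClassCount {E : Fin (m + 1) → ModuleCat.{u} A |
        CompleteES E ∧ RelProj E k ∧ RelInj E k} : ℚ) /
      (isoClassCount {E : Fin (m + 1) → ModuleCat.{u} A | CompleteES E} : ℚ)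
      = 2 / (h : ℚ) := by
  rw [counts (fd_of K hA) k]
  exact ringel

end ExcSeq
end
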